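/- arXiv:1306.0758 — 3 statements merged into one kernel-verified Lean document; each statement's English description precedes it below -/
import Mathlib

section
/- Let k and n be positive integers such that 8 ≤ 2k ≤ n < (k+1)^3, and suppose (n,k) does not belong to the set {(8,4), (10,5), (12,6), (16,8)}. Then for every choice of nonzero integers a_0, a_1, …, a_k each of which has all of its prime factors ≤ k, the polynomial F_{n,k}(x) = ∑_{j=0}^{k} a_j c_j x^j is irreducible over ℚ. -/
open Polynomial

/-- `c n k j = (−1)^{k−j} C(n,j) C(n−j−1, k−j)`, the `j`-th coefficient of `P_{n,k}(x−1)`. -/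
def c (n k j : ℕ) : ℤ :=
  (-1) ^ (k - j) * (n.choose j : ℤ) * ((n - j - 1).choose (k - j) : ℤ)

/-- `F n k a = ∑_{j=0}^{k} a_j c_j x^j` as a polynomial over `ℚ`. -/
noncomputable def F (n k : ℕ) (a : ℕ → ℤ) : Polynomial ℚ :=
  ∑ j ∈ Finset.range (k + 1), Polynomial.C ((a j * c n k j : ℤ) : ℚ) * Polynomial.X ^ j


/-! ### Newton polygon argument -/

lemma np_bottom (p : ℤ) (hp : Prime p) (f g h : ℤ[X]) (hf : f = g * h) (i : ℕ)
    (hi : ¬ p ∣ f.coeff i) (hj : ∀ j, j ≠ i → p ∣ f.coeff j) :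
    ∃ r s, r + s = i ∧ (∀ j < r, p ∣ g.coeff j) ∧ (∀ j < s, p ∣ h.coeff j) ∧
      ¬ p ∣ g.coeff r ∧ ¬ p ∣ h.coeff s := by
  classical
  have hg : ∃ r, ¬ p ∣ g.coeff r := by
    by_contra hcon
    push Not at hcon
    apply hi
    rw [hf, coeff_mul]
    exact Finset.dvd_sum fun x _ => Dvd.dvd.mul_right (hcon _) _
  have hh : ∃ r, ¬ p ∣ h.coeff r := by
    by_contra hcon
    push Not at hcon
    apply hi
    rw [hf, coeff_mul]
    exact Finset.dvd_sum fun x _ => Dvd.dvd.mul_left (hcon _) _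
  refine ⟨Nat.find hg, Nat.find hh, ?_, fun j hj => ?_, fun j hj => ?_, Nat.find_spec hg,
    Nat.find_spec hh⟩
  · by_contra hne
    have h1 := hj _ hne
    rw [hf, coeff_mul] at h1
    have hmem : (Nat.find hg, Nat.find hh) ∈
        Finset.HasAntidiagonal.antidiagonal (Nat.find hg + Nat.find hh) := by simp
    rw [← Finset.add_sum_erase _ _ hmem] at h1
    have h2 : p ∣ ∑ x ∈ (Finset.HasAntidiagonal.antidiagonal (Nat.find hg + Nat.find hh)).erase
        (Nat.find hg, Nat.find hh), g.coeff x.1 * h.coeff x.2 := by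
      apply Finset.dvd_sum
      rintro ⟨a, b⟩ hx
      simp only [Finset.mem_erase, Finset.HasAntidiagonal.mem_antidiagonal, ne_eq, Prod.mk.injEq] at hx
      rcases lt_or_ge a (Nat.find hg) with h | h
      · exact Dvd.dvd.mul_right (by simpa using Nat.find_min hg h) _
      · have hb : b < Nat.find hh := by
          by_contra hb
          apply hx.1
          omega
        exact Dvd.dvd.mul_left (by simpa using Nat.find_min hh hb) _
    have h3 := (dvd_add_left h2).1 h1
    rcases hp.dvd_or_dvd h3 with h | h
    · exact Nat.find_spec hg h
    · exact Nat.find_spec hh h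
  · simpa using Nat.find_min hg hj
  · simpa using Nat.find_min hh hj

/-- case `e = 1`. -/
lemma np_one (p : ℤ) (f g h : ℤ[X]) (hf : f = g * h) (r s : ℕ)
    (h0 : 0 < r + s → ¬ p ^ 2 ∣ f.coeff 0) (hg : ∀ j < r, p ∣ g.coeff j)
    (hh : ∀ j < s, p ∣ h.coeff j) : r = 0 ∨ s = 0 := by
  by_contra hcon
  push Not at hcon
  apply h0 (by omega)
  rw [hf, mul_coeff_zero, pow_two]
  exact mul_dvd_mul (hg 0 (by omega)) (hh 0 (by omega))

lemma np_two_aux (p : ℤ) (hp : Prime p) (f g h : ℤ[X]) (hf : f = g * h) (r s : ℕ)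
    (hj : ∀ j, j ≠ r + s → p ^ 2 ∣ f.coeff j)
    (h0 : 0 < r + s → ¬ p ^ 3 ∣ f.coeff 0) (hg : ∀ j < r, p ∣ g.coeff j)
    (hh : ∀ j < s, p ∣ h.coeff j) (hgr : ¬ p ∣ g.coeff r) (hr : 0 < r) (hrs : r < s) : False := by
  have h1 := hj r (by omega)
  rw [hf, coeff_mul] at h1
  have hmem : (r, 0) ∈ Finset.HasAntidiagonal.antidiagonal r := by simp
  rw [← Finset.add_sum_erase _ _ hmem] at h1
  have h2 : p ^ 2 ∣ ∑ x ∈ (Finset.HasAntidiagonal.antidiagonal r).erase (r, 0), g.coeff x.1 * h.coeff x.2 := by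
    apply Finset.dvd_sum
    rintro ⟨a, b⟩ hx
    simp only [Finset.mem_erase, Finset.HasAntidiagonal.mem_antidiagonal, ne_eq, Prod.mk.injEq] at hx
    rw [pow_two]
    exact mul_dvd_mul (hg _ (by omega)) (hh _ (by omega))
  have h3 := (dvd_add_left h2).1 h1
  have h4 : p ^ 2 ∣ h.coeff 0 := hp.pow_dvd_of_dvd_mul_left 2 hgr h3
  apply h0 (by omega)
  rw [hf, mul_coeff_zero, pow_succ']
  exact mul_dvd_mul (hg 0 hr) h4

lemma np_two (p : ℤ) (hp : Prime p) (f g h : ℤ[X]) (hf : f = g * h) (r s : ℕ)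
    (hj : ∀ j, j ≠ r + s → p ^ 2 ∣ f.coeff j)
    (h0 : 0 < r + s → ¬ p ^ 3 ∣ f.coeff 0) (hg : ∀ j < r, p ∣ g.coeff j)
    (hh : ∀ j < s, p ∣ h.coeff j) (hgr : ¬ p ∣ g.coeff r) (hhs : ¬ p ∣ h.coeff s) :
    r = 0 ∨ s = 0 ∨ r = s := by
  by_contra hcon
  push Not at hcon
  rcases lt_or_gt_of_ne hcon.2.2 with hlt | hlt
  · exact np_two_aux p hp f g h hf r s hj h0 hg hh hgr (by omega) hlt
  · exact np_two_aux p hp f h g (by rw [hf, mul_comm]) s r (by rwa [add_comm]) (by rwa [add_comm])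
      hh hg hhs (by omega) hlt

lemma np_full (p : ℤ) (hp : Prime p) (f g h : ℤ[X]) (hf : f = g * h) (i k : ℕ)
    (hk : f.natDegree = k) (hik : i ≤ k) (hf0 : f.coeff 0 ≠ 0)
    (hi : ¬ p ∣ f.coeff i) (hj : ∀ j, j ≤ k → j ≠ i → p ∣ f.coeff j) :
    ∃ r t, g.natDegree = r + t ∧ r ≤ i ∧ t ≤ k - i ∧
      ((∀ j, j ≤ k → j ≠ i → ¬ p ^ 2 ∣ f.coeff j) → (r = 0 ∨ r = i) ∧ (t = 0 ∨ t = k - i)) ∧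
      ((∀ j, j ≤ k → j ≠ i → p ^ 2 ∣ f.coeff j ∧ ¬ p ^ 3 ∣ f.coeff j) →
        (r = 0 ∨ r = i ∨ 2 * r = i) ∧ (t = 0 ∨ t = k - i ∨ 2 * t = k - i)) := by
  have hfne : f ≠ 0 := by rintro rfl; simp at hf0
  have hgne : g ≠ 0 := by rintro rfl; simp [hf] at hfne
  have hhne : h ≠ 0 := by rintro rfl; simp [hf] at hfne
  have hdeg : g.natDegree + h.natDegree = k := by rw [← hk, hf, natDegree_mul hgne hhne]
  have hrev : f.reverse = g.reverse * h.reverse := by rw [hf, reverse_mul_of_domain]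
  have hrc : ∀ j ≤ k, f.reverse.coeff j = f.coeff (k - j) := by
    intro j hj; rw [coeff_reverse, hk, revAt_le hj]
  have hrc' : ∀ j, k < j → f.reverse.coeff j = 0 := by
    intro j hj
    apply coeff_eq_zero_of_natDegree_lt
    have := reverse_natDegree_le f
    omega
  have hfc' : ∀ j, k < j → f.coeff j = 0 := by
    intro j hj
    apply coeff_eq_zero_of_natDegree_lt
    omega
  have hall : ∀ q : ℤ, (∀ j, j ≤ k → j ≠ i → q ∣ f.coeff j) → ∀ j, j ≠ i → q ∣ f.coeff j := by
    intro q hq j hj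
    rcases le_or_gt j k with h | h
    · exact hq j h hj
    · rw [hfc' j h]; exact dvd_zero _
  have hall' : ∀ q : ℤ, (∀ j, j ≤ k → j ≠ i → q ∣ f.coeff j) →
      ∀ j, j ≠ k - i → q ∣ f.reverse.coeff j := by
    intro q hq j hj
    rcases le_or_gt j k with h | h
    · rw [hrc j h]; exact hq _ (by omega) (by omega)
    · rw [hrc' j h]; exact dvd_zero _
  obtain ⟨r, s, hrs, a1, a2, a3, a4⟩ := np_bottom p hp f g h hf i hi (hall p hj)
  obtain ⟨t, u, htu, b1, b2, b3, b4⟩ := np_bottom p hp _ _ _ hrev (k - i)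
    (by rw [hrc _ (by omega)]; rwa [show k - (k - i) = i by omega]) (hall' p hj)
  have ht : t ≤ g.natDegree := by
    by_contra hcon
    apply b3
    rw [coeff_eq_zero_of_natDegree_lt]; · exact dvd_zero _
    have := reverse_natDegree_le g
    omega
  have hu : u ≤ h.natDegree := by
    by_contra hcon
    apply b4
    rw [coeff_eq_zero_of_natDegree_lt]; · exact dvd_zero _
    have := reverse_natDegree_le h
    omega
  have c1 : r ≤ g.natDegree - t := by
    by_contra hcon
    apply b3
    rw [coeff_reverse, revAt_le ht]
    exact a1 _ (by omega)
  have c2 : s ≤ h.natDegree - u := by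
    by_contra hcon
    apply b4
    rw [coeff_reverse, revAt_le hu]
    exact a2 _ (by omega)
  refine ⟨r, t, by omega, by omega, by omega, fun H => ?_, fun H => ?_⟩
  · have e1 := np_one p f g h hf r s (fun h => H 0 (by omega) (by omega)) a1 a2
    have e2 := np_one p _ _ _ hrev t u (fun h => by
      rw [hrc 0 (by omega)]; exact H _ (by omega) (by omega)) b1 b2
    omega
  · have e1 := np_two p hp f g h hf r s (by rw [hrs]; exact hall _ fun j h1 h2 => (H j h1 h2).1)
      (fun h => (H 0 (by omega) (by omega)).2) a1 a2 a3 a4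
    have e2 := np_two p hp _ _ _ hrev t u
      (by rw [htu]; exact hall' _ fun j h1 h2 => (H j h1 h2).1) (fun h => by
      rw [hrc 0 (by omega)]; exact (H _ (by omega) (by omega)).2) b1 b2 b3 b4
    omega

/-! ### Coefficients -/

/-- The constraints on the degree `d` of a factor given by the Newton polygons at primes `p > k`. -/
def Constr (n k d : ℕ) : Prop :=
  ∀ i ≤ k, ∀ p : ℕ, p.Prime → k < p → p ∣ n - i →
    (¬ p ^ 2 ∣ n - i → d = i ∨ d + i = k) ∧
    (p ^ 2 ∣ n - i → ∃ r t, d = r + t ∧ (r = 0 ∨ r = i ∨ 2 * r = i) ∧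
      (t = 0 ∨ t = k - i ∨ 2 * t = k - i))

/-- absolute value of the coefficient -/
def cAbs (n k j : ℕ) : ℕ := n.choose j * (n - j - 1).choose (k - j)

lemma c_eq (n k j : ℕ) : c n k j = (-1) ^ (k - j) * (cAbs n k j : ℤ) := by
  simp [c, cAbs, mul_assoc]

lemma cAbs_mul (n k j : ℕ) (hkn : k < n) (hj : j ≤ k) :
    cAbs n k j * (j.factorial * (k - j).factorial) * (n - j) = n.descFactorial (k + 1) := by
  have h1 : n.choose j * j.factorial = n.descFactorial j := by
    rw [Nat.descFactorial_eq_factorial_mul_choose, mul_comm]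
  have h2 : (n - j - 1).choose (k - j) * (k - j).factorial = (n - j - 1).descFactorial (k - j) := by
    rw [Nat.descFactorial_eq_factorial_mul_choose, mul_comm]
  have h3 : (n - j) * (n - j - 1).descFactorial (k - j) = (n - j).descFactorial (k - j + 1) := by
    obtain ⟨m, hm⟩ : ∃ m, n - j = m + 1 := ⟨n - j - 1, by omega⟩
    rw [hm, Nat.add_sub_cancel, Nat.succ_descFactorial_succ]
  have h4 : (n - j).descFactorial (k - j + 1) * n.descFactorial j = n.descFactorial (k + 1) := by
    have := Nat.descFactorial_mul_descFactorial (n := n) (k := j) (m := k + 1) (by omega)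
    rw [← this]
    congr 2
    omega
  rw [← h4, ← h3, ← h2, ← h1, cAbs]
  ring

lemma not_dvd_other {n k i j p : ℕ} (hkn : k < n) (hi : i ≤ k) (hj : j ≤ k) (hij : j ≠ i)
    (hkp : k < p) (hpi : p ∣ n - i) : ¬ p ∣ n - j := by
  intro hpj
  rcases lt_or_gt_of_ne hij with h | h
  · have : p ∣ i - j := by
      have := Nat.dvd_sub hpj hpi
      rwa [show n - j - (n - i) = i - j by omega] at this
    have := Nat.le_of_dvd (by omega) this
    omega
  · have : p ∣ j - i := by
      have := Nat.dvd_sub hpi hpj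
      rwa [show n - i - (n - j) = j - i by omega] at this
    have := Nat.le_of_dvd (by omega) this
    omega

lemma desc_split (n k i : ℕ) (hi : i ≤ k) :
    n.descFactorial (k + 1) = (n - i) * ∏ l ∈ (Finset.range (k + 1)).erase i, (n - l) := by
  rw [Nat.descFactorial_eq_prod_range,
    Finset.mul_prod_erase _ (fun l => n - l) (Finset.mem_range.2 (by omega))]

lemma cAbs_dvd_iff {n k i j p e : ℕ} (hkn : k < n) (hi : i ≤ k) (hj : j ≤ k) (hij : j ≠ i)
    (hp : p.Prime) (hkp : k < p) (hpi : p ∣ n - i) : p ^ e ∣ cAbs n k j ↔ p ^ e ∣ n - i := by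
  have hcop : ∀ m, ¬ p ∣ m → Nat.Coprime (p ^ e) m := fun m hm =>
    Nat.Coprime.pow_left e ((Nat.Prime.coprime_iff_not_dvd hp).2 hm)
  have h1 := cAbs_mul n k j hkn hj
  rw [desc_split n k i hi] at h1
  have hW : ¬ p ∣ ∏ l ∈ (Finset.range (k + 1)).erase i, (n - l) := by
    rw [hp.prime.dvd_finsetProd_iff]
    rintro ⟨l, hl, hpl⟩
    simp only [Finset.mem_erase, Finset.mem_range] at hl
    exact not_dvd_other hkn hi (by omega) hl.1 hkp hpi hpl
  have hf : ¬ p ∣ j.factorial * (k - j).factorial := by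
    rw [hp.dvd_mul, hp.dvd_factorial, hp.dvd_factorial]
    omega
  have hnj := not_dvd_other hkn hi hj hij hkp hpi
  constructor
  · intro h
    apply (hcop _ hW).dvd_of_dvd_mul_right
    rw [← h1, mul_assoc]
    exact Dvd.dvd.mul_right h _
  · intro h
    apply (hcop _ hf).dvd_of_dvd_mul_right
    apply (hcop _ hnj).dvd_of_dvd_mul_right
    rw [h1]
    exact Dvd.dvd.mul_right h _

lemma cAbs_not_dvd {n k i p : ℕ} (hkn : k < n) (hi : i ≤ k)
    (hp : p.Prime) (hkp : k < p) (hpi : p ∣ n - i) : ¬ p ∣ cAbs n k i := by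
  intro hcon
  have h1 := cAbs_mul n k i hkn hi
  rw [desc_split n k i hi, mul_comm] at h1
  have h2 := Nat.eq_of_mul_eq_mul_left (by omega) h1
  have hW : ¬ p ∣ ∏ l ∈ (Finset.range (k + 1)).erase i, (n - l) := by
    rw [hp.prime.dvd_finsetProd_iff]
    rintro ⟨l, hl, hpl⟩
    simp only [Finset.mem_erase, Finset.mem_range] at hl
    exact not_dvd_other hkn hi (by omega) hl.1 hkp hpi hpl
  apply hW
  rw [← h2]
  exact Dvd.dvd.mul_right hcon _

lemma cAbs_ne_zero {n k j : ℕ} (hkn : k < n) (hj : j ≤ k) : cAbs n k j ≠ 0 := by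
  have h1 := cAbs_mul n k j hkn hj
  intro h
  rw [h] at h1
  simp only [zero_mul] at h1
  have := Nat.descFactorial_eq_zero_iff_lt.1 h1.symm
  omega

/-- the integral version of `F` -/
noncomputable def FZ (n k : ℕ) (a : ℕ → ℤ) : ℤ[X] :=
  ∑ j ∈ Finset.range (k + 1), Polynomial.C (a j * c n k j : ℤ) * Polynomial.X ^ j

lemma FZ_map (n k : ℕ) (a : ℕ → ℤ) : (FZ n k a).map (Int.castRingHom ℚ) = F n k a := by
  simp [FZ, F, Polynomial.map_sum]

lemma FZ_coeff (n k : ℕ) (a : ℕ → ℤ) (j : ℕ) (hj : j ≤ k) :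
    (FZ n k a).coeff j = a j * c n k j := by
  simp only [FZ, finsetSum_coeff, coeff_C_mul, coeff_X_pow]
  rw [Finset.sum_eq_single j]
  · simp
  · intro b _ hb; simp [hb.symm]
  · intro h; simp at h; omega

lemma FZ_natDegree (n k : ℕ) (a : ℕ → ℤ) (hkn : k < n) (ha : a k ≠ 0) :
    (FZ n k a).natDegree = k := by
  apply le_antisymm
  · apply natDegree_sum_le_of_forall_le
    intro j hj
    refine (natDegree_C_mul_X_pow_le _ _).trans ?_
    simp at hj; omega
  · apply le_natDegree_of_ne_zero
    rw [FZ_coeff _ _ _ _ le_rfl, c_eq]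
    have := cAbs_ne_zero hkn le_rfl
    simp [ha, this]

lemma pow_dvd_coeff (n k : ℕ) (a : ℕ → ℤ) (j : ℕ) (hj : j ≤ k) (p e : ℕ) (hp : p.Prime)
    (haj : ¬ (p : ℤ) ∣ a j) : (p : ℤ) ^ e ∣ (FZ n k a).coeff j ↔ p ^ e ∣ cAbs n k j := by
  rw [FZ_coeff _ _ _ _ hj, c_eq]
  have h1 : IsCoprime ((p : ℤ) ^ e) (a j) :=
    IsCoprime.pow_left ((Nat.prime_iff_prime_int.1 hp).coprime_iff_not_dvd.2 haj)
  have h3 : ∀ z : ℤ, (p : ℤ) ^ e ∣ a j * z ↔ (p : ℤ) ^ e ∣ z :=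
    fun z => ⟨fun h => h1.dvd_of_dvd_mul_left h, fun h => Dvd.dvd.mul_left h _⟩
  rw [h3]
  have h2 : IsUnit ((-1 : ℤ) ^ (k - j)) := IsUnit.pow _ (by simp)
  rw [h2.dvd_mul_left]
  exact_mod_cast Int.natCast_dvd_natCast (m := p ^ e) (n := cAbs n k j)

lemma factor_constr (n k : ℕ) (a : ℕ → ℤ) (hkn : k < n) (h3 : n < (k + 1) ^ 3)
    (ha : ∀ j ≤ k, a j ≠ 0 ∧ ∀ p : ℕ, p.Prime → (p : ℤ) ∣ a j → p ≤ k) (g h : ℤ[X])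
    (hgh : FZ n k a = g * h) (hg0 : 0 < g.natDegree) (hh0 : 0 < h.natDegree) :
    Constr n k g.natDegree := by
  intro i hi p hp hkp hpi
  have hap : ∀ j ≤ k, ¬ (p : ℤ) ∣ a j := fun j hj hd => by
    have := (ha j hj).2 p hp hd
    omega
  have hdeg := FZ_natDegree n k a hkn (ha k le_rfl).1
  have hne : FZ n k a ≠ 0 := by
    intro h0
    rw [h0] at hdeg; simp at hdeg
    subst hdeg
    have := FZ_coeff n 0 a 0 le_rfl
    rw [h0, c_eq] at this
    have h1 := cAbs_ne_zero hkn (le_refl 0)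
    simp [h1] at this
    exact (ha 0 le_rfl).1 this
  have hsum : g.natDegree + h.natDegree = k := by
    rw [← hdeg, hgh, natDegree_mul]
    · rintro rfl; simp at hg0
    · rintro rfl; simp at hh0
  have hf0 : (FZ n k a).coeff 0 ≠ 0 := by
    rw [FZ_coeff _ _ _ _ (by omega), c_eq]
    have h1 := cAbs_ne_zero hkn (Nat.zero_le k)
    simp [h1, (ha 0 (by omega)).1]
  have hpow : ∀ e, ∀ j ≤ k, j ≠ i → ((p : ℤ) ^ e ∣ (FZ n k a).coeff j ↔ p ^ e ∣ n - i) := by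
    intro e j hj hji
    rw [pow_dvd_coeff n k a j hj p e hp (hap j hj), cAbs_dvd_iff hkn hi hj hji hp hkp hpi]
  obtain ⟨r, t, hrt, hr, ht, H1, H2⟩ := np_full (p : ℤ) (Nat.prime_iff_prime_int.1 hp) _ g h hgh i k
    hdeg hi hf0 (by
      have := pow_dvd_coeff n k a i hi p 1 hp (hap i hi)
      simp only [pow_one] at this
      rw [this]
      exact cAbs_not_dvd hkn hi hp hkp hpi) (by
      intro j hj hji
      have := hpow 1 j hj hji
      simp only [pow_one] at this
      exact this.2 hpi)
  refine ⟨fun hnd => ?_, fun hd => ?_⟩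
  · have := H1 fun j hj hji => by rwa [hpow 2 j hj hji]
    omega
  · have := H2 fun j hj hji => by
      refine ⟨(hpow 2 j hj hji).2 hd, ?_⟩
      rw [hpow 3 j hj hji]
      intro h4
      have h5 := Nat.le_of_dvd (by omega) h4
      have h6 : (k + 1) ^ 3 ≤ p ^ 3 := Nat.pow_le_pow_left hkp 3
      omega
    exact ⟨r, t, hrt, this⟩

lemma irreducible_of_constr (n k : ℕ) (a : ℕ → ℤ) (hk : 4 ≤ k) (hkn : k < n)
    (h3 : n < (k + 1) ^ 3)
    (ha : ∀ j ≤ k, a j ≠ 0 ∧ ∀ p : ℕ, p.Prime → (p : ℤ) ∣ a j → p ≤ k)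
    (H : ∀ d, 1 ≤ d → 2 * d ≤ k → ¬ Constr n k d) : Irreducible (F n k a) := by
  have hdeg := FZ_natDegree n k a hkn (ha k le_rfl).1
  have hne : FZ n k a ≠ 0 := by
    rintro h0
    rw [h0] at hdeg; simp at hdeg
    omega
  have hcont : (FZ n k a).content ≠ 0 := by rwa [Ne, content_eq_zero_iff]
  have hprim := (FZ n k a).isPrimitive_primPart
  have hirr : Irreducible (FZ n k a).primPart := by
    constructor
    · intro hu
      have := natDegree_eq_zero_of_isUnit hu
      rw [natDegree_primPart] at this
      omega
    · intro x y hxy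
      by_contra hcon
      push Not at hcon
      have hpos : ∀ x y, (FZ n k a).primPart = x * y → ¬ IsUnit x → 0 < x.natDegree := by
        intro x y hxy hx
        by_contra h0
        have h1 : x.natDegree = 0 := by omega
        obtain ⟨z, rfl⟩ := natDegree_eq_zero.1 h1
        exact hx ((isUnit_C).2 (hprim z ⟨y, hxy⟩))
      have hx0 := hpos x y hxy hcon.1
      have hy0 := hpos y x (by rw [hxy, mul_comm]) hcon.2
      have hfac : FZ n k a = (C (FZ n k a).content * x) * y := by
        conv_lhs => rw [(FZ n k a).eq_C_content_mul_primPart, hxy]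
        ring
      have hfac' : FZ n k a = (C (FZ n k a).content * y) * x := by
        conv_lhs => rw [(FZ n k a).eq_C_content_mul_primPart, hxy]
        ring
      have hxd : (C (FZ n k a).content * x).natDegree = x.natDegree := natDegree_C_mul hcont
      have hyd : (C (FZ n k a).content * y).natDegree = y.natDegree := natDegree_C_mul hcont
      have c1 := factor_constr n k a hkn h3 ha _ _ hfac (by omega) hy0
      have c2 := factor_constr n k a hkn h3 ha _ _ hfac' (by omega) hx0
      rw [hxd] at c1
      rw [hyd] at c2
      have hsum : x.natDegree + y.natDegree = k := by
        rw [← hdeg, ← natDegree_primPart (FZ n k a), hxy, natDegree_mul]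
        · rintro rfl; simp at hx0
        · rintro rfl; simp at hy0
      rcases le_or_gt (2 * x.natDegree) k with h | h
      · exact H _ hx0 h c1
      · exact H _ hy0 (by omega) c2
  have h1 := (IsPrimitive.Int.irreducible_iff_irreducible_map_cast hprim).1 hirr
  rw [← FZ_map, (FZ n k a).eq_C_content_mul_primPart, Polynomial.map_mul, map_C]
  have hunit : IsUnit (C ((Int.castRingHom ℚ) (FZ n k a).content) : ℚ[X]) := by
    rw [isUnit_C, isUnit_iff_ne_zero]
    simp only [eq_intCast, ne_eq, Int.cast_eq_zero]
    exact hcont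
  exact (irreducible_isUnit_mul hunit).2 h1

/-- indices `i ≤ k` such that `n - i` has a prime factor exceeding `k` -/
def RoughIdx (n k i : ℕ) : Prop := ∃ p : ℕ, p.Prime ∧ k < p ∧ p ∣ n - i

open Classical in
noncomputable def roughSet (n k : ℕ) : Finset ℕ := (Finset.range (k + 1)).filter (RoughIdx n k)

lemma mem_roughSet {n k i : ℕ} : i ∈ roughSet n k ↔ i ≤ k ∧ RoughIdx n k i := by
  classical
  simp [roughSet]

lemma choose_split (n m k : ℕ) (hm : m ≤ n) (hk : k ≤ n) : ∃ R : ℕ,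
    n.choose m = (∏ p ∈ Nat.primesLE k, p ^ (n.choose m).factorization p) * R ∧
    ∀ p : ℕ, p.Prime → p ∣ R → k < p := by
  classical
  refine ⟨∏ p ∈ Finset.range (n + 1) \ Nat.primesLE k, p ^ (n.choose m).factorization p, ?_, ?_⟩
  · have hsub : Nat.primesLE k ⊆ Finset.range (n + 1) := by
      intro p hp
      have := Nat.le_of_mem_primesLE hp
      simp; omega
    rw [mul_comm, Finset.prod_sdiff hsub, Nat.prod_pow_factorization_choose n m hm]
  · intro p hp hd
    rw [Prime.dvd_finsetProd_iff hp.prime] at hd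
    obtain ⟨q, hq, hpq⟩ := hd
    have h1 := hp.dvd_of_dvd_pow hpq
    by_cases hqp : q.Prime
    · have : p = q := (Nat.prime_dvd_prime_iff_eq hp hqp).1 h1
      subst this
      simp only [Finset.mem_sdiff, Nat.mem_primesLE] at hq
      by_contra hcon
      exact hq.2 ⟨by omega, hp⟩
    · rw [Nat.factorization_eq_zero_of_not_prime _ hqp] at hpq
      simp at hpq
      exact absurd hpq hp.one_lt.ne'

lemma smooth_part_le (n m k : ℕ) (hn : 0 < n) :
    (∏ p ∈ Nat.primesLE k, p ^ (n.choose m).factorization p) ≤ n ^ Nat.primeCounting k := by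
  rw [← Nat.primesLE_card_eq_primeCounting]
  exact Finset.prod_le_pow_card _ _ _ (fun p _ => Nat.pow_factorization_choose_le hn)

lemma DEL (n k : ℕ) (hkn : k < n) (T : Finset ℕ) (hT : T ⊆ Finset.range (k + 1)) (f : ℕ → ℕ)
    (hf : ∀ i ∈ T, f i ∣ n - i) (hs : ∀ i ∈ T, ∀ p : ℕ, p.Prime → p ∣ f i → p ≤ k) :
    ∏ i ∈ T, f i ≤ (k + 1).factorial * n ^ Nat.primeCounting k := by
  obtain ⟨R, hR, hRp⟩ := choose_split n (k + 1) k (by omega) (by omega)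
  set S := ∏ p ∈ Nat.primesLE k, p ^ (n.choose (k + 1)).factorization p with hS
  have h1 : ∏ i ∈ T, f i ∣ (k + 1).factorial * S * R := by
    rw [mul_assoc, ← hR, ← Nat.descFactorial_eq_factorial_mul_choose,
      Nat.descFactorial_eq_prod_range]
    exact (Finset.prod_dvd_prod_of_dvd _ _ hf).trans (Finset.prod_dvd_prod_of_subset _ _ _ hT)
  have hcop : Nat.Coprime (∏ i ∈ T, f i) R := by
    refine Nat.coprime_of_dvd fun p hp h1 h2 => ?_
    rw [Prime.dvd_finsetProd_iff hp.prime] at h1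
    obtain ⟨i, hi, hpi⟩ := h1
    have := hs i hi p hp hpi
    have := hRp p hp h2
    omega
  have h2 := hcop.dvd_of_dvd_mul_right h1
  have hSpos : 0 < S := by
    apply Finset.prod_pos
    intro p hp
    exact pow_pos (Nat.prime_of_mem_primesLE hp).pos _
  refine (Nat.le_of_dvd (Nat.mul_pos (Nat.factorial_pos _) hSpos) h2).trans ?_
  exact Nat.mul_le_mul_left _ (smooth_part_le n (k + 1) k (by omega))

lemma CH (n k : ℕ) (hkn : k < n) :
    n.choose k ≤ n ^ (roughSet n k).card * ∏ p ∈ Nat.primesLE k, p ^ (n.choose k).factorization p := by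
  classical
  obtain ⟨R, hR, hRp⟩ := choose_split n k k (by omega) (by omega)
  set S := ∏ p ∈ Nat.primesLE k, p ^ (n.choose k).factorization p with hS
  have h1 : R ∣ ∏ i ∈ Finset.range k, (n - i) := by
    rw [← Nat.descFactorial_eq_prod_range, Nat.descFactorial_eq_factorial_mul_choose, hR]
    exact ⟨k.factorial * S, by ring⟩
  rw [← Finset.prod_filter_mul_prod_filter_not (Finset.range k) (fun i => i ∈ roughSet n k)] at h1
  have hcop : Nat.Coprime R (∏ i ∈ Finset.range k with ¬ i ∈ roughSet n k, (n - i)) := by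
    refine Nat.coprime_of_dvd fun p hp h1 h2 => ?_
    rw [Prime.dvd_finsetProd_iff hp.prime] at h2
    obtain ⟨i, hi, hpi⟩ := h2
    simp only [Finset.mem_filter, Finset.mem_range, mem_roughSet] at hi
    exact hi.2 ⟨hi.1.le, p, hp, hRp p hp h1, hpi⟩
  have h2 := hcop.dvd_of_dvd_mul_right h1
  have hpos : 0 < ∏ i ∈ Finset.range k with i ∈ roughSet n k, (n - i) := by
    apply Finset.prod_pos
    intro i hi
    simp only [Finset.mem_filter, Finset.mem_range] at hi
    omega
  have h3 : R ≤ n ^ (roughSet n k).card := by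
    refine (Nat.le_of_dvd hpos h2).trans ?_
    refine (Finset.prod_le_pow_card _ _ n (fun i _ => Nat.sub_le _ _)).trans ?_
    refine Nat.pow_le_pow_right (by omega) (Finset.card_le_card ?_)
    intro i hi
    exact (Finset.mem_filter.1 hi).2
  calc n.choose k = R * S := by rw [mul_comm]; exact hR
    _ ≤ _ := Nat.mul_le_mul_right _ h3

lemma smooth_le_sqrt (n m k M : ℕ) (hn : 0 < n)
    (hM : ∀ p : ℕ, p.Prime → M < p → p ≤ k → (n.choose m).factorization p = 0) :
    (∏ p ∈ Nat.primesLE k, p ^ (n.choose m).factorization p) ≤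
      n ^ Nat.primeCounting (Nat.sqrt n) * 4 ^ M := by
  classical
  rw [← Finset.prod_filter_mul_prod_filter_not (Nat.primesLE k) (fun p => p ≤ Nat.sqrt n)]
  refine Nat.mul_le_mul ?_ ?_
  · refine (Finset.prod_le_pow_card _ _ n (fun p _ => Nat.pow_factorization_choose_le hn)).trans ?_
    refine Nat.pow_le_pow_right hn ?_
    rw [← Nat.primesLE_card_eq_primeCounting]
    refine Finset.card_le_card fun p hp => ?_
    simp only [Finset.mem_filter, Nat.mem_primesLE] at hp ⊢
    exact ⟨hp.2, hp.1.2⟩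
  · refine le_trans ?_ (primorial_le_four_pow M)
    unfold primorial
    have h1 : ∀ p ∈ (Nat.primesLE k).filter (fun p => ¬ p ≤ Nat.sqrt n),
        p ^ (n.choose m).factorization p ≤ if p ≤ M then p else 1 := by
      intro p hp
      simp only [Finset.mem_filter, Nat.mem_primesLE] at hp
      obtain ⟨⟨hpk, hpp⟩, hps⟩ := hp
      split_ifs with h
      · have : (n.choose m).factorization p ≤ 1 := by
          apply Nat.factorization_choose_le_one
          rw [Nat.pow_two]
          exact Nat.sqrt_lt.1 (by omega)
        calc p ^ (n.choose m).factorization p ≤ p ^ 1 := Nat.pow_le_pow_right hpp.pos this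
          _ = p := pow_one p
      · rw [hM p hpp (by omega) hpk]; simp
    refine (Finset.prod_le_prod' h1).trans ?_
    rw [← Finset.prod_filter]
    refine Finset.prod_le_prod_of_subset_of_one_le' ?_ ?_
    · intro p hp
      simp only [Finset.mem_filter, Nat.mem_primesLE, Finset.mem_range] at hp ⊢
      exact ⟨by omega, hp.1.1.2⟩
    · intro p hp _
      exact (Finset.mem_filter.1 hp).2.one_lt.le

lemma pi_le_half (s : ℕ) : Nat.primeCounting s ≤ s / 2 + 1 := by
  have h0 : Nat.primeCounting 2 = 1 := by decide
  rcases Nat.lt_or_ge s 2 with h | h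
  · have := Nat.monotone_primeCounting (show s ≤ 2 by omega)
    omega
  · have := Nat.primeCounting_add_le (a := 2) (k := 2) (by norm_num) le_rfl (s - 2)
    rw [show 2 + (s - 2) = s by omega, h0] at this
    have ht : Nat.totient 2 = 1 := by decide
    rw [ht] at this
    omega

lemma CH4 (n k M : ℕ) (hkn : k < n) (hA : (roughSet n k).card ≤ 4)
    (hM : ∀ p : ℕ, p.Prime → M < p → p ≤ k → (n.choose k).factorization p = 0) :
    n.choose k ≤ n ^ (5 + Nat.sqrt n / 2) * 4 ^ M := by
  refine (CH n k hkn).trans ?_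
  have h1 := smooth_le_sqrt n k k M (by omega) hM
  calc _ ≤ n ^ 4 * (n ^ (Nat.sqrt n / 2 + 1) * 4 ^ M) := by
        refine Nat.mul_le_mul (Nat.pow_le_pow_right (by omega) hA) (h1.trans ?_)
        exact Nat.mul_le_mul_right _ (Nat.pow_le_pow_right (by omega) (pi_le_half _))
    _ = _ := by rw [← mul_assoc, ← pow_add]; congr 2; omega

lemma DEL4 (n k : ℕ) (hkn : k < n) (hA : (roughSet n k).card ≤ 4) :
    (n - k) ^ (k - 3) ≤ (k + 1).factorial * n ^ Nat.primeCounting k := by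
  classical
  refine le_trans ?_ (DEL n k hkn (Finset.range (k + 1) \ roughSet n k) Finset.sdiff_subset
    (fun i => n - i) (fun i _ => dvd_rfl) ?_)
  · have hc : k - 3 ≤ (Finset.range (k + 1) \ roughSet n k).card := by
      have := Finset.le_card_sdiff (roughSet n k) (Finset.range (k + 1))
      simp at this; omega
    calc (n - k) ^ (k - 3) ≤ (n - k) ^ (Finset.range (k + 1) \ roughSet n k).card :=
          Nat.pow_le_pow_right (by omega) hc
      _ ≤ _ := by
        apply Finset.pow_card_le_prod
        intro i hi
        simp at hi
        omega
  · intro i hi p hp hpi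
    simp only [Finset.mem_sdiff, mem_roughSet, Finset.mem_range] at hi
    by_contra hcon
    exact hi.2 ⟨by omega, p, hp, by omega, hpi⟩

lemma MONO (n n0 k a b X Y : ℕ) (hn : n0 ≤ n) (hk : k < n0) (hab : b ≤ a)
    (h : Y * n0 ^ b < (n0 - k) ^ a * X) : Y * n ^ b < (n - k) ^ a * X := by
  have h1 : n * (n0 - k) ≤ n0 * (n - k) := by
    obtain ⟨s, rfl⟩ := Nat.exists_eq_add_of_le hn
    obtain ⟨t, rfl⟩ := Nat.exists_eq_add_of_lt hk
    rw [show k + t + 1 - k = t + 1 by omega, show k + t + 1 + s - k = t + 1 + s by omega]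
    nlinarith
  have h0 : 0 < n0 - k := by omega
  have hpos : 0 < n0 ^ b := pow_pos (by omega) _
  obtain ⟨e, rfl⟩ := Nat.exists_eq_add_of_le hab
  have h2 : n ^ b * (n0 - k) ^ b ≤ n0 ^ b * (n - k) ^ b := by
    rw [← mul_pow, ← mul_pow]; exact Nat.pow_le_pow_left h1 b
  have h3 : (n0 - k) ^ e ≤ (n - k) ^ e := Nat.pow_le_pow_left (by omega) e
  -- Y n^b (n0-k)^b n0^b
  have hq : 0 < (n0 - k) ^ b := pow_pos h0 b
  have hn' : 0 < n ^ b := pow_pos (by omega) _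
  refine lt_of_mul_lt_mul_right (a := n0 ^ b) ?_ (Nat.zero_le _)
  calc Y * n ^ b * n0 ^ b = (Y * n0 ^ b) * n ^ b := by ring
    _ < ((n0 - k) ^ (b + e) * X) * n ^ b := Nat.mul_lt_mul_of_pos_right h hn'
    _ = (n ^ b * (n0 - k) ^ b) * ((n0 - k) ^ e * X) := by rw [pow_add]; ring
    _ ≤ (n0 ^ b * (n - k) ^ b) * ((n - k) ^ e * X) :=
        Nat.mul_le_mul h2 (Nat.mul_le_mul_right _ h3)
    _ = _ := by rw [pow_add]; ring

lemma card_le_four (n k d : ℕ) (hd : 1 ≤ d) (h2d : 2 * d < k) (hC : Constr n k d) :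
    (roughSet n k).card ≤ 4 := by
  classical
  have hsub : roughSet n k ⊆ {d, k - d, 2 * d, k - 2 * d} := by
    intro i hi
    obtain ⟨hik, p, hp, hkp, hpi⟩ := mem_roughSet.1 hi
    obtain ⟨h1, h2⟩ := hC i hik p hp hkp hpi
    simp only [Finset.mem_insert, Finset.mem_singleton]
    by_cases h : p ^ 2 ∣ n - i
    · obtain ⟨r, t, h3, h4, h5⟩ := h2 h
      omega
    · have := h1 h
      omega
  exact (Finset.card_le_card hsub).trans Finset.card_le_four

/-- product of the first odd numbers -/
def oddFac (U : ℕ) : ℕ := ∏ j ∈ Finset.range U, (2 * j + 1)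

lemma same_parity (e : ℕ) (S : Finset ℕ) : (∀ s ∈ S, 0 < s ∧ s % 2 = e) →
    oddFac S.card ≤ ∏ s ∈ S, s ∧
    ∀ b, 0 < b → b % 2 = e → (∀ s ∈ S, s < b) → 2 * S.card + 1 ≤ b := by
  induction S using Finset.induction_on_max with
  | empty => intro _; simp [oddFac]; omega
  | insert a S ha ih =>
    intro h
    have haS : a ∉ S := fun hm => lt_irrefl _ (ha a hm)
    obtain ⟨h1, h2⟩ := ih (fun s hs => h s (Finset.mem_insert_of_mem hs))
    obtain ⟨ha0, ha2⟩ := h a (Finset.mem_insert_self _ _)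
    have h3 := h2 a ha0 ha2 ha
    rw [Finset.card_insert_of_notMem haS, Finset.prod_insert haS]
    refine ⟨?_, ?_⟩
    · rw [oddFac, Finset.prod_range_succ, mul_comm]
      exact Nat.mul_le_mul h3 h1
    · intro b hb hb2 hlt
      have := hlt a (Finset.mem_insert_self _ _)
      omega

lemma UB (n k d : ℕ) (h4 : 4 ≤ k) (hkn : 2 * k ≤ n) (h3 : n < (k + 1) ^ 3) (h2d : 2 * d = k)
    (hC : Constr n k d) : ∃ U : ℕ, (roughSet n k).card ≤ U + 1 ∧
      (n - k) ^ (k - U) * oddFac U ≤ (k + 1).factorial * n ^ Nat.primeCounting k ∧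
      (1 ≤ U → (k + 1) ^ 2 * (2 * U - 1) ≤ n) := by
  classical
  set B := (roughSet n k).erase d with hB
  have hBm : ∀ i ∈ B, ∃ p m : ℕ, k < p ∧ n - i = p ^ 2 * m ∧ 0 < m ∧ m ≤ k ∧ m % 2 = n % 2 := by
    intro i hi
    obtain ⟨hid, hi⟩ := Finset.mem_erase.1 hi
    obtain ⟨hik, p, hp, hkp, hpi⟩ := mem_roughSet.1 hi
    obtain ⟨h1, h2⟩ := hC i hik p hp hkp hpi
    have hsq : p ^ 2 ∣ n - i := by
      by_contra h
      have := h1 h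
      clear h2 h1
      omega
    have hev : i % 2 = 0 := by
      obtain ⟨r, t, h3, h4, h5⟩ := h2 hsq
      clear h2 h1
      omega
    obtain ⟨m, hm⟩ := hsq
    have hm0 : 0 < m := by
      rcases Nat.eq_zero_or_pos m with h | h
      · subst h; simp at hm; omega
      · exact h
    refine ⟨p, m, hkp, hm, hm0, ?_, ?_⟩
    · by_contra hcon
      have h5 : (k + 1) ^ 2 * (k + 1) ≤ p ^ 2 * m :=
        Nat.mul_le_mul (Nat.pow_le_pow_left hkp 2) (by omega)
      have : (k + 1) ^ 3 = (k + 1) ^ 2 * (k + 1) := by ring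
      omega
    · have hodd : p % 2 = 1 := by
        rcases hp.eq_two_or_odd with h | h
        · omega
        · exact h
      have h6 : (n - i) % 2 = m % 2 := by
        rw [hm, Nat.mul_mod, Nat.pow_mod, hodd]; simp
      omega
  choose! P m hP using hBm
  have hinj : ∀ i ∈ B, ∀ j ∈ B, i < j → m i ≠ m j := by
    intro i hi j hj hij heq
    obtain ⟨h1, h2, h3, h4, h5⟩ := hP i hi
    obtain ⟨h1', h2', h3', h4', h5'⟩ := hP j hj
    have hjk : j ≤ k := (mem_roughSet.1 (Finset.mem_erase.1 hj).2).1
    rw [← heq] at h2'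
    have h6 : P j ^ 2 * m i + (j - i) = P i ^ 2 * m i := by omega
    have h7 : P j < P i := by
      by_contra hcon
      have : P i ^ 2 * m i ≤ P j ^ 2 * m i :=
        Nat.mul_le_mul_right _ (Nat.pow_le_pow_left (by omega) 2)
      omega
    have h8 : (P j + 1) ^ 2 * m i ≤ P i ^ 2 * m i :=
      Nat.mul_le_mul_right _ (Nat.pow_le_pow_left h7 2)
    have h9 : (P j + 1) ^ 2 * m i = P j ^ 2 * m i + (2 * P j + 1) * m i := by ring
    have h10 : (2 * P j + 1) * 1 ≤ (2 * P j + 1) * m i := Nat.mul_le_mul_left _ h3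
    omega
  have hinj' : Set.InjOn m B := by
    intro i hi j hj heq
    rcases lt_trichotomy i j with h | h | h
    · exact absurd heq (hinj i hi j hj h)
    · exact h
    · exact absurd heq.symm (hinj j hj i hi h)
  have hcard : (B.image m).card = B.card := Finset.card_image_of_injOn hinj'
  have hsp := same_parity (n % 2) (B.image m) (by
    intro s hs
    obtain ⟨i, hi, rfl⟩ := Finset.mem_image.1 hs
    exact ⟨(hP i hi).2.2.1, (hP i hi).2.2.2.2⟩)
  rw [hcard, Finset.prod_image hinj'] at hsp
  refine ⟨B.card, ?_, ?_, ?_⟩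
  · have := Finset.pred_card_le_card_erase (s := roughSet n k) (a := d)
    rw [← hB] at this
    omega
  · have hBT : B ⊆ (Finset.range (k + 1)).erase d := by
      intro i hi
      obtain ⟨hid, hi⟩ := Finset.mem_erase.1 hi
      have := (mem_roughSet.1 hi).1
      simp; omega
    have hdel := DEL n k (by omega) ((Finset.range (k + 1)).erase d) (Finset.erase_subset _ _)
      (fun i => if i ∈ B then m i else n - i) (by
        intro i hi
        by_cases hiB : i ∈ B
        · simp only [hiB, if_true]
          rw [(hP i hiB).2.1]
          exact dvd_mul_left _ _
        · simp [hiB]) (by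
        intro i hi p hp hpi
        by_cases hiB : i ∈ B
        · simp only [hiB, if_true] at hpi
          exact (Nat.le_of_dvd (hP i hiB).2.2.1 hpi).trans (hP i hiB).2.2.2.1
        · simp only [hiB, if_false] at hpi
          by_contra hcon
          have hi2 := Finset.mem_erase.1 hi
          have hi3 := Finset.mem_range.1 hi2.2
          exact hiB (Finset.mem_erase.2 ⟨hi2.1, mem_roughSet.2 ⟨by omega, p, hp, by omega, hpi⟩⟩))
    refine le_trans ?_ hdel
    rw [← Finset.prod_sdiff hBT]
    refine Nat.mul_le_mul ?_ ?_
    · have hc : (((Finset.range (k + 1)).erase d) \ B).card = k - B.card := by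
        rw [Finset.card_sdiff_of_subset hBT, Finset.card_erase_of_mem (by simp; omega)]
        simp
      rw [← hc]
      apply Finset.pow_card_le_prod
      intro i hi
      simp only [Finset.mem_sdiff, Finset.mem_erase, Finset.mem_range] at hi
      have : i ∉ B := by simpa using hi.2
      simp only [this, if_false]
      omega
    · refine hsp.1.trans (le_of_eq (Finset.prod_congr rfl fun i hi => ?_))
      simp [hi]
  · intro hU
    by_contra hcon
    have hlt : ∀ i ∈ B, m i < 2 * B.card - 1 := by
      intro i hi
      by_contra hc
      obtain ⟨h1, h2, h3, h4, h5⟩ := hP i hi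
      have : (k + 1) ^ 2 * (2 * B.card - 1) ≤ P i ^ 2 * m i :=
        Nat.mul_le_mul (Nat.pow_le_pow_left h1 2) (by omega)
      omega
    have := hsp.2 (2 * B.card - 1 + (n + 1) % 2) (by omega) (by omega) (by
      intro s hs
      obtain ⟨i, hi, rfl⟩ := Finset.mem_image.1 hs
      have := hlt i hi
      omega)
    omega

lemma choose_low1 (k s : ℕ) (hk : 1 ≤ k) (hs : s ≤ k) :
    4 ^ k * 3 ^ s ≤ (2 * k + s).choose k * 2 ^ s * (2 * k) := by
  induction s with
  | zero =>
    have := Nat.four_pow_le_two_mul_self_mul_centralBinom k (by omega)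
    rw [Nat.centralBinom] at this
    simp only [pow_zero, mul_one, add_zero]
    linarith
  | succ s ih =>
    have ih := ih (by omega)
    have h1 := Nat.choose_mul_succ_eq (2 * k + s) k
    rw [show 2 * k + s + 1 - k = k + s + 1 by omega] at h1
    rw [show 2 * k + (s + 1) = 2 * k + s + 1 by ring]
    have hpos : 0 < k + s + 1 := by omega
    refine le_of_mul_le_mul_right (a := k + s + 1) ?_ hpos
    calc 4 ^ k * 3 ^ (s + 1) * (k + s + 1) = (4 ^ k * 3 ^ s) * (3 * (k + s + 1)) := by ring
      _ ≤ ((2 * k + s).choose k * 2 ^ s * (2 * k)) * (2 * (2 * k + s + 1)) :=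
          Nat.mul_le_mul ih (by omega)
      _ = ((2 * k + s).choose k * (2 * k + s + 1)) * (2 ^ (s + 1) * (2 * k)) := by ring
      _ = _ := by rw [h1]; ring

lemma bern (n k : ℕ) (hk : k ≤ n) : (n + 1) ^ k * (n + 1 - k) ≤ n ^ k * (n + 1) := by
  have h : (1 : ℝ) + k * (-1 / (n + 1)) ≤ (1 + -1 / (n + 1)) ^ k := by
    apply one_add_mul_le_pow
    have : (1 : ℝ) / (n + 1) ≤ 1 := by
      rw [div_le_one (by positivity)]; linarith [(Nat.cast_nonneg n : (0 : ℝ) ≤ n)]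
    rw [neg_div]; linarith
  have e1 : (1 : ℝ) + -1 / (n + 1) = n / (n + 1) := by field_simp; ring
  rw [e1, div_pow, le_div_iff₀ (by positivity)] at h
  have e2 : (1 : ℝ) + k * (-1 / (n + 1)) = (n + 1 - k) / (n + 1) := by field_simp; ring
  rw [e2, div_mul_eq_mul_div, div_le_iff₀ (by positivity)] at h
  have : (((n + 1) ^ k * (n + 1 - k) : ℕ) : ℝ) ≤ ((n ^ k * (n + 1) : ℕ) : ℝ) := by
    push_cast [Nat.cast_sub (show k ≤ n + 1 by omega)]
    linarith
  exact_mod_cast this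

lemma choose_low2 (k n : ℕ) (hk : 1 ≤ k) (hn : 3 * k ≤ n) :
    n ^ k * 2 ^ k ≤ n.choose k * k ^ k * (2 * k) := by
  induction n, hn using Nat.le_induction with
  | base =>
    have h := choose_low1 k k hk le_rfl
    rw [show 2 * k + k = 3 * k by ring] at h
    have h2 : 0 < 2 ^ k := by positivity
    refine le_of_mul_le_mul_right (a := 2 ^ k) ?_ h2
    calc (3 * k) ^ k * 2 ^ k * 2 ^ k = (4 ^ k * 3 ^ k) * k ^ k := by
          rw [mul_pow, show (4 : ℕ) = 2 * 2 by norm_num, mul_pow 2 2]; ring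
      _ ≤ ((3 * k).choose k * 2 ^ k * (2 * k)) * k ^ k := Nat.mul_le_mul_right _ h
      _ = _ := by ring
  | succ n hn ih =>
    have h1 := Nat.choose_mul_succ_eq n k
    have h2 := bern n k (by omega)
    have hpos : 0 < n + 1 - k := by omega
    refine le_of_mul_le_mul_right (a := n + 1 - k) ?_ hpos
    calc (n + 1) ^ k * 2 ^ k * (n + 1 - k) = ((n + 1) ^ k * (n + 1 - k)) * 2 ^ k := by ring
      _ ≤ (n ^ k * (n + 1)) * 2 ^ k := Nat.mul_le_mul_right _ h2
      _ = (n ^ k * 2 ^ k) * (n + 1) := by ring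
      _ ≤ (n.choose k * k ^ k * (2 * k)) * (n + 1) := Nat.mul_le_mul_right _ ih
      _ = (n.choose k * (n + 1)) * (k ^ k * (2 * k)) := by ring
      _ = _ := by rw [h1]; ring

lemma pi_le_quarter (k : ℕ) (hk : 2200 ≤ k) : 4 * Nat.primeCounting k ≤ k := by
  have h0 : Nat.primeCounting 210 = 46 := by decide +kernel
  have h1 : Nat.totient 210 = 48 := by decide +kernel
  have := Nat.primeCounting_add_le (a := 210) (k := 210) (by norm_num) le_rfl (k - 210)
  rw [show 210 + (k - 210) = k by omega, h0, h1] at this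
  omega

lemma log_le_div_e (x : ℝ) (hx : 0 < x) : Real.log x ≤ x / 2.718 := by
  have h := Real.add_one_le_exp (Real.log x - 1)
  rw [Real.exp_sub, Real.exp_log hx] at h
  have he := Real.exp_one_gt_d9
  have : x / Real.exp 1 ≤ x / 2.718 := by
    apply div_le_div_of_nonneg_left hx.le (by norm_num); linarith
  linarith

/-- upper bound for `(6 + √n/2) log n` in terms of `y = √n` -/
lemma sqrt_bound (n : ℕ) (hn : 6000 ≤ n) :
    (6 + (Nat.sqrt n / 2 : ℕ) : ℝ) * Real.log n ≤ (12 + √(n : ℝ)) * Real.log (√(n : ℝ)) ∧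
    77 ≤ √(n : ℝ) := by
  have hn' : (6000 : ℝ) ≤ n := by exact_mod_cast hn
  have h77 : 77 ≤ √(n : ℝ) := Real.le_sqrt_of_sq_le (by linarith)
  refine ⟨?_, h77⟩
  have h1 : Real.log (√(n : ℝ)) = Real.log n / 2 := Real.log_sqrt (by linarith)
  have h2 : ((Nat.sqrt n / 2 : ℕ) : ℝ) ≤ √(n : ℝ) / 2 := by
    refine Nat.cast_div_le.trans ?_
    have := Real.nat_sqrt_le_real_sqrt (a := n)
    push_cast
    linarith
  have h3 : 0 ≤ Real.log n := Real.log_nonneg (by linarith)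
  rw [h1]
  nlinarith

lemma sqrt_bound2 (n : ℕ) (hn : 6000 ≤ n) :
    (6 + (Nat.sqrt n / 2 : ℕ) : ℝ) * Real.log n ≤ 0.066 * n := by
  obtain ⟨h1, h77⟩ := sqrt_bound n hn
  set y := √(n : ℝ) with hy
  have hyy : y * y = n := Real.mul_self_sqrt (by positivity)
  have hl : Real.log y ≤ 0.0567 * y := by
    have h := Real.log_le_sub_one_of_pos (show 0 < y / 64 by positivity)
    rw [Real.log_div (by positivity) (by norm_num), show (64 : ℝ) = 2 ^ 6 by norm_num,
      Real.log_pow] at h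
    have := Real.log_two_lt_d9
    norm_num at h
    linarith
  have h0 : 0 ≤ Real.log y := Real.log_nonneg (by linarith)
  calc _ ≤ _ := h1
    _ ≤ (12 / 77 * y + y) * (0.0567 * y) := by
      apply mul_le_mul _ hl h0 (by positivity)
      linarith
    _ ≤ 0.066 * n := by rw [← hyy]; nlinarith

lemma large_i (n k : ℕ) (hk : 3000 ≤ k) (h2 : 2 * k ≤ n) (h3 : n ≤ 3 * k)
    (hA : (roughSet n k).card ≤ 4) : False := by
  have h := CH4 n k (n / 3) (by omega) hA (by
    intro p hp h1 hpk
    exact Nat.factorization_choose_of_lt_three_mul (by omega) hpk (by omega) (by omega))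
  obtain ⟨s, rfl⟩ := Nat.exists_eq_add_of_le h2
  have hl := choose_low1 k s (by omega) (by omega)
  set n := 2 * k + s with hn
  have h5 : 4 ^ k * 3 ^ s ≤ (n ^ (5 + Nat.sqrt n / 2) * 4 ^ (n / 3)) * 2 ^ s * n := by
    refine hl.trans (Nat.mul_le_mul (Nat.mul_le_mul_right _ h) (by omega))
  have h6 : ((4 : ℝ) ^ k * 3 ^ s) ≤ ((n : ℝ) ^ (5 + Nat.sqrt n / 2) * 4 ^ (n / 3)) * 2 ^ s * n := by
    exact_mod_cast h5
  have hnpos : (0 : ℝ) < n := by exact_mod_cast (show 0 < n by omega)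
  have h7 := Real.log_le_log (by positivity) h6
  rw [Real.log_mul (by positivity) (by positivity), Real.log_mul (by positivity) (by positivity),
    Real.log_mul (by positivity) (by positivity), Real.log_mul (by positivity) (by positivity),
    Real.log_pow, Real.log_pow, Real.log_pow, Real.log_pow, Real.log_pow] at h7
  have hb := sqrt_bound2 n (by omega)
  have hl15 : 1 / 3 ≤ Real.log 3 - Real.log 2 := by
    rw [← Real.log_div (by norm_num) (by norm_num)]
    have := Real.one_sub_inv_le_log_of_pos (show (0 : ℝ) < 3 / 2 by norm_num)
    norm_num at this ⊢
    linarith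
  have hl4 : Real.log 4 = 2 * Real.log 2 := by
    rw [show (4 : ℝ) = 2 ^ 2 by norm_num, Real.log_pow]; norm_num
  have hn3 : ((n / 3 : ℕ) : ℝ) ≤ n / 3 := by exact_mod_cast Nat.cast_div_le (α := ℝ)
  have hnr : (n : ℝ) = 2 * k + s := by rw [hn]; push_cast; ring
  have hsk : (s : ℝ) ≤ k := by exact_mod_cast (show s ≤ k by omega)
  have hlog2 := Real.log_two_gt_d9
  have hlog2' := Real.log_two_lt_d9
  have hl4n : ((n / 3 : ℕ) : ℝ) * Real.log 4 ≤ n / 3 * Real.log 4 :=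
    mul_le_mul_of_nonneg_right hn3 (by rw [hl4]; linarith)
  push_cast at h7 hb
  have hs0 : (0 : ℝ) ≤ s := by positivity
  have h8 : k * Real.log 4 + s * (Real.log 3 - Real.log 2) - n / 3 * Real.log 4 ≤ 0.066 * n := by
    nlinarith
  rw [hl4, hnr] at h8
  have hk' : (3000 : ℝ) ≤ k := by exact_mod_cast hk
  nlinarith [mul_le_mul_of_nonneg_left hl15 hs0, mul_nonneg (sub_nonneg.2 hsk) (sub_nonneg.2 hlog2.le)]

lemma large_ii (n k : ℕ) (hk : 3000 ≤ k) (h3 : 3 * k ≤ n) (hnk : n ^ 2 ≤ k ^ 3)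
    (hA : (roughSet n k).card ≤ 4) : False := by
  have h := CH4 n k k (by omega) hA (by
    intro p hp h1 hpk
    omega)
  have hl := choose_low2 k n (by omega) h3
  have h5 : n ^ k * 2 ^ k ≤ (n ^ (5 + Nat.sqrt n / 2) * 4 ^ k) * k ^ k * n := by
    refine hl.trans (Nat.mul_le_mul (Nat.mul_le_mul_right _ h) (by omega))
  have h6 : ((n : ℝ) ^ k * 2 ^ k) ≤ ((n : ℝ) ^ (5 + Nat.sqrt n / 2) * 4 ^ k) * (k : ℝ) ^ k * n := by
    exact_mod_cast h5
  have hnpos : (0 : ℝ) < n := by exact_mod_cast (show 0 < n by omega)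
  have hkpos : (0 : ℝ) < k := by exact_mod_cast (show 0 < k by omega)
  have h7 := Real.log_le_log (by positivity) h6
  rw [Real.log_mul (by positivity) (by positivity), Real.log_mul (by positivity) (by positivity),
    Real.log_mul (by positivity) (by positivity), Real.log_mul (by positivity) (by positivity),
    Real.log_pow, Real.log_pow, Real.log_pow, Real.log_pow, Real.log_pow] at h7
  have hl4 : Real.log 4 = 2 * Real.log 2 := by
    rw [show (4 : ℝ) = 2 ^ 2 by norm_num, Real.log_pow]; norm_num
  rw [hl4] at h7
  have h8 : k * Real.log (n / (2 * k)) ≤ (6 + (Nat.sqrt n / 2 : ℕ) : ℝ) * Real.log n := by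
    rw [Real.log_div (by positivity) (by positivity), Real.log_mul (by positivity) (by positivity)]
    push_cast at h7 ⊢
    nlinarith
  have hlog2 := Real.log_two_gt_d9
  rcases Nat.lt_or_ge n (9 * k) with h9 | h9
  · have hb := sqrt_bound2 n (by omega)
    have hlog := Real.one_sub_inv_le_log_of_pos (show (0 : ℝ) < n / (2 * k) by positivity)
    have h10 := mul_le_mul_of_nonneg_left hlog hkpos.le
    rw [inv_div] at h10
    have h11 : k * (1 - 2 * k / n) ≤ (0.066 * n : ℝ) := by linarith
    have h12 : (k : ℝ) * (1 - 2 * k / n) = (k * n - 2 * k * k) / n := by field_simp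
    rw [h12, div_le_iff₀ hnpos] at h11
    have ha : (3 * k : ℝ) ≤ n := by exact_mod_cast h3
    have hb : (n : ℝ) ≤ 9 * k := by exact_mod_cast h9.le
    nlinarith [mul_nonneg (sub_nonneg.2 ha) (sub_nonneg.2 hb)]
  · obtain ⟨hb, h77⟩ := sqrt_bound n (by omega)
    have h10 : Real.log 4 ≤ Real.log (n / (2 * k)) := by
      apply Real.log_le_log (by norm_num)
      rw [le_div_iff₀ (by positivity)]
      have : (9 * k : ℝ) ≤ n := by exact_mod_cast h9
      linarith
    rw [hl4] at h10
    set y := √(n : ℝ) with hy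
    set z := y ^ (1 / 3 : ℝ) with hz
    have hypos : 0 < y := by linarith
    have hzpos : 0 < z := Real.rpow_pos_of_pos hypos _
    have hz3 : z ^ 3 = y := by
      rw [hz, ← Real.rpow_natCast, ← Real.rpow_mul hypos.le]; norm_num
    have hyy : y ^ 2 = n := Real.sq_sqrt hnpos.le
    have hkz : z ^ 4 ≤ k := by
      have : (z ^ 4) ^ 3 ≤ (k : ℝ) ^ 3 := by
        have e : (z ^ 4) ^ 3 = (n : ℝ) ^ 2 := by rw [← hyy, ← hz3]; ring
        rw [e]; exact_mod_cast hnk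
      exact le_of_pow_le_pow_left₀ (by norm_num) hkpos.le this
    have hly : Real.log y ≤ 3 * (z / 2.718) := by
      rw [← hz3, Real.log_pow]
      have := log_le_div_e z hzpos
      push_cast; linarith
    have h0 : 0 ≤ Real.log y := Real.log_nonneg (by linarith)
    have h11 : (12 + y) * Real.log y ≤ (12 / 77 * y + y) * (3 * (z / 2.718)) := by
      apply mul_le_mul _ hly h0 (by positivity)
      linarith
    have h12 : (12 / 77 * y + y) * (3 * (z / 2.718)) = (89 / 77 * 3 / 2.718) * z ^ 4 := by
      rw [← hz3]; ring
    have h13 : (k : ℝ) * (2 * Real.log 2) ≤ k * Real.log (n / (2 * k)) :=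
      mul_le_mul_of_nonneg_left h10 hkpos.le
    have hz4 : 0 < z ^ 4 := by positivity
    have h14 : (89 / 77 * 3 / 2.718 : ℝ) ≤ 1.28 := by norm_num
    have h15 := mul_le_mul_of_nonneg_right h14 hz4.le
    have h16 : (k : ℝ) * 1.38 ≤ k * (2 * Real.log 2) :=
      mul_le_mul_of_nonneg_left (by linarith) hkpos.le
    linarith

lemma log_factorial_le (k : ℕ) (hk : 1 ≤ k) :
    Real.log (k.factorial : ℝ) ≤ k * Real.log k - k + 1 + Real.log k := by
  induction k, hk using Nat.le_induction with
  | base => simp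
  | succ k hk ih =>
    have hkpos : (0 : ℝ) < k := by exact_mod_cast hk
    have h1 : Real.log ((k + 1).factorial : ℝ) = Real.log (k + 1) + Real.log (k.factorial : ℝ) := by
      rw [Nat.factorial_succ]
      push_cast
      rw [Real.log_mul (by positivity) (by positivity)]
    have h2 := Real.log_le_sub_one_of_pos (show (0 : ℝ) < k / (k + 1) by positivity)
    rw [Real.log_div (by positivity) (by positivity)] at h2
    have h3 : (k : ℝ) / (k + 1) - 1 = - (1 / (k + 1)) := by field_simp; ring
    rw [h3] at h2
    have h4 := mul_le_mul_of_nonneg_left h2 (show (0 : ℝ) ≤ k + 1 by positivity)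
    have h5 : ((k : ℝ) + 1) * (-(1 / (k + 1))) = -1 := by field_simp
    rw [h5] at h4
    rw [h1]
    push_cast
    nlinarith

lemma log_sub_ge (n k : ℕ) (h : k < n) :
    Real.log n - k / ((n : ℝ) - k) ≤ Real.log ((n - k : ℕ) : ℝ) := by
  have hn : (0 : ℝ) < n := by exact_mod_cast (show 0 < n by omega)
  have hnk : (0 : ℝ) < (n : ℝ) - k := by
    have : (k : ℝ) < n := by exact_mod_cast h
    linarith
  rw [Nat.cast_sub h.le]
  have h1 := Real.log_le_sub_one_of_pos (show (0 : ℝ) < n / (n - k) by positivity)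
  rw [Real.log_div (by positivity) (by positivity)] at h1
  have h3 : (n : ℝ) / (n - k) - 1 = k / (n - k) := by field_simp; ring
  linarith

lemma large_iii (n k : ℕ) (hk : 3000 ≤ k) (hnk : k ^ 3 ≤ n ^ 2) (hpi : 4 * Nat.primeCounting k ≤ k)
    (hA : (roughSet n k).card ≤ 4) : False := by
  have hbig : 50 * k ≤ n := by
    by_contra hcon
    have h1 : n ^ 2 ≤ (50 * k) ^ 2 := Nat.pow_le_pow_left (by omega) 2
    have h2 : k ^ 2 * 3000 ≤ k ^ 2 * k := Nat.mul_le_mul_left _ hk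
    have h3 : 0 < k ^ 2 := by positivity
    nlinarith
  have h := DEL4 n k (by omega) hA
  have h6 : (((n - k : ℕ) : ℝ)) ^ (k - 3) ≤ (((k + 1).factorial : ℕ) : ℝ) * (n : ℝ) ^ Nat.primeCounting k := by
    exact_mod_cast h
  have hkpos : (0 : ℝ) < k := by exact_mod_cast (show 0 < k by omega)
  have hnpos : (0 : ℝ) < n := by exact_mod_cast (show 0 < n by omega)
  have hnkpos : (0 : ℝ) < (n - k : ℕ) := by exact_mod_cast (show 0 < n - k by omega)
  have h7 := Real.log_le_log (by positivity) h6
  rw [Real.log_mul (by positivity) (by positivity), Real.log_pow, Real.log_pow,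
    Nat.factorial_succ, Nat.cast_mul, Real.log_mul (by positivity) (by positivity)] at h7
  have hf := log_factorial_le k (by omega)
  have hs := log_sub_ge n k (by omega)
  have hbig' : (50 * k : ℝ) ≤ n := by exact_mod_cast hbig
  have hs2 : (k : ℝ) / (n - k) ≤ 1 / 49 := by
    rw [div_le_div_iff₀ (by linarith) (by norm_num)]; linarith
  have hk3 : ((k - 3 : ℕ) : ℝ) = k - 3 := by
    rw [Nat.cast_sub (by omega)]; norm_num
  rw [hk3] at h7
  have hk' : (3000 : ℝ) ≤ k := by exact_mod_cast hk
  have hpi' : (4 * Nat.primeCounting k : ℝ) ≤ k := by exact_mod_cast hpi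
  have hln : 3 * Real.log k ≤ 2 * Real.log n := by
    have : (k : ℝ) ^ 3 ≤ (n : ℝ) ^ 2 := by exact_mod_cast hnk
    have := Real.log_le_log (by positivity) this
    rw [Real.log_pow, Real.log_pow] at this
    exact_mod_cast this
  have hL : 1 ≤ Real.log k := by
    rw [Real.le_log_iff_exp_le hkpos]
    have := Real.exp_one_lt_d9
    linarith
  have hk1 : Real.log ((k + 1 : ℕ) : ℝ) ≤ Real.log k + 1 := by
    have h1 := Real.log_le_sub_one_of_pos (show (0 : ℝ) < ((k + 1 : ℕ) : ℝ) / k by positivity)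
    rw [Real.log_div (by positivity) (by positivity)] at h1
    have : ((k + 1 : ℕ) : ℝ) / k - 1 ≤ 1 := by
      push_cast
      rw [add_div, div_self hkpos.ne']
      have : 1 / (k : ℝ) ≤ 1 := by rw [div_le_one hkpos]; linarith
      linarith
    linarith
  have e1 : ((k : ℝ) - 3) * (Real.log n - 1 / 49) ≤ (k - 3) * Real.log ((n - k : ℕ) : ℝ) :=
    mul_le_mul_of_nonneg_left (by linarith) (by linarith)
  have hlnpos : 0 ≤ Real.log n := by linarith
  have e2 : (Nat.primeCounting k : ℝ) * Real.log n ≤ k / 4 * Real.log n :=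
    mul_le_mul_of_nonneg_right (by linarith) hlnpos
  have e3 : (3 / 4 * (k : ℝ) - 3) * (3 / 2 * Real.log k) ≤ (3 / 4 * k - 3) * Real.log n :=
    mul_le_mul_of_nonneg_left (by linarith) (by linarith)
  have e4 : (3000 : ℝ) * Real.log k ≤ k * Real.log k := mul_le_mul_of_nonneg_right hk' (by linarith)
  nlinarith

lemma log_oddFac_ge (U : ℕ) (hU : 1 ≤ U) : U * Real.log U - U ≤ Real.log (oddFac U : ℝ) := by
  have h1 : U.factorial ≤ oddFac U := by
    rw [oddFac, ← Finset.prod_range_add_one_eq_factorial]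
    exact Finset.prod_le_prod' fun i _ => by omega
  have h2 := Real.pow_div_factorial_le_exp (U : ℝ) (by positivity) U
  have hUpos : (0 : ℝ) < U := by exact_mod_cast hU
  have h3 := Real.log_le_log (by positivity) h2
  rw [Real.log_exp, Real.log_div (by positivity) (by positivity), Real.log_pow] at h3
  have h4 : Real.log (U.factorial : ℝ) ≤ Real.log (oddFac U : ℝ) :=
    Real.log_le_log (by positivity) (by exact_mod_cast h1)
  linarith

lemma large_U (n k U : ℕ) (hk : 130 ≤ k) (hU4 : 4 ≤ U) (hUk : 2 * U ≤ k)
    (hn : (k + 1) ^ 2 * (2 * U - 1) ≤ n) (hpi : 4 * Nat.primeCounting k ≤ k)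
    (h : (n - k) ^ (k - U) * oddFac U ≤ (k + 1).factorial * n ^ Nat.primeCounting k) : False := by
  have hn2 : k ^ 2 * U ≤ n := by
    refine le_trans (Nat.mul_le_mul (Nat.pow_le_pow_left (by omega) 2) (by omega)) hn
  have hn3 : k * (k + 1) ≤ n := by
    have : k ^ 2 * 4 ≤ k ^ 2 * U := Nat.mul_le_mul_left _ hU4
    nlinarith
  have hkn : k < n := by nlinarith
  have h6 : ((n - k : ℕ) : ℝ) ^ (k - U) * (oddFac U : ℝ) ≤
      (((k + 1).factorial : ℕ) : ℝ) * (n : ℝ) ^ Nat.primeCounting k := by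
    exact_mod_cast h
  have hkpos : (0 : ℝ) < k := by exact_mod_cast (show 0 < k by omega)
  have hUpos : (0 : ℝ) < U := by exact_mod_cast (show 0 < U by omega)
  have hnpos : (0 : ℝ) < n := by exact_mod_cast (show 0 < n by omega)
  have hnkpos : (0 : ℝ) < (n - k : ℕ) := by exact_mod_cast (show 0 < n - k by omega)
  have hopos : (0 : ℝ) < oddFac U := by
    have : 0 < oddFac U := Finset.prod_pos fun i _ => by omega
    exact_mod_cast this
  have h7 := Real.log_le_log (by positivity) h6
  rw [Real.log_mul (by positivity) (by positivity), Real.log_mul (by positivity) (by positivity),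
    Real.log_pow, Real.log_pow,
    Nat.factorial_succ, Nat.cast_mul, Real.log_mul (by positivity) (by positivity)] at h7
  have hf := log_factorial_le k (by omega)
  have ho := log_oddFac_ge U (by omega)
  have hs := log_sub_ge n k hkn
  have hn3' : (k * (k + 1) : ℝ) ≤ n := by exact_mod_cast hn3
  have hs2 : (k : ℝ) / (n - k) ≤ 1 / k := by
    rw [div_le_div_iff₀ (by nlinarith) hkpos]; nlinarith
  have hkU : ((k - U : ℕ) : ℝ) = k - U := by
    rw [Nat.cast_sub (by omega)]
  rw [hkU] at h7
  have hk' : (130 : ℝ) ≤ k := by exact_mod_cast hk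
  have hUk' : (2 * U : ℝ) ≤ k := by exact_mod_cast hUk
  have hU4' : (4 : ℝ) ≤ U := by exact_mod_cast hU4
  have hpi' : (4 * Nat.primeCounting k : ℝ) ≤ k := by exact_mod_cast hpi
  have hln : 2 * Real.log k + Real.log U ≤ Real.log n := by
    have : (k : ℝ) ^ 2 * U ≤ (n : ℝ) := by exact_mod_cast hn2
    have := Real.log_le_log (by positivity) this
    rw [Real.log_mul (by positivity) (by positivity), Real.log_pow] at this
    exact_mod_cast this
  have hlog2 := Real.log_two_gt_d9
  have hlog2' := Real.log_two_lt_d9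
  have hL : 4.8 ≤ Real.log k := by
    have : Real.log ((2 : ℝ) ^ 7) ≤ Real.log k := Real.log_le_log (by norm_num) (by norm_num; linarith)
    rw [Real.log_pow] at this
    push_cast at this
    linarith
  have hLk : Real.log k ≤ k / 2.718 := by
    have h := Real.add_one_le_exp (Real.log k - 1)
    rw [Real.exp_sub, Real.exp_log hkpos] at h
    have he := Real.exp_one_gt_d9
    have : (k : ℝ) / Real.exp 1 ≤ k / 2.718 := by
      apply div_le_div_of_nonneg_left hkpos.le (by norm_num); linarith
    linarith
  have hk1 : Real.log ((k + 1 : ℕ) : ℝ) ≤ Real.log k + 1 := by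
    have h1 := Real.log_le_sub_one_of_pos (show (0 : ℝ) < ((k + 1 : ℕ) : ℝ) / k by positivity)
    rw [Real.log_div (by positivity) (by positivity)] at h1
    have : ((k + 1 : ℕ) : ℝ) / k - 1 ≤ 1 := by
      push_cast
      rw [add_div, div_self hkpos.ne']
      have : 1 / (k : ℝ) ≤ 1 := by rw [div_le_one hkpos]; linarith
      linarith
    linarith
  have hlU : 2 * Real.log 2 ≤ Real.log U := by
    have : Real.log ((2 : ℝ) ^ 2) ≤ Real.log U := Real.log_le_log (by norm_num) (by norm_num; linarith)
    rw [Real.log_pow] at this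
    exact_mod_cast this
  have hlnpos : 0 ≤ Real.log n := by linarith
  have e1 : ((k : ℝ) - U) * (Real.log n - 1 / k) ≤ (k - U) * Real.log ((n - k : ℕ) : ℝ) :=
    mul_le_mul_of_nonneg_left (by linarith) (by linarith)
  have e1' : ((k : ℝ) - U) * (1 / k) ≤ 1 := by
    rw [mul_one_div, div_le_one hkpos]; linarith
  have e2 : (Nat.primeCounting k : ℝ) * Real.log n ≤ k / 4 * Real.log n :=
    mul_le_mul_of_nonneg_right (by linarith) hlnpos
  have e3 : (3 / 4 * (k : ℝ) - U) * (2 * Real.log k + Real.log U) ≤ (3 / 4 * k - U) * Real.log n :=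
    mul_le_mul_of_nonneg_left hln (by linarith)
  -- main inequality
  have main : k * Real.log k / 2 - 2 * U * Real.log k + 3 / 4 * k * Real.log U + k - U ≤
      2 * Real.log k + 3 := by
    rw [mul_sub] at e1
    linarith [h7, hf, ho, e1, e1', e2, e3, hk1]
  rcases le_total (4 * (U : ℝ)) k with hc | hc
  · have f1 : 4 * (U : ℝ) * Real.log k ≤ k * Real.log k :=
      mul_le_mul_of_nonneg_right hc (by linarith)
    have f2 : 3 / 4 * (k : ℝ) * (2 * Real.log 2) ≤ 3 / 4 * k * Real.log U :=
      mul_le_mul_of_nonneg_left hlU (by linarith)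
    have f3 : 3 / 4 * (k : ℝ) * 1.38 ≤ 3 / 4 * k * (2 * Real.log 2) :=
      mul_le_mul_of_nonneg_left (by linarith) (by linarith)
    norm_num at hLk f3
    linarith
  · have hlU2 : Real.log k - 2 * Real.log 2 ≤ Real.log U := by
      have : Real.log k ≤ Real.log ((2 : ℝ) ^ 2 * U) := Real.log_le_log hkpos (by linarith)
      rw [Real.log_mul (by norm_num) (by positivity), Real.log_pow] at this
      push_cast at this
      linarith
    have f1 : 2 * (U : ℝ) * Real.log k ≤ k * Real.log k :=
      mul_le_mul_of_nonneg_right hUk' (by linarith)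
    have f2 : 3 / 4 * (k : ℝ) * (Real.log k - 1.4) ≤ 3 / 4 * k * Real.log U :=
      mul_le_mul_of_nonneg_left (by linarith) (by linarith)
    have f4 : (130 : ℝ) * (Real.log k - 4.8) ≤ k * (Real.log k - 4.8) :=
      mul_le_mul_of_nonneg_right hk' (by linarith)
    norm_num at f2 f4
    linarith

/-- `y` has a prime factor `> k` occurring to exactly the first power -/
def ExactIdx (k y : ℕ) : Prop := ∃ p : ℕ, p.Prime ∧ k < p ∧ p ∣ y ∧ ¬ p ^ 2 ∣ y

lemma exactIdx_prime (k p : ℕ) (hp : p.Prime) (hk : k < p) : ExactIdx k p := by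
  refine ⟨p, hp, hk, dvd_rfl, fun h => ?_⟩
  have h1 := Nat.le_of_dvd hp.pos h
  have := hp.one_lt
  nlinarith

lemma tri (n k d a b c : ℕ) (hC : Constr n k d) (hab : a < b) (hbc : b < c) (hcn : c ≤ n)
    (hna : n ≤ a + k) (ha : ExactIdx k a) (hb : ExactIdx k b) (hc : ExactIdx k c) : False := by
  have key : ∀ y, y ≤ n → n ≤ y + k → ExactIdx k y → d = n - y ∨ d + (n - y) = k := by
    intro y hy hy2 ⟨p, hp, hkp, hpy, hpy2⟩
    have e : n - (n - y) = y := by omega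
    have := (hC (n - y) (by omega) p hp hkp (by rw [e]; exact hpy)).1 (by rw [e]; exact hpy2)
    exact this
  have h1 := key a (by omega) (by omega) ha
  have h2 := key b (by omega) (by omega) hb
  have h3 := key c (by omega) (by omega) hc
  omega

lemma triP (n k d a b c : ℕ) (hC : Constr n k d) (hka : k < a) (ha : a.Prime) (hb : b.Prime)
    (hc : c.Prime) (hab : a < b) (hbc : b < c) (hcn : c ≤ n) (hna : n ≤ a + k) : False :=
  tri n k d a b c hC hab hbc hcn hna (exactIdx_prime k a ha hka)
    (exactIdx_prime k b hb (by omega)) (exactIdx_prime k c hc (by omega))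

lemma ladder (n k d : ℕ) (hC : Constr n k d) (hk : 60 ≤ k) (hk2 : k < 3000) (h2 : 2 * k ≤ n)
    (h4 : n ≤ 4 * k) : False := by
  by_cases h71 : n < k + 71
  · exact triP n k d 71 73 79 hC (by omega) (by norm_num) (by norm_num) (by norm_num)
      (by norm_num) (by norm_num) (by omega) (by omega)
  by_cases h79 : n < k + 79
  · exact triP n k d 79 83 89 hC (by omega) (by norm_num) (by norm_num) (by norm_num)
      (by norm_num) (by norm_num) (by omega) (by omega)
  by_cases h97 : n < k + 97
  · exact triP n k d 97 101 103 hC (by omega) (by norm_num) (by norm_num) (by norm_num)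
      (by norm_num) (by norm_num) (by omega) (by omega)
  by_cases h109 : n < k + 109
  · exact triP n k d 109 113 127 hC (by omega) (by norm_num) (by norm_num) (by norm_num)
      (by norm_num) (by norm_num) (by omega) (by omega)
  by_cases h131 : n < k + 131
  · exact triP n k d 131 137 139 hC (by omega) (by norm_num) (by norm_num) (by norm_num)
      (by norm_num) (by norm_num) (by omega) (by omega)
  by_cases h163 : n < k + 163
  · exact triP n k d 163 167 173 hC (by omega) (by norm_num) (by norm_num) (by norm_num)
      (by norm_num) (by norm_num) (by omega) (by omega)
  by_cases h197 : n < k + 197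
  · exact triP n k d 197 199 211 hC (by omega) (by norm_num) (by norm_num) (by norm_num)
      (by norm_num) (by norm_num) (by omega) (by omega)
  by_cases h241 : n < k + 241
  · exact triP n k d 241 251 257 hC (by omega) (by norm_num) (by norm_num) (by norm_num)
      (by norm_num) (by norm_num) (by omega) (by omega)
  by_cases h311 : n < k + 311
  · exact triP n k d 311 313 317 hC (by omega) (by norm_num) (by norm_num) (by norm_num)
      (by norm_num) (by norm_num) (by omega) (by omega)
  by_cases h397 : n < k + 397
  · exact triP n k d 397 401 409 hC (by omega) (by norm_num) (by norm_num) (by norm_num)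
      (by norm_num) (by norm_num) (by omega) (by omega)
  by_cases h509 : n < k + 509
  · exact triP n k d 509 521 523 hC (by omega) (by norm_num) (by norm_num) (by norm_num)
      (by norm_num) (by norm_num) (by omega) (by omega)
  by_cases h661 : n < k + 661
  · exact triP n k d 661 673 677 hC (by omega) (by norm_num) (by norm_num) (by norm_num)
      (by norm_num) (by norm_num) (by omega) (by omega)
  by_cases h863 : n < k + 863
  · exact triP n k d 863 877 881 hC (by omega) (by norm_num) (by norm_num) (by norm_num)
      (by norm_num) (by norm_num) (by omega) (by omega)
  by_cases h1117 : n < k + 1117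
  · exact triP n k d 1117 1123 1129 hC (by omega) (by norm_num) (by norm_num) (by norm_num)
      (by norm_num) (by norm_num) (by omega) (by omega)
  by_cases h1483 : n < k + 1483
  · exact triP n k d 1483 1487 1489 hC (by omega) (by norm_num) (by norm_num) (by norm_num)
      (by norm_num) (by norm_num) (by omega) (by omega)
  by_cases h1949 : n < k + 1949
  · exact triP n k d 1949 1951 1973 hC (by omega) (by norm_num) (by norm_num) (by norm_num)
      (by norm_num) (by norm_num) (by omega) (by omega)
  by_cases h2579 : n < k + 2579
  · exact triP n k d 2579 2591 2593 hC (by omega) (by norm_num) (by norm_num) (by norm_num)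
      (by norm_num) (by norm_num) (by omega) (by omega)
  by_cases h3407 : n < k + 3407
  · exact triP n k d 3407 3413 3433 hC (by omega) (by norm_num) (by norm_num) (by norm_num)
      (by norm_num) (by norm_num) (by omega) (by omega)
  by_cases h4517 : n < k + 4517
  · exact triP n k d 4517 4519 4523 hC (by omega) (by norm_num) (by norm_num) (by norm_num)
      (by norm_num) (by norm_num) (by omega) (by omega)
  by_cases h5987 : n < k + 5987
  · exact triP n k d 5987 6007 6011 hC (by omega) (by norm_num) (by norm_num) (by norm_num)
      (by norm_num) (by norm_num) (by omega) (by omega)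
  by_cases h7949 : n < k + 7949
  · exact triP n k d 7949 7951 7963 hC (by omega) (by norm_num) (by norm_num) (by norm_num)
      (by norm_num) (by norm_num) (by omega) (by omega)
  by_cases h10567 : n < k + 10567
  · exact triP n k d 10567 10589 10597 hC (by omega) (by norm_num) (by norm_num) (by norm_num)
      (by norm_num) (by norm_num) (by omega) (by omega)
  omega

/-- evaluates the argument `n` before passing it on -/
def forceNat (n : ℕ) (g : ℕ → Bool) : Bool := Nat.rec (g 0) (fun m _ => g (m + 1)) n

lemma forceNat_eq (n : ℕ) (g : ℕ → Bool) : forceNat n g = g n := by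
  cases n <;> rfl

/-- candidates for primes (every prime `≥ 11` is one) -/
def cand (j : ℕ) : Bool :=
  Nat.beq (Nat.gcd j 4274883284060025564298013753389399649690343788366813724672000000000000) 1 || (Nat.ble j 53 && Nat.beq (Nat.gcd j 210) 1)

lemma fac53 : Nat.factorial 53 = 4274883284060025564298013753389399649690343788366813724672000000000000 := by
  decide +kernel

lemma cand_of_prime (j : ℕ) (h : 11 ≤ j) (hj : j.Prime) : cand j = true := by
  unfold cand
  rw [← fac53]
  rcases Nat.lt_or_ge 53 j with h1 | h1
  · have : Nat.gcd j (Nat.factorial 53) = 1 := by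
      rw [← Nat.coprime_iff_gcd_eq_one, hj.coprime_iff_not_dvd, hj.dvd_factorial]; omega
    simp [this]
  · have h2 : Nat.gcd j 210 = 1 := by
      rw [← Nat.coprime_iff_gcd_eq_one, hj.coprime_iff_not_dvd]
      intro hd
      rw [show 210 = 2 * 3 * 5 * 7 by norm_num, hj.dvd_mul, hj.dvd_mul, hj.dvd_mul] at hd
      rcases hd with ((hd | hd) | hd) | hd <;>
        · have := Nat.le_of_dvd (by norm_num) hd
          omega
    simp [h1, h2]

def oddF (U : ℕ) : ℕ := Nat.rec 1 (fun j r => r * (2 * j + 1)) U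

lemma oddF_eq (U : ℕ) : oddF U = oddFac U := by
  induction U with
  | zero => simp [oddF, oddFac]
  | succ U ih => rw [oddFac, Finset.prod_range_succ, ← oddFac, ← ih]; rfl

/-- test for the inequality coming from `U` exceptional indices -/
def uTest (k fac pi U : ℕ) : Bool :=
  Nat.blt U 4 || (Nat.blt (fac * ((k + 1) ^ 2 * (2 * U - 1)) ^ pi)
    (((k + 1) ^ 2 * (2 * U - 1) - k) ^ (k - U) * oddF U) && Nat.ble pi (k - U))

def delTest (k fac pi n0 : ℕ) : Bool :=
  Nat.blt (fac * n0 ^ pi) ((n0 - k) ^ (k - 3)) && Nat.ble pi (k - 3)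

def kTest (k fac pi : ℕ) : Bool :=
  (Nat.blt k 60 || delTest k fac pi (4 * k)) &&
  (Nat.blt k 130 || Nat.ble (4 * pi) k) &&
  (Nat.blt k 26 || Nat.ble 60 k || delTest k fac pi (6 * k)) &&
  (Nat.blt k 11 || Nat.ble 26 k || Nat.beq (k % 2) 0 || delTest k fac pi 850) &&
  (Nat.blt k 26 || Nat.ble 130 k || Nat.beq (k % 2) 1 || (List.range (k / 2 + 1)).all (uTest k fac pi))

/-- loop over `k = 3000 - f` -/
def kLoop (f : ℕ) : ℕ → ℕ → Bool :=
  Nat.rec (fun _ _ => true)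
    (fun f ih fac pi => kTest (3000 - (f + 1)) fac pi &&
      forceNat (fac * (3000 - f + 1)) fun fac' =>
        forceNat (bif cand (3000 - f) then pi + 1 else pi) fun pi' => ih fac' pi') f

lemma kLoop_sound (f : ℕ) : ∀ fac pi : ℕ, f ≤ 2990 → kLoop f fac pi = true →
    fac = (3000 - f + 1).factorial → Nat.primeCounting (3000 - f) ≤ pi →
    ∀ k, 3000 - f ≤ k → k < 3000 →
      ∃ pi', Nat.primeCounting k ≤ pi' ∧ kTest k (k + 1).factorial pi' = true := by
  induction f with
  | zero => intro _ _ _ _ _ _ k h1 h2; omega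
  | succ f ih =>
    intro fac pi hf h hfac hpi k h1 h2
    have h' : (kTest (3000 - (f + 1)) fac pi &&
      forceNat (fac * (3000 - f + 1)) fun fac' =>
        forceNat (bif cand (3000 - f) then pi + 1 else pi) fun pi' => kLoop f fac' pi') = true := h
    rw [Bool.and_eq_true, forceNat_eq, forceNat_eq] at h'
    rcases Nat.eq_or_lt_of_le h1 with h3 | h3
    · refine ⟨pi, ?_, ?_⟩
      · rw [← h3]; exact hpi
      · rw [← h3, ← hfac]; exact h'.1
    · have e : 3000 - f = 3000 - (f + 1) + 1 := by omega
      refine ih _ _ (by omega) h'.2 ?_ ?_ k (by omega) h2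
      · rw [hfac, e, Nat.factorial_succ (3000 - (f + 1) + 1)]; ring
      · have hs : Nat.primeCounting (3000 - f) = Nat.primeCounting (3000 - (f + 1)) +
            if (3000 - f).Prime then 1 else 0 := by
          rw [e, Nat.primeCounting, Nat.primeCounting, Nat.primeCounting', Nat.count_succ]
        rw [hs]
        split_ifs with hp
        · rw [cand_of_prime _ (by omega) hp]
          simp only [cond_true]; omega
        · cases cand (3000 - f) <;> simp only [cond_true, cond_false] <;> omega

lemma kLoop_true : kLoop 2990 (Nat.factorial 11) 4 = true := by decide +kernel

lemma kTest_all (k : ℕ) (h1 : 10 ≤ k) (h2 : k < 3000) :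
    ∃ pi', Nat.primeCounting k ≤ pi' ∧ kTest k (k + 1).factorial pi' = true :=
  kLoop_sound 2990 _ _ le_rfl kLoop_true (by norm_num) (by decide +kernel) k (by omega) h2

lemma delTest_sound (n k n0 pi : ℕ) (hkn : k < n0) (hn : n0 ≤ n) (hA : (roughSet n k).card ≤ 4)
    (hpi : Nat.primeCounting k ≤ pi) (h : delTest k (k + 1).factorial pi n0 = true) : False := by
  simp only [delTest, Bool.and_eq_true, Nat.blt_eq, Nat.ble_eq] at h
  have h1 := DEL4 n k (by omega) hA
  have h2 := MONO n n0 k (k - 3) (Nat.primeCounting k) 1 (k + 1).factorial hn hkn (by omega) (by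
    rw [mul_one]
    exact lt_of_le_of_lt (Nat.mul_le_mul_left _ (Nat.pow_le_pow_right (by omega) hpi)) h.1)
  rw [mul_one] at h2
  omega

lemma uTest_sound (n k U pi : ℕ) (h26 : 26 ≤ k) (hU : 4 ≤ U)
    (hn : (k + 1) ^ 2 * (2 * U - 1) ≤ n)
    (hpi : Nat.primeCounting k ≤ pi) (h : uTest k (k + 1).factorial pi U = true)
    (hUB : (n - k) ^ (k - U) * oddFac U ≤ (k + 1).factorial * n ^ Nat.primeCounting k) : False := by
  simp only [uTest, Bool.or_eq_true, Bool.and_eq_true, Nat.blt_eq, Nat.ble_eq] at h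
  rcases h with h | h
  · omega
  rw [oddF_eq] at h
  have hk : k < (k + 1) ^ 2 * (2 * U - 1) := by
    have : (k + 1) ^ 2 * 1 ≤ (k + 1) ^ 2 * (2 * U - 1) := Nat.mul_le_mul_left _ (by omega)
    nlinarith
  have h2 := MONO n _ k (k - U) (Nat.primeCounting k) (oddFac U) (k + 1).factorial hn hk (by omega)
    (lt_of_le_of_lt (Nat.mul_le_mul_left _ (Nat.pow_le_pow_right (by omega) hpi)) h.1)
  omega

/-- the part of `x` composed of primes `> k` when `W = (k!)^20`, `x < 2^20` -/
def roughPart (W x : ℕ) : ℕ := x / Nat.gcd x W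

lemma roughPart_prime (k x p : ℕ) (hx : 0 < x) (hx2 : x < 2 ^ 20) (hp : p.Prime)
    (hd : p ∣ roughPart (k.factorial ^ 20) x) : k < p := by
  by_contra hcon
  set W := k.factorial ^ 20 with hW
  have hg : Nat.gcd x W ∣ x := Nat.gcd_dvd_left _ _
  have hpk : p ∣ k.factorial := (hp.dvd_factorial).2 (by omega)
  have hxe : roughPart W x * Nat.gcd x W = x := Nat.div_mul_cancel hg
  -- p ^ j ∣ x and p ^ j ∣ W for growing j
  have key : ∀ j, j ≤ 20 → p ^ j ∣ x := by
    intro j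
    induction j with
    | zero => intro _; simp
    | succ j ih =>
      intro hj
      have h1 := ih (by omega)
      have h2 : p ^ j ∣ W := by
        rw [hW]
        exact (pow_dvd_pow_of_dvd hpk j).trans (pow_dvd_pow _ (by omega))
      have h3 : p ^ j ∣ Nat.gcd x W := Nat.dvd_gcd h1 h2
      rw [← hxe, pow_succ, mul_comm]
      exact Nat.mul_dvd_mul hd h3
  have h1 := Nat.le_of_dvd hx (key 20 le_rfl)
  have h2 : 2 ^ 20 ≤ p ^ 20 := Nat.pow_le_pow_left hp.two_le 20
  omega

lemma roughPart_dvd (W x : ℕ) : roughPart W x ∣ x := Nat.div_dvd_of_dvd (Nat.gcd_dvd_left _ _)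

lemma beq_false_iff (a b : ℕ) : Nat.beq a b = false ↔ a ≠ b := by
  rw [← Bool.not_eq_true, Nat.beq_eq]

def e1 (k W x : ℕ) : Bool :=
  (!(Nat.beq (roughPart W x) 1)) && (Nat.blt (roughPart W x) ((k + 1) ^ 2) ||
    !(Nat.beq (roughPart W x % 24) 1))

lemma sq_mod24 (p : ℕ) (h2 : p % 2 ≠ 0) (h3 : p % 3 ≠ 0) : p ^ 2 % 24 = 1 := by
  have h : ∀ r < 24, r % 2 ≠ 0 → r % 3 ≠ 0 → r ^ 2 % 24 = 1 := by decide
  rw [Nat.pow_mod]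
  exact h (p % 24) (Nat.mod_lt _ (by norm_num)) (by omega) (by omega)

lemma rough_of_ne_one (k x : ℕ) (hx : 0 < x) (hx2 : x < 2 ^ 20)
    (h : roughPart (k.factorial ^ 20) x ≠ 1) : ∃ p : ℕ, p.Prime ∧ k < p ∧ p ∣ x := by
  obtain ⟨p, hp, hpd⟩ := Nat.exists_prime_and_dvd h
  exact ⟨p, hp, roughPart_prime k x p hx hx2 hp hpd, hpd.trans (roughPart_dvd _ _)⟩

lemma e1_sound (k x : ℕ) (hk : 4 ≤ k) (hx : 0 < x) (hx2 : x < 2 ^ 20) (hx3 : x < (k + 1) ^ 3)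
    (h : e1 k (k.factorial ^ 20) x = true) : ExactIdx k x := by
  set W := k.factorial ^ 20 with hW
  have h' : roughPart W x ≠ 1 ∧ (roughPart W x < (k + 1) ^ 2 ∨ roughPart W x % 24 ≠ 1) := by
    simpa [e1, beq_false_iff] using h
  obtain ⟨h1, h2⟩ := h'
  set L := roughPart W x with hL
  have hLx : L ∣ x := roughPart_dvd _ _
  have hLle : L ≤ x := Nat.le_of_dvd hx hLx
  have hL0 : 0 < L := Nat.pos_of_dvd_of_pos hLx hx
  obtain ⟨p, hp, hpd⟩ := Nat.exists_prime_and_dvd h1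
  have hkp := roughPart_prime k x p hx hx2 hp hpd
  refine ⟨p, hp, hkp, hpd.trans hLx, fun hsq => ?_⟩
  have hxe : L * Nat.gcd x W = x := Nat.div_mul_cancel (Nat.gcd_dvd_left _ _)
  have hcop : Nat.Coprime (p ^ 2) (Nat.gcd x W) := by
    apply Nat.Coprime.pow_left
    rw [hp.coprime_iff_not_dvd]
    intro hd
    have h5 := hp.dvd_of_dvd_pow (hd.trans (Nat.gcd_dvd_right _ _))
    rw [hp.dvd_factorial] at h5
    omega
  rw [← hxe] at hsq
  obtain ⟨m, hm⟩ := hcop.dvd_of_dvd_mul_right hsq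
  have hp2 : (k + 1) ^ 2 ≤ p ^ 2 := Nat.pow_le_pow_left hkp 2
  have hm1 : m = 1 := by
    by_contra hm1
    obtain ⟨q, hq, hqm⟩ := Nat.exists_prime_and_dvd hm1
    have hkq : k < q := roughPart_prime k x q hx hx2 hq (by
      change q ∣ L
      rw [hm]; exact hqm.mul_left _)
    have hm0 : 0 < m := by
      rcases Nat.eq_zero_or_pos m with h | h
      · subst h; omega
      · exact h
    have hqle := Nat.le_of_dvd hm0 hqm
    have : (k + 1) ^ 2 * (k + 1) ≤ p ^ 2 * m := Nat.mul_le_mul hp2 (by omega)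
    have : (k + 1) ^ 3 = (k + 1) ^ 2 * (k + 1) := by ring
    omega
  rw [hm1, mul_one] at hm
  rcases h2 with h2 | h2
  · omega
  · apply h2
    rw [hm]
    refine sq_mod24 p ?_ ?_
    · intro h; have := (Nat.prime_dvd_prime_iff_eq Nat.prime_two hp).1 (Nat.dvd_of_mod_eq_zero h); omega
    · intro h; have := (Nat.prime_dvd_prime_iff_eq Nat.prime_three hp).1 (Nat.dvd_of_mod_eq_zero h); omega

def opts (i : ℕ) : List ℕ := bif Nat.beq (i % 2) 0 then [0, i, i / 2] else [0, i]

lemma mem_opts (i r : ℕ) (h : r = 0 ∨ r = i ∨ 2 * r = i) : r ∈ opts i := by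
  unfold opts
  rcases h with h | h | h
  · subst h; cases Nat.beq (i % 2) 0 <;> simp
  · subst h; cases Nat.beq (r % 2) 0 <;> simp
  · have : i % 2 = 0 := by omega
    rw [this]
    simp; omega

/-- index `i` rules out `d` -/
def rulesOut (k W n d i : ℕ) : Bool :=
  !(Nat.beq d i) && !(Nat.beq (d + i) k) && (e1 k W (n - i) ||
    (!(Nat.beq (roughPart W (n - i)) 1) &&
      (opts i).all fun r => (opts (k - i)).all fun t => !(Nat.beq d (r + t))))

lemma rulesOut_sound (k n d i : ℕ) (hk : 4 ≤ k) (hik : i ≤ k) (hkn : k < n) (h3 : n < (k + 1) ^ 3)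
    (h20 : n < 2 ^ 20) (h : rulesOut k (k.factorial ^ 20) n d i = true) : ¬ Constr n k d := by
  intro hC
  simp only [rulesOut, Bool.and_eq_true, Bool.or_eq_true, Bool.not_eq_true', beq_false_iff,
    List.all_eq_true] at h
  obtain ⟨⟨hdi, hdk⟩, h | ⟨h1, h2⟩⟩ := h
  · obtain ⟨p, hp, hkp, hpd, hpd2⟩ := e1_sound k (n - i) hk (by omega) (by omega) (by omega) h
    have := (hC i hik p hp hkp hpd).1 hpd2
    omega
  · obtain ⟨p, hp, hkp, hpd⟩ := rough_of_ne_one k (n - i) (by omega) (by omega) h1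
    obtain ⟨g1, g2⟩ := hC i hik p hp hkp hpd
    by_cases hsq : p ^ 2 ∣ n - i
    · obtain ⟨r, t, e, hr, ht⟩ := g2 hsq
      exact h2 r (mem_opts i r hr) t (mem_opts _ t ht) e
    · have := g1 hsq
      clear g1 g2
      omega

def chk (k W n : ℕ) : Bool :=
  (List.range (k / 2)).all fun d => (List.range (k + 1)).any fun i => rulesOut k W n (d + 1) i

lemma chk_sound (k n d : ℕ) (hk : 4 ≤ k) (hkn : k < n) (h3 : n < (k + 1) ^ 3)
    (h20 : n < 2 ^ 20) (h : chk k (k.factorial ^ 20) n = true) (hd : 1 ≤ d) (h2d : 2 * d ≤ k) :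
    ¬ Constr n k d := by
  simp only [chk, List.all_eq_true, List.any_eq_true, List.mem_range] at h
  obtain ⟨i, hi, hr⟩ := h (d - 1) (by omega)
  rw [show d - 1 + 1 = d by omega] at hr
  exact rulesOut_sound k n d i hk (by omega) hkn h3 h20 hr

def exc (k n : ℕ) : Bool :=
  Nat.beq n (2 * k) && (Nat.beq k 4 || Nat.beq k 5 || Nat.beq k 6 || Nat.beq k 8)

def okAt (k W x a : ℕ) : Bool :=
  Nat.blt x (2 * k) || Nat.ble x (a + k) || exc k x || chk k W x

/-- loop over `x = N - f` -/
def xLoop (k W N f : ℕ) : ℕ → ℕ → ℕ → Bool :=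
  Nat.rec (fun _ _ _ => true)
    (fun f ih a b c =>
      bif e1 k W (N - (f + 1)) then (okAt k W (N - (f + 1)) b && ih b c (N - (f + 1)))
      else (okAt k W (N - (f + 1)) a && ih a b c)) f

lemma okAt_sound (k x a b c d : ℕ) (hk : 4 ≤ k) (hx3 : x < (k + 1) ^ 3) (hx20 : x < 2 ^ 20)
    (h2k : 2 * k ≤ x)
    (ha : a ≠ 0 → ExactIdx k a ∧ a < b) (hb : b ≠ 0 → ExactIdx k b ∧ b < c)
    (hc : c ≠ 0 → ExactIdx k c ∧ c < x + 1) (h : okAt k (k.factorial ^ 20) x a = true)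
    (hd : 1 ≤ d) (h2d : 2 * d ≤ k) : exc k x = true ∨ ¬ Constr x k d := by
  simp only [okAt, Bool.or_eq_true, Nat.blt_eq, Nat.ble_eq] at h
  rcases h with ((h | h) | h) | h
  · omega
  · right
    intro hC
    obtain ⟨a1, a2⟩ := ha (by omega)
    obtain ⟨b1, b2⟩ := hb (by omega)
    obtain ⟨c1, c2⟩ := hc (by omega)
    exact tri x k d a b c hC a2 b2 (by omega) h a1 b1 c1
  · exact Or.inl h
  · exact Or.inr (chk_sound k x d hk (by omega) hx3 hx20 h hd h2d)

lemma xLoop_sound (k N : ℕ) (hk : 4 ≤ k) (hN3 : N ≤ (k + 1) ^ 3) (hN20 : N ≤ 2 ^ 20) (f : ℕ) :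
    ∀ a b c : ℕ, f < N → xLoop k (k.factorial ^ 20) N f a b c = true →
    (a ≠ 0 → ExactIdx k a ∧ a < b) → (b ≠ 0 → ExactIdx k b ∧ b < c) →
    (c ≠ 0 → ExactIdx k c ∧ c < N - f) →
    ∀ x d, N - f ≤ x → x < N → 2 * k ≤ x → 1 ≤ d → 2 * d ≤ k → exc k x = true ∨ ¬ Constr x k d := by
  induction f with
  | zero => intro _ _ _ _ _ _ _ _ x d h1 h2; omega
  | succ f ih =>
    intro a b c hf h ha hb hc x d hx1 hx2 hx3 hd h2d
    have hstep : xLoop k (k.factorial ^ 20) N (f + 1) a b c =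
      bif e1 k (k.factorial ^ 20) (N - (f + 1)) then
        (okAt k (k.factorial ^ 20) (N - (f + 1)) b &&
          xLoop k (k.factorial ^ 20) N f b c (N - (f + 1)))
      else (okAt k (k.factorial ^ 20) (N - (f + 1)) a && xLoop k (k.factorial ^ 20) N f a b c) := rfl
    rw [hstep] at h
    set y := N - (f + 1) with hy
    have hyf : N - f = y + 1 := by omega
    rw [hyf] at ih
    cases he : e1 k (k.factorial ^ 20) y with
    | true =>
      rw [he, cond_true, Bool.and_eq_true] at h
      have hE := e1_sound k y hk (by omega) (by omega) (by omega) he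
      have hc' : c ≠ 0 → ExactIdx k c ∧ c < y := hc
      rcases Nat.eq_or_lt_of_le hx1 with e | e
      · subst e
        exact okAt_sound k y b c y d hk (by omega) (by omega) hx3 hb hc' (fun _ => ⟨hE, by omega⟩)
          h.1 hd h2d
      · exact ih b c y (by omega) h.2 hb hc' (fun _ => ⟨hE, by omega⟩) x d (by omega) hx2 hx3 hd h2d
    | false =>
      rw [he, cond_false, Bool.and_eq_true] at h
      have hc' : c ≠ 0 → ExactIdx k c ∧ c < y + 1 := fun h => ⟨(hc h).1, by have := (hc h).2; omega⟩
      rcases Nat.eq_or_lt_of_le hx1 with e | e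
      · subst e
        exact okAt_sound k y a b c d hk (by omega) (by omega) hx3 ha hb hc' h.1 hd h2d
      · exact ih a b c (by omega) h.2 ha hb hc' x d (by omega) hx2 hx3 hd h2d

def bnd (k : ℕ) : ℕ :=
  bif Nat.ble k 9 || (Nat.ble k 25 && Nat.beq (k % 2) 0) then (k + 1) ^ 3
  else bif Nat.ble k 25 then 851 else 6 * k + 1

def runAll (K : ℕ) : Bool :=
  Nat.rec true (fun k r => r && (Nat.blt k 4 ||
    (Nat.ble (bnd k) ((k + 1) ^ 3) && forceNat (k.factorial ^ 20) fun W =>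
      forceNat (bnd k) fun N => xLoop k W N (N - k) 0 0 0))) K

set_option maxRecDepth 100000 in
lemma runAll_true : runAll 60 = true := by decide +kernel

lemma runAll_imp (K : ℕ) (h : runAll K = true) (k : ℕ) (hk : k < K) (h4 : 4 ≤ k) :
    bnd k ≤ (k + 1) ^ 3 ∧ xLoop k (k.factorial ^ 20) (bnd k) (bnd k - k) 0 0 0 = true := by
  induction K with
  | zero => omega
  | succ K ih =>
    have hs : runAll (K + 1) = (runAll K && (Nat.blt K 4 ||
      (Nat.ble (bnd K) ((K + 1) ^ 3) && forceNat (K.factorial ^ 20) fun W =>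
      forceNat (bnd K) fun N => xLoop K W N (N - K) 0 0 0))) := rfl
    rw [hs] at h
    simp only [forceNat_eq, Bool.and_eq_true, Bool.or_eq_true, Nat.blt_eq, Nat.ble_eq] at h
    rcases Nat.lt_or_ge k K with h1 | h1
    · exact ih h.1 h1
    · have : k = K := by omega
      subst this
      rcases h.2 with h2 | h2
      · omega
      · exact h2

lemma small_pass (n k d : ℕ) (h4 : 4 ≤ k) (hk : k < 60) (h2 : 2 * k ≤ n) (hn : n < bnd k)
    (hd : 1 ≤ d) (h2d : 2 * d ≤ k) : exc k n = true ∨ ¬ Constr n k d := by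
  obtain ⟨h1, h3⟩ := runAll_imp 60 runAll_true k hk h4
  have : (k + 1) ^ 3 ≤ 60 ^ 3 := Nat.pow_le_pow_left (by omega) 3
  exact xLoop_sound k (bnd k) h4 h1 (by omega) (bnd k - k) 0 0 0 (by omega) h3 (by simp) (by simp)
    (by simp) n d (by omega) hn h2 hd h2d

lemma dichotomy (n k d : ℕ) (h4 : 4 ≤ k) (hkn : 2 * k ≤ n) (h3 : n < (k + 1) ^ 3) (hd : 1 ≤ d)
    (h2d : 2 * d ≤ k) (hC : Constr n k d) : (roughSet n k).card ≤ 4 ∨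
    ∃ U, k % 2 = 0 ∧ 4 ≤ U ∧ 2 * U ≤ k ∧ (k + 1) ^ 2 * (2 * U - 1) ≤ n ∧
      (n - k) ^ (k - U) * oddFac U ≤ (k + 1).factorial * n ^ Nat.primeCounting k := by
  rcases Nat.lt_or_ge (2 * d) k with h | h
  · exact Or.inl (card_le_four n k d hd h hC)
  · obtain ⟨U, h5, h6, h7⟩ := UB n k d h4 hkn h3 (by omega) hC
    rcases Nat.lt_or_ge U 4 with hU | hU
    · left; omega
    · right
      have h8 := h7 (by omega)
      have h9 : 2 * U - 1 < k + 1 := by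
        have : (k + 1) ^ 2 * (2 * U - 1) < (k + 1) ^ 2 * (k + 1) := by
          have : (k + 1) ^ 3 = (k + 1) ^ 2 * (k + 1) := by ring
          omega
        exact lt_of_mul_lt_mul_left this (Nat.zero_le _)
      exact ⟨U, by omega, hU, by omega, h8, h6⟩

lemma kTest_spec (k : ℕ) (h1 : 10 ≤ k) (h2 : k < 3000) :
    ∃ pi, Nat.primeCounting k ≤ pi ∧
      (60 ≤ k → delTest k (k + 1).factorial pi (4 * k) = true) ∧
      (130 ≤ k → 4 * pi ≤ k) ∧
      (26 ≤ k → k < 60 → delTest k (k + 1).factorial pi (6 * k) = true) ∧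
      (11 ≤ k → k < 26 → k % 2 = 1 → delTest k (k + 1).factorial pi 850 = true) ∧
      (26 ≤ k → k < 130 → k % 2 = 0 → ∀ U, 2 * U ≤ k → uTest k (k + 1).factorial pi U = true) := by
  obtain ⟨pi, hpi, h⟩ := kTest_all k h1 h2
  refine ⟨pi, hpi, ?_⟩
  simp only [kTest, Bool.and_eq_true, Bool.or_eq_true, Nat.blt_eq, Nat.ble_eq, Nat.beq_eq,
    List.all_eq_true, List.mem_range] at h
  obtain ⟨⟨⟨⟨a, b⟩, c⟩, d⟩, e⟩ := h
  refine ⟨fun g => a.resolve_left (by omega), fun g => b.resolve_left (by omega),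
    fun g g' => c.resolve_left (by omega), fun g g' g'' => d.resolve_left (by omega),
    fun g g' g'' U hU => (e.resolve_left (by omega)) U (by omega)⟩

lemma no_constr (n k d : ℕ) (h4 : 4 ≤ k) (h2 : 2 * k ≤ n) (h3 : n < (k + 1) ^ 3)
    (hexc : exc k n = false) (hd : 1 ≤ d) (h2d : 2 * d ≤ k) : ¬ Constr n k d := by
  intro hC
  have hdich := dichotomy n k d h4 h2 h3 hd h2d hC
  rcases Nat.lt_or_ge k 60 with h60 | h60
  · rcases Nat.lt_or_ge n (bnd k) with hb | hb
    · rcases small_pass n k d h4 h60 h2 hb hd h2d with h | h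
      · rw [hexc] at h; exact absurd h (by simp)
      · exact h hC
    · by_cases c1 : k ≤ 9 ∨ (k ≤ 25 ∧ k % 2 = 0)
      · have : bnd k = (k + 1) ^ 3 := by
          have : (Nat.ble k 9 || (Nat.ble k 25 && Nat.beq (k % 2) 0)) = true := by
            simpa [Nat.beq_eq] using c1
          simp only [bnd, this, cond_true]
        omega
      · have h0 : (Nat.ble k 9 || (Nat.ble k 25 && Nat.beq (k % 2) 0)) = false := by
          rw [← Bool.not_eq_true]
          simpa [Nat.beq_eq] using c1
        obtain ⟨pi, hpi, t1, t2, t3, t4, t5⟩ := kTest_spec k (by omega) (by omega)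
        by_cases c2 : k ≤ 25
        · have hbn : bnd k = 851 := by
            have : Nat.ble k 25 = true := by simpa using c2
            rw [bnd, h0, cond_false, this, cond_true]
          rcases hdich with hA | ⟨U, hU, _⟩
          · exact delTest_sound n k 850 pi (by omega) (by omega) hA hpi
              (t4 (by omega) (by omega) (by omega))
          · omega
        · have hbn : bnd k = 6 * k + 1 := by
            have : Nat.ble k 25 = false := by
              rw [← Bool.not_eq_true]; simpa using c2
            rw [bnd, h0, cond_false, this, cond_false]
          rcases hdich with hA | ⟨U, hev, hU4, hUk, hUn, hUB⟩
          · exact delTest_sound n k (6 * k) pi (by omega) (by omega) hA hpi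
              (t3 (by omega) (by omega))
          · exact uTest_sound n k U pi (by omega) hU4 hUn hpi
              (t5 (by omega) (by omega) hev U hUk) hUB
  · rcases Nat.lt_or_ge k 3000 with hk | hk
    · rcases Nat.le_total n (4 * k) with hn | hn
      · exact ladder n k d hC h60 hk h2 hn
      · obtain ⟨pi, hpi, t1, t2, t3, t4, t5⟩ := kTest_spec k (by omega) (by omega)
        rcases hdich with hA | ⟨U, hev, hU4, hUk, hUn, hUB⟩
        · exact delTest_sound n k (4 * k) pi (by omega) hn hA hpi (t1 h60)
        · rcases Nat.lt_or_ge k 130 with h130 | h130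
          · exact uTest_sound n k U pi (by omega) hU4 hUn hpi
              (t5 (by omega) (by omega) hev U hUk) hUB
          · have := t2 h130
            exact large_U n k U h130 hU4 hUk hUn (by omega) hUB
    · have hpi := pi_le_quarter k (by omega)
      rcases hdich with hA | ⟨U, hev, hU4, hUk, hUn, hUB⟩
      · rcases Nat.le_total n (3 * k) with hn | hn
        · exact large_i n k hk h2 hn hA
        · rcases Nat.le_total (n ^ 2) (k ^ 3) with h | h
          · exact large_ii n k hk hn h hA
          · exact large_iii n k hk h hpi hA
      · exact large_U n k U (by omega) hU4 hUk hUn hpi hUB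

theorem F_irreducible_of_range (n k : ℕ) (h8 : 8 ≤ 2 * k) (h2 : 2 * k ≤ n)
    (h3 : n < (k + 1) ^ 3)
    (hexc : (n, k) ∉ ({(8, 4), (10, 5), (12, 6), (16, 8)} : Set (ℕ × ℕ)))
    (a : ℕ → ℤ) (ha : ∀ j ≤ k, a j ≠ 0 ∧ ∀ p : ℕ, p.Prime → (p : ℤ) ∣ a j → p ≤ k) :
    Irreducible (F n k a) := by
  have he : exc k n = false := by
    rw [← Bool.not_eq_true]
    intro h
    apply hexc
    simp only [exc, Bool.and_eq_true, Bool.or_eq_true, Nat.beq_eq] at h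
    simp only [Set.mem_insert_iff, Set.mem_singleton_iff, Prod.mk.injEq]
    omega
  exact irreducible_of_constr n k a (by omega) (by omega) h3 ha
    (fun d hd h2d => no_constr n k d (by omega) h2 h3 he hd h2d)
end

section
/- Let k ≥ 6 and n > k^2 be integers. Then there exist two distinct indices r and s with 0 ≤ r < s ≤ k−1 and primes p > k and q > k such that ord_p(n+r) is odd and ord_q(n+s) is odd; that is, two distinct terms of the product n(n+1)⋯(n+k−1) are each divisible by some prime exceeding k exactly to an odd power. -/
namespace TwoTerms

lemma defect_bound (s : ℝ) (d u A B : ℕ) (hs : s ^ 2 = d) (hs0 : 0 ≤ s) (hAB : A * B = d * u ^ 2)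
    (hA : 30000 ≤ A) (hB : 30000 ≤ B) (h1 : A ≤ B + 23) (h2 : B ≤ A + 23) :
    0 ≤ ((A : ℝ) + B) - 2 * (s * u) ∧ ((A : ℝ) + B) - 2 * (s * u) ≤ 529 / 60000 := by
  have hAB' : (A : ℝ) * B = (s * u) ^ 2 := by
    rw [mul_pow, hs]; exact_mod_cast hAB
  have hA' : (30000 : ℝ) ≤ A := by exact_mod_cast hA
  have hB' : (30000 : ℝ) ≤ B := by exact_mod_cast hB
  have h1' : (A : ℝ) ≤ B + 23 := by exact_mod_cast h1
  have h2' : (B : ℝ) ≤ A + 23 := by exact_mod_cast h2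
  have hsu : 0 ≤ s * (u : ℝ) := by positivity
  set w := s * (u : ℝ) with hw
  have key : ((A : ℝ) + B - 2 * w) * (A + B + 2 * w) = (A - B) ^ 2 := by nlinarith
  have hsq : ((A : ℝ) - B) ^ 2 ≤ 529 := by nlinarith
  have h0 : 0 ≤ (A : ℝ) + B - 2 * w := by
    by_contra h
    push Not at h
    have : (A : ℝ) + B + 2 * w > 0 := by linarith
    nlinarith [sq_nonneg ((A : ℝ) - B)]
  refine ⟨h0, ?_⟩
  have : ((A : ℝ) + B - 2 * w) * 60000 ≤ ((A : ℝ) + B - 2 * w) * (A + B + 2 * w) :=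
    mul_le_mul_of_nonneg_left (by linarith) h0
  linarith

lemma pair_sum (d u v A B C D : ℕ) (hd : ¬ IsSquare d) (hAB : A * B = d * u ^ 2)
    (hCD : C * D = d * v ^ 2)
    (hA : 30000 ≤ A) (hB : 30000 ≤ B) (hC : 30000 ≤ C) (hD : 30000 ≤ D)
    (h1 : A ≤ B + 23) (h2 : B ≤ A + 23) (h3 : C ≤ D + 23) (h4 : D ≤ C + 23)
    (h5 : A ≤ C + 23) (h6 : C ≤ A + 23) (h7 : B ≤ D + 23) (h8 : D ≤ B + 23) :
    A + B = C + D := by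
  obtain ⟨p1, p2⟩ := defect_bound (Real.sqrt d) d u A B (Real.sq_sqrt (by positivity))
    (Real.sqrt_nonneg _) hAB hA hB h1 h2
  obtain ⟨q1, q2⟩ := defect_bound (Real.sqrt d) d v C D (Real.sq_sqrt (by positivity))
    (Real.sqrt_nonneg _) hCD hC hD h3 h4
  have hs : (Real.sqrt d) ^ 2 = (d : ℝ) := Real.sq_sqrt (by positivity)
  set s := Real.sqrt d
  set δ : ℤ := (A : ℤ) + B - (C + D) with hδ
  set e : ℤ := (u : ℤ) - v with he
  have hδ' : (δ : ℝ) = (A : ℝ) + B - (C + D) := by rw [hδ]; push_cast; ring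
  have he' : (e : ℝ) = (u : ℝ) - v := by rw [he]; push_cast; ring
  have a1 : |(δ : ℝ) - 2 * s * e| ≤ 529 / 60000 := by
    rw [hδ', he', abs_le]; constructor <;> nlinarith
  have a2 : |(δ : ℝ)| ≤ 46 := by
    have : |δ| ≤ 46 := by rw [abs_le]; constructor <;> omega
    exact_mod_cast this
  have a3 : |(δ : ℝ) + 2 * s * e| ≤ 93 := by
    rw [abs_le] at *; constructor <;> linarith [a1.1, a1.2, a2.1, a2.2]
  have a4 : |((δ ^ 2 - 4 * d * e ^ 2 : ℤ) : ℝ)| < 1 := by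
    have : ((δ ^ 2 - 4 * d * e ^ 2 : ℤ) : ℝ) = ((δ : ℝ) - 2 * s * e) * ((δ : ℝ) + 2 * s * e) := by
      push_cast; rw [← hs]; ring
    rw [this, abs_mul]
    calc _ ≤ (529 / 60000 : ℝ) * 93 := by gcongr
      _ < 1 := by norm_num
  have a5 : δ ^ 2 - 4 * d * e ^ 2 = 0 := by
    have : |δ ^ 2 - 4 * d * e ^ 2| < 1 := by exact_mod_cast a4
    exact Int.abs_lt_one_iff.mp this
  have he0 : e = 0 := by
    by_contra hne
    apply hd
    have hdvd : (2 * e) ^ 2 ∣ δ ^ 2 := ⟨d, by linarith⟩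
    rw [Int.pow_dvd_pow_iff (by norm_num)] at hdvd
    obtain ⟨q, hq⟩ := hdvd
    have : (d : ℤ) = q ^ 2 := by
      have h4 : (4 * e ^ 2) * (d : ℤ) = (4 * e ^ 2) * q ^ 2 := by rw [hq] at a5; linarith
      exact mul_left_cancel₀ (by positivity) h4
    refine ⟨q.natAbs, ?_⟩
    zify
    rw [this, abs_mul_abs_self]; ring
  have hδ0 : δ = 0 := by
    rw [he0] at a5
    have : δ ^ 2 = 0 := by linarith
    exact pow_eq_zero_iff (by norm_num) |>.mp this
  omega

def near (K A B : ℕ) : Bool := Nat.ble A (B + K) && Nat.ble B (A + K)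

def okq (A B C D : ℕ) : Bool :=
  Nat.ble (min (min A B) (min C D))
    ((max (max A B) (max C D) - min (min A B) (min C D) + 1) ^ 2) || (C == 300 && B == 288)

def chk (K c1 c2 c3 c4 : ℕ) : Bool :=
  (List.range 174).all fun x => (List.range 174).all fun y =>
    !(near K (c1 * (x * x)) (c2 * (y * y))) || (List.range 174).all fun z =>
      !(near K (c1 * (x * x)) (c3 * (z * z))) || (List.range 174).all fun w =>
        !(near K (c1 * (x * x)) (c4 * (w * w))) ||
          okq (c1 * (x * x)) (c2 * (y * y)) (c3 * (z * z)) (c4 * (w * w))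

lemma chk1 : chk 23 1 2 3 6 = true := by decide +kernel
lemma chk2 : chk 6 1 2 5 10 = true := by decide +kernel
lemma chk3 : chk 6 1 3 5 15 = true := by decide +kernel
lemma chk4 : chk 6 2 3 5 30 = true := by decide +kernel

/-- Four terms of a short window lying in the square classes `c1,c2,c3,c4`. -/
lemma quad (K c1 c2 c3 c4 d1 d2 d3 f1 f2 f3 g1 g2 g3 : ℕ) (hK : K ≤ 23) (hc : chk K c1 c2 c3 c4 = true)
    (hd1 : ¬ IsSquare d1) (hd2 : ¬ IsSquare d2) (hd3 : ¬ IsSquare d3)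
    (e1 : c1 * c2 = d1 * f1 ^ 2) (e1' : c3 * c4 = d1 * g1 ^ 2)
    (e2 : c1 * c3 = d2 * f2 ^ 2) (e2' : c2 * c4 = d2 * g2 ^ 2)
    (e3 : c1 * c4 = d3 * f3 ^ 2) (e3' : c2 * c3 = d3 * g3 ^ 2)
    (hc1 : 0 < c1) (hc2 : 0 < c2) (hc3 : 0 < c3) (hc4 : 0 < c4)
    (n k A B C D x y z w : ℕ) (hk : k ≤ K + 1) (hn : k ^ 2 < n)
    (hA : A = c1 * x ^ 2) (hB : B = c2 * y ^ 2) (hC : C = c3 * z ^ 2) (hD : D = c4 * w ^ 2)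
    (hAn : n ≤ A) (hBn : n ≤ B) (hCn : n ≤ C) (hDn : n ≤ D)
    (hAk : A < n + k) (hBk : B < n + k) (hCk : C < n + k) (hDk : D < n + k) :
    C = 300 ∧ B = 288 := by
  by_cases hbig : n < 30000
  · have bd : ∀ c t X : ℕ, 0 < c → X = c * t ^ 2 → X < n + k → t < 174 := by
      intro c t X hc0 hX hlt
      by_contra hge
      push Not at hge
      have : 174 ^ 2 ≤ t ^ 2 := Nat.pow_le_pow_left hge 2
      nlinarith
    have hx := bd c1 x A hc1 hA hAk
    have hy := bd c2 y B hc2 hB hBk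
    have hz := bd c3 z C hc3 hC hCk
    have hw := bd c4 w D hc4 hD hDk
    have nr : ∀ X Y : ℕ, n ≤ X → n ≤ Y → X < n + k → Y < n + k → near K X Y = true := by
      intro X Y h1 h2 h3 h4
      simp only [near, Bool.and_eq_true, Nat.ble_eq]
      omega
    have h := hc
    simp only [chk, List.all_eq_true, List.mem_range] at h
    have h1 := h x hx y hy
    rw [show c1 * (x * x) = A by rw [hA]; ring, show c2 * (y * y) = B by rw [hB]; ring,
      nr A B hAn hBn hAk hBk] at h1
    simp only [Bool.not_true, Bool.false_or, List.all_eq_true, List.mem_range] at h1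
    have h2 := h1 z hz
    rw [show c3 * (z * z) = C by rw [hC]; ring, nr A C hAn hCn hAk hCk] at h2
    simp only [Bool.not_true, Bool.false_or, List.all_eq_true, List.mem_range] at h2
    have h3 := h2 w hw
    rw [show c4 * (w * w) = D by rw [hD]; ring, nr A D hAn hDn hAk hDk] at h3
    simp only [Bool.not_true, Bool.false_or, okq, Bool.or_eq_true, Nat.ble_eq,
      Bool.and_eq_true, beq_iff_eq] at h3
    rcases h3 with h3 | h3
    · exfalso
      have hmin : n ≤ min (min A B) (min C D) := by omega
      have : max (max A B) (max C D) - min (min A B) (min C D) + 1 ≤ k := by omega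
      have := Nat.pow_le_pow_left this 2
      omega
    · exact h3
  · exfalso
    push Not at hbig
    have s1 := pair_sum d1 (f1 * x * y) (g1 * z * w) A B C D hd1
      (by rw [hA, hB]; linear_combination (x ^ 2 * y ^ 2) * e1)
      (by rw [hC, hD]; linear_combination (z ^ 2 * w ^ 2) * e1')
      (by omega) (by omega) (by omega) (by omega) (by omega) (by omega) (by omega) (by omega)
      (by omega) (by omega) (by omega) (by omega)
    have s2 := pair_sum d2 (f2 * x * z) (g2 * y * w) A C B D hd2
      (by rw [hA, hC]; linear_combination (x ^ 2 * z ^ 2) * e2)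
      (by rw [hB, hD]; linear_combination (y ^ 2 * w ^ 2) * e2')
      (by omega) (by omega) (by omega) (by omega) (by omega) (by omega) (by omega) (by omega)
      (by omega) (by omega) (by omega) (by omega)
    have hBC : B = C := by omega
    apply hd3
    have s4 := pair_sum d3 (f3 * x * w) (g3 * y * z) A D B C hd3
      (by rw [hA, hD]; linear_combination (x ^ 2 * w ^ 2) * e3)
      (by rw [hB, hC]; linear_combination (y ^ 2 * z ^ 2) * e3')
      (by omega) (by omega) (by omega) (by omega) (by omega) (by omega) (by omega) (by omega)
      (by omega) (by omega) (by omega) (by omega)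
    have hAB : A = B := by omega
    -- then `B * C = B ^ 2 = d3 * (..)^2`, so `d3` is a square
    have h5 : B ^ 2 = d3 * (g3 * y * z) ^ 2 := by
      have : B * C = d3 * (g3 * y * z) ^ 2 := by
        rw [hB, hC]; linear_combination (y ^ 2 * z ^ 2) * e3'
      rw [← this, ← hBC]; ring
    have hne : g3 * y * z ≠ 0 := by
      intro h0
      rw [h0] at h5
      have : B = 0 := by simpa using h5
      omega
    have hdvd : (g3 * y * z) ^ 2 ∣ B ^ 2 := ⟨d3, by rw [h5]; ring⟩
    rw [Nat.pow_dvd_pow_iff (by norm_num)] at hdvd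
    obtain ⟨q, hq⟩ := hdvd
    refine ⟨q, ?_⟩
    rw [hq] at h5
    have h4 : (g3 * y * z) ^ 2 * d3 = (g3 * y * z) ^ 2 * (q * q) := by linarith
    exact Nat.eq_of_mul_eq_mul_left (by positivity) h4

end TwoTerms

namespace TwoTerms

structure Setup (n k b : ℕ) (a x : ℕ → ℕ) : Prop where
  hn : k ^ 2 < n
  hb : b < k
  eq : ∀ i, i < k → n + i = a i * x i ^ 2
  sqf : ∀ i, i < k → Squarefree (a i)
  sm : ∀ i, i < k → i ≠ b → ∀ p : ℕ, p.Prime → p ∣ a i → p ≤ k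

lemma Setup.inj_aux {n k b : ℕ} {a x : ℕ → ℕ} (S : Setup n k b a x) {i j : ℕ} (hij : i < j)
    (hj : j < k) : a i ≠ a j := by
  intro h
  have h1 := S.eq i (by omega)
  have h2 := S.eq j hj
  rw [← h] at h2
  have hn := S.hn
  have hxx : x i < x j := by
    by_contra hc
    push Not at hc
    have : a i * x j ^ 2 ≤ a i * x i ^ 2 := by gcongr
    omega
  have h3 : a i * (x i + 1) ^ 2 ≤ a i * x j ^ 2 := by gcongr; omega
  have ha : 0 < a i := Nat.pos_of_ne_zero (by intro h0; rw [h0] at h1; omega)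
  have h4 : 2 * (a i * x i) < k := by nlinarith
  have h5 : (a i * x i) ^ 2 ≥ a i * x i ^ 2 := by nlinarith [sq_nonneg (x i)]
  have h6 : (2 * (a i * x i)) ^ 2 < k ^ 2 := Nat.pow_lt_pow_left h4 (by norm_num)
  nlinarith

lemma Setup.inj {n k b : ℕ} {a x : ℕ → ℕ} (S : Setup n k b a x) {i j : ℕ} (hi : i < k)
    (hj : j < k) (h : a i = a j) : i = j := by
  rcases lt_trichotomy i j with h' | h' | h'
  · exact absurd h (S.inj_aux h' hj)
  · exact h'
  · exact absurd h.symm (S.inj_aux h' hi)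

lemma card_mult (n k q : ℕ) (hq : 0 < q) :
    ((Finset.range k).filter (fun i => q ∣ n + i)).card ≤ (k + q - 1) / q := by
  have h := Nat.count_modEq_card k hq ((q - n % q) % q)
  have h2 : ((Finset.range k).filter (fun i => q ∣ n + i)).card
      = k.count (· ≡ ((q - n % q) % q) [MOD q]) := by
    rw [Nat.count_eq_card_filter_range]
    congr 1
    apply Finset.filter_congr
    intro i _
    have hlt := Nat.mod_lt n hq
    have : n + (q - n % q) ≡ 0 [MOD q] := by
      have h0 := Nat.div_add_mod n q
      rw [Nat.modEq_zero_iff_dvd]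
      exact ⟨n / q + 1, by rw [mul_add]; omega⟩
    rw [← Nat.modEq_zero_iff_dvd]
    constructor
    · intro h
      have h3 : n + i ≡ n + (q - n % q) [MOD q] := h.trans this.symm
      exact (Nat.ModEq.add_left_cancel' n h3).trans (Nat.mod_modEq _ _).symm
    · intro h
      exact (Nat.ModEq.add_left n (h.trans (Nat.mod_modEq _ _))).trans this
  rw [h2, h]
  have h3 := Nat.div_add_mod k q
  rw [Nat.le_div_iff_mul_le hq]
  split_ifs with hc
  · have : 0 < k % q := by omega
    have e : (k / q + 1) * q = q * (k / q) + q := by ring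
    rw [e]; omega
  · have e : (k / q + 0) * q = q * (k / q) := by ring
    rw [e]; omega

def T (k b : ℕ) (a : ℕ → ℕ) (N : ℕ) : Finset ℕ :=
  (Finset.range k).filter (fun i => i ≠ b ∧ a i ∣ N)

lemma sqf_dvd_primorial {P m : ℕ} (hm : Squarefree m) (h : ∀ p : ℕ, p.Prime → p ∣ m → p ≤ P) :
    m ∣ primorial P := by
  rw [← Nat.prod_primeFactors_of_squarefree hm, primorial]
  apply Finset.prod_dvd_prod_of_subset
  intro p hp
  have h1 := Nat.prime_of_mem_primeFactors hp
  have h2 := h p h1 (Nat.dvd_of_mem_primeFactors hp)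
  simp only [Finset.mem_filter, Finset.mem_range, Nat.primesLE, Nat.primesBelow]
  exact ⟨by omega, h1⟩

lemma Setup.dvd_term {n k b : ℕ} {a x : ℕ → ℕ} (S : Setup n k b a x) {i p : ℕ} (hi : i < k)
    (h : p ∣ a i) : p ∣ n + i := by
  rw [S.eq i hi]; exact Dvd.dvd.mul_right h _

lemma Setup.tcount {n k b : ℕ} {a x : ℕ → ℕ} (S : Setup n k b a x) (P : ℕ) (Q : Finset ℕ)
    (hQ0 : ∀ q ∈ Q, 0 < q) (hQ : ∀ p : ℕ, p.Prime → P < p → p ≤ k → p ∈ Q) :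
    k - 1 ≤ (T k b a (primorial P)).card + ∑ q ∈ Q, (k + q - 1) / q := by
  have hsub : (Finset.range k).erase b ⊆ T k b a (primorial P) ∪
      Q.biUnion (fun q => (Finset.range k).filter (fun i => q ∣ n + i)) := by
    intro i hi
    simp only [Finset.mem_erase, Finset.mem_range] at hi
    simp only [T, Finset.mem_union, Finset.mem_filter, Finset.mem_range, Finset.mem_biUnion]
    by_cases h : ∀ p : ℕ, p.Prime → p ∣ a i → p ≤ P
    · exact Or.inl ⟨hi.2, hi.1, sqf_dvd_primorial (S.sqf i hi.2) h⟩
    · push Not at h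
      obtain ⟨p, hp, hpa, hpP⟩ := h
      exact Or.inr ⟨p, hQ p hp hpP (S.sm i hi.2 hi.1 p hp hpa), hi.2, S.dvd_term hi.2 hpa⟩
  have h1 := Finset.card_le_card hsub
  rw [Finset.card_erase_of_mem (Finset.mem_range.mpr S.hb), Finset.card_range] at h1
  refine h1.trans ((Finset.card_union_le _ _).trans ?_)
  gcongr
  refine Finset.card_biUnion_le.trans (Finset.sum_le_sum ?_)
  intro q hq
  exact card_mult n k q (hQ0 q hq)

lemma Setup.T_le {n k b : ℕ} {a x : ℕ → ℕ} (S : Setup n k b a x) (N : ℕ) (hN : N ≠ 0) :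
    (T k b a N).card ≤ N.divisors.card := by
  apply Finset.card_le_card_of_injOn a
  · intro i hi
    simp only [T, Finset.coe_filter, Set.mem_ofPred_eq] at hi
    simp [hi.2.2, hN]
  · intro i hi j hj h
    simp only [T, Finset.coe_filter, Set.mem_ofPred_eq, Finset.mem_range] at hi hj
    exact S.inj hi.1 hj.1 h

lemma Setup.T_surj {n k b : ℕ} {a x : ℕ → ℕ} (S : Setup n k b a x) (N : ℕ) (hN : N ≠ 0)
    (h : N.divisors.card ≤ (T k b a N).card) (c : ℕ) (hc : c ∣ N) :
    ∃ i, i < k ∧ i ≠ b ∧ a i = c := by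
  have himg : (T k b a N).image a = N.divisors := by
    apply Finset.eq_of_subset_of_card_le
    · intro m hm
      simp only [Finset.mem_image, T, Finset.mem_filter] at hm
      obtain ⟨i, hi, rfl⟩ := hm
      simp [hi.2.2, hN]
    · rw [Finset.card_image_of_injOn]
      · exact h
      · intro i hi j hj h
        simp only [T, Finset.coe_filter, Set.mem_ofPred_eq, Finset.mem_range] at hi hj
        exact S.inj hi.1 hj.1 h
  have : c ∈ (T k b a N).image a := by rw [himg]; simp [hc, hN]
  simp only [Finset.mem_image, T, Finset.mem_filter, Finset.mem_range] at this
  obtain ⟨i, hi, rfl⟩ := this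
  exact ⟨i, hi.1, hi.2.1, rfl⟩

lemma Setup.quad_of {n k b : ℕ} {a x : ℕ → ℕ} (S : Setup n k b a x)
    (K c1 c2 c3 c4 d1 d2 d3 f1 f2 f3 g1 g2 g3 : ℕ) (hK : K ≤ 23) (hc : chk K c1 c2 c3 c4 = true)
    (hd1 : ¬ IsSquare d1) (hd2 : ¬ IsSquare d2) (hd3 : ¬ IsSquare d3)
    (e1 : c1 * c2 = d1 * f1 ^ 2) (e1' : c3 * c4 = d1 * g1 ^ 2)
    (e2 : c1 * c3 = d2 * f2 ^ 2) (e2' : c2 * c4 = d2 * g2 ^ 2)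
    (e3 : c1 * c4 = d3 * f3 ^ 2) (e3' : c2 * c3 = d3 * g3 ^ 2)
    (hc1 : 0 < c1) (hc2 : 0 < c2) (hc3 : 0 < c3) (hc4 : 0 < c4)
    (hk : k ≤ K + 1)
    (h1 : ∃ i, i < k ∧ i ≠ b ∧ a i = c1) (h2 : ∃ i, i < k ∧ i ≠ b ∧ a i = c2)
    (h3 : ∃ i, i < k ∧ i ≠ b ∧ a i = c3) (h4 : ∃ i, i < k ∧ i ≠ b ∧ a i = c4) : False := by
  obtain ⟨i1, hi1, -, ha1⟩ := h1
  obtain ⟨i2, hi2, -, ha2⟩ := h2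
  obtain ⟨i3, hi3, -, ha3⟩ := h3
  obtain ⟨i4, hi4, -, ha4⟩ := h4
  have hn := S.hn
  obtain ⟨r1, r2⟩ := quad K c1 c2 c3 c4 d1 d2 d3 f1 f2 f3 g1 g2 g3 hK hc hd1 hd2 hd3 e1 e1' e2 e2' e3 e3'
    hc1 hc2 hc3 hc4 n k (n + i1) (n + i2) (n + i3) (n + i4) (x i1) (x i2) (x i3) (x i4) hk hn
    (by rw [S.eq i1 hi1, ha1]) (by rw [S.eq i2 hi2, ha2]) (by rw [S.eq i3 hi3, ha3])
    (by rw [S.eq i4 hi4, ha4]) (by omega) (by omega) (by omega) (by omega) (by omega) (by omega)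
    (by omega) (by omega)
  have hk16 : k ≤ 16 := by
    by_contra hge
    push Not at hge
    have : 17 ^ 2 ≤ k ^ 2 := Nat.pow_le_pow_left hge 2
    omega
  have aux : ∀ m p : ℕ, p.Prime → 16 < p → p ∣ m → ¬ p ^ 2 ∣ m → n ≤ m → m < n + k → m = n + b := by
    intro m p hp hp16 hpm hpm2 hnm hmk
    have e := S.eq (m - n) (by omega)
    rw [show n + (m - n) = m by omega] at e
    by_contra hne
    have hpa : p ∣ a (m - n) := by
      rw [e] at hpm
      rcases (Nat.Prime.dvd_mul hp).mp hpm with h | h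
      · exact h
      · exfalso
        apply hpm2
        rw [e]
        exact Dvd.dvd.mul_left (pow_dvd_pow_of_dvd (hp.dvd_of_dvd_pow h) 2) _
    have := S.sm (m - n) (by omega) (by omega) p hp hpa
    omega
  have b1 := aux 290 29 (by norm_num) (by norm_num) (by norm_num) (by norm_num) (by omega) (by omega)
  have b2 := aux 293 293 (by norm_num) (by norm_num) (by norm_num) (by norm_num) (by omega) (by omega)
  omega

lemma not_sq {d : ℕ} (q : ℕ) (h1 : q * q < d) (h2 : d < (q + 1) * (q + 1)) : ¬ IsSquare d := by
  rintro ⟨r, rfl⟩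
  have := Nat.mul_self_lt_mul_self_iff.mp h1
  have := Nat.mul_self_lt_mul_self_iff.mp h2
  omega

lemma Setup.quad1236 {n k b : ℕ} {a x : ℕ → ℕ} (S : Setup n k b a x) (hk : k ≤ 24)
    (h1 : ∃ i, i < k ∧ i ≠ b ∧ a i = 1) (h2 : ∃ i, i < k ∧ i ≠ b ∧ a i = 2)
    (h3 : ∃ i, i < k ∧ i ≠ b ∧ a i = 3) (h4 : ∃ i, i < k ∧ i ≠ b ∧ a i = 6) : False :=
  S.quad_of 23 1 2 3 6 2 3 6 1 1 1 3 2 1 (by norm_num) chk1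
    (not_sq 1 (by norm_num) (by norm_num)) (not_sq 1 (by norm_num) (by norm_num))
    (not_sq 2 (by norm_num) (by norm_num)) (by norm_num) (by norm_num) (by norm_num)
    (by norm_num) (by norm_num) (by norm_num) (by norm_num) (by norm_num) (by norm_num)
    (by norm_num) (by omega) h1 h2 h3 h4

lemma Setup.quad12510 {n k b : ℕ} {a x : ℕ → ℕ} (S : Setup n k b a x) (hk : k ≤ 7)
    (h1 : ∃ i, i < k ∧ i ≠ b ∧ a i = 1) (h2 : ∃ i, i < k ∧ i ≠ b ∧ a i = 2)
    (h3 : ∃ i, i < k ∧ i ≠ b ∧ a i = 5) (h4 : ∃ i, i < k ∧ i ≠ b ∧ a i = 10) : False :=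
  S.quad_of 6 1 2 5 10 2 5 10 1 1 1 5 2 1 (by norm_num) chk2
    (not_sq 1 (by norm_num) (by norm_num)) (not_sq 2 (by norm_num) (by norm_num))
    (not_sq 3 (by norm_num) (by norm_num)) (by norm_num) (by norm_num) (by norm_num)
    (by norm_num) (by norm_num) (by norm_num) (by norm_num) (by norm_num) (by norm_num)
    (by norm_num) (by omega) h1 h2 h3 h4

lemma Setup.quad13515 {n k b : ℕ} {a x : ℕ → ℕ} (S : Setup n k b a x) (hk : k ≤ 7)
    (h1 : ∃ i, i < k ∧ i ≠ b ∧ a i = 1) (h2 : ∃ i, i < k ∧ i ≠ b ∧ a i = 3)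
    (h3 : ∃ i, i < k ∧ i ≠ b ∧ a i = 5) (h4 : ∃ i, i < k ∧ i ≠ b ∧ a i = 15) : False :=
  S.quad_of 6 1 3 5 15 3 5 15 1 1 1 5 3 1 (by norm_num) chk3
    (not_sq 1 (by norm_num) (by norm_num)) (not_sq 2 (by norm_num) (by norm_num))
    (not_sq 3 (by norm_num) (by norm_num)) (by norm_num) (by norm_num) (by norm_num)
    (by norm_num) (by norm_num) (by norm_num) (by norm_num) (by norm_num) (by norm_num)
    (by norm_num) (by omega) h1 h2 h3 h4

lemma Setup.quad23530 {n k b : ℕ} {a x : ℕ → ℕ} (S : Setup n k b a x) (hk : k ≤ 7)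
    (h1 : ∃ i, i < k ∧ i ≠ b ∧ a i = 2) (h2 : ∃ i, i < k ∧ i ≠ b ∧ a i = 3)
    (h3 : ∃ i, i < k ∧ i ≠ b ∧ a i = 5) (h4 : ∃ i, i < k ∧ i ≠ b ∧ a i = 30) : False :=
  S.quad_of 6 2 3 5 30 6 10 15 1 1 2 5 3 1 (by norm_num) chk4
    (not_sq 2 (by norm_num) (by norm_num)) (not_sq 3 (by norm_num) (by norm_num))
    (not_sq 3 (by norm_num) (by norm_num)) (by norm_num) (by norm_num) (by norm_num)
    (by norm_num) (by norm_num) (by norm_num) (by norm_num) (by norm_num) (by norm_num)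
    (by norm_num) (by omega) h1 h2 h3 h4

/-- the primes up to 800 -/
def plist : List ℕ := [2, 3, 5, 7, 11, 13, 17, 19, 23, 29, 31, 37, 41, 43, 47, 53, 59, 61, 67, 71, 73, 79, 83, 89,
  97, 101, 103, 107, 109, 113, 127, 131, 137, 139, 149, 151, 157, 163, 167, 173, 179, 181, 191,
  193, 197, 199, 211, 223, 227, 229, 233, 239, 241, 251, 257, 263, 269, 271, 277, 281, 283, 293,
  307, 311, 313, 317, 331, 337, 347, 349, 353, 359, 367, 373, 379, 383, 389, 397, 401, 409, 419,
  421, 431, 433, 439, 443, 449, 457, 461, 463, 467, 479, 487, 491, 499, 503, 509, 521, 523, 541,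
  547, 557, 563, 569, 571, 577, 587, 593, 599, 601, 607, 613, 617, 619, 631, 641, 643, 647, 653,
  659, 661, 673, 677, 683, 691, 701, 709, 719, 727, 733, 739, 743, 751, 757, 761, 769, 773, 787,
  797]

def cov (q : ℕ) : Bool := Nat.beq (Nat.gcd q 223092870) 1 ||
  [2, 3, 5, 7, 11, 13, 17, 19, 23].contains q

lemma cov_check : ((List.range 801).all fun q => !(cov q) || q == 1 || plist.contains q) = true := by
  decide +kernel

lemma mem_plist {p : ℕ} (hp : p.Prime) (h : p ≤ 800) : p ∈ plist := by
  have h1 := List.all_eq_true.mp cov_check p (List.mem_range.mpr (by omega))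
  have hcov : cov p = true := by
    unfold cov
    by_cases hc : Nat.Coprime p 223092870
    · have : Nat.gcd p 223092870 = 1 := hc
      rw [this]; rfl
    · have hd : p ∣ 223092870 := by
        by_contra h; exact hc ((Nat.Prime.coprime_iff_not_dvd hp).mpr h)
      have : p ∣ 2 * 3 * 5 * 7 * 11 * 13 * 17 * 19 * 23 := by norm_num; exact hd
      simp only [hp.dvd_mul] at this
      have e : ∀ r : ℕ, r.Prime → p ∣ r → p = r := fun r hr h => (Nat.prime_dvd_prime_iff_eq hp hr).mp h
      have : p = 2 ∨ p = 3 ∨ p = 5 ∨ p = 7 ∨ p = 11 ∨ p = 13 ∨ p = 17 ∨ p = 19 ∨ p = 23 := by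
        rcases this with (((((((h | h) | h) | h) | h) | h) | h) | h) | h
        · simp [e 2 (by norm_num) h]
        · simp [e 3 (by norm_num) h]
        · simp [e 5 (by norm_num) h]
        · simp [e 7 (by norm_num) h]
        · simp [e 11 (by norm_num) h]
        · simp [e 13 (by norm_num) h]
        · simp [e 17 (by norm_num) h]
        · simp [e 19 (by norm_num) h]
        · simp [e 23 (by norm_num) h]
      simp [this]
  have h2 : (p == 1) = false := by simp [hp.one_lt.ne']
  simp only [hcov, h2, Bool.not_true, Bool.false_or, List.contains_iff_mem] at h1
  exact h1

def lsum (P k : ℕ) (l : List ℕ) : ℕ :=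
  l.foldr (fun q s => bif Nat.blt P q && Nat.ble q k then s + (k + q - 1) / q else s) 0

lemma plist_nodup : plist.Nodup := by decide +kernel

lemma lsum_eq (P k : ℕ) (l : List ℕ) (hl : l.Nodup) :
    lsum P k l = ∑ q ∈ l.toFinset.filter (fun q => P < q ∧ q ≤ k), (k + q - 1) / q := by
  induction l with
  | nil => simp [lsum]
  | cons q l ih =>
    have hl' := List.nodup_cons.mp hl
    have ih' := ih hl'.2
    have e : lsum P k (q :: l) = bif Nat.blt P q && Nat.ble q k then lsum P k l + (k + q - 1) / q
      else lsum P k l := rfl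
    rw [e, ih', List.toFinset_cons, Finset.filter_insert]
    by_cases h : P < q ∧ q ≤ k
    · have hb : (Nat.blt P q && Nat.ble q k) = true := by
        simp only [Bool.and_eq_true, Nat.blt_eq, Nat.ble_eq]; exact h
      rw [hb, if_pos h, Finset.sum_insert]
      · simp [add_comm]
      · simp [hl'.1]
    · have hb : (Nat.blt P q && Nat.ble q k) = false := by
        rw [Bool.eq_false_iff]
        simp only [ne_eq, Bool.and_eq_true, Nat.blt_eq, Nat.ble_eq]; exact h
      rw [hb, if_neg h]; rfl

lemma Setup.count_large {n k b : ℕ} {a x : ℕ → ℕ} (S : Setup n k b a x) (hk : k ≤ 800)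
    (P M N : ℕ) (hN : primorial P = N) (hN0 : N ≠ 0) (hM : N.divisors.card = M)
    (h : M + lsum P k plist + (if k ≤ 24 then 0 else 1) ≤ k - 1) :
    k ≤ 24 ∧ ∀ c, c ∣ N → ∃ i, i < k ∧ i ≠ b ∧ a i = c := by
  rw [lsum_eq P k plist plist_nodup] at h
  have h1 := S.tcount P (plist.toFinset.filter (fun q => P < q ∧ q ≤ k))
    (by intro q hq; simp only [Finset.mem_filter] at hq; omega)
    (by
      intro p hp h1 h2
      simp only [Finset.mem_filter, List.mem_toFinset]
      exact ⟨mem_plist hp (by omega), h1, h2⟩)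
  rw [hN] at h1
  have h2 := S.T_le N hN0
  rw [hM] at h2
  split_ifs at h with h24
  · exact ⟨h24, fun c hc => S.T_surj N hN0 (by rw [hM]; omega) c hc⟩
  · omega

def Pof (k : ℕ) : ℕ := if k ≤ 20 then 3 else if k ≤ 56 then 5 else if k ≤ 176 then 7 else
  if k ≤ 416 then 11 else 13
def Mof (k : ℕ) : ℕ := if k ≤ 20 then 4 else if k ≤ 56 then 8 else if k ≤ 176 then 16 else
  if k ≤ 416 then 32 else 64

lemma big_check : ((List.range 792).all fun j =>
    Nat.ble (Mof (j + 9) + lsum (Pof (j + 9)) (j + 9) plist + (if j + 9 ≤ 24 then 0 else 1))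
      (j + 8)) = true := by
  decide +kernel

lemma prim_vals : primorial 3 = 6 ∧ primorial 5 = 30 ∧ primorial 7 = 210 ∧ primorial 11 = 2310 ∧
    primorial 13 = 30030 := by decide +kernel

lemma card_div_mul_prime (m p : ℕ) (hp : p.Prime) (h : Nat.Coprime m p) :
    (m * p).divisors.card = 2 * m.divisors.card := by
  rw [Nat.Coprime.card_divisors_mul h, Nat.Prime.divisors hp, mul_comm]
  rw [Finset.card_pair hp.one_lt.ne]

lemma card_vals : (Nat.divisors 6).card = 4 ∧ (Nat.divisors 30).card = 8 ∧
    (Nat.divisors 210).card = 16 ∧ (Nat.divisors 2310).card = 32 ∧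
    (Nat.divisors 30030).card = 64 := by
  have h1 : (Nat.divisors 6).card = 4 := by decide
  have h2 := card_div_mul_prime 6 5 (by norm_num) (by norm_num)
  have h3 := card_div_mul_prime 30 7 (by norm_num) (by norm_num)
  have h4 := card_div_mul_prime 210 11 (by norm_num) (by norm_num)
  have h5 := card_div_mul_prime 2310 13 (by norm_num) (by norm_num)
  norm_num only at h2 h3 h4 h5
  omega

lemma Setup.mid {n k b : ℕ} {a x : ℕ → ℕ} (S : Setup n k b a x) (hk : 9 ≤ k) (hk' : k ≤ 800) :
    False := by
  have h := List.all_eq_true.mp big_check (k - 9) (List.mem_range.mpr (by omega))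
  rw [Nat.ble_eq, show k - 9 + 9 = k by omega, show k - 9 + 8 = k - 1 by omega] at h
  obtain ⟨p1, p2, p3, p4, p5⟩ := prim_vals
  obtain ⟨c1, c2, c3, c4, c5⟩ := card_vals
  have fin : ∀ N, 6 ∣ N → (k ≤ 24 ∧ ∀ c, c ∣ N → ∃ i, i < k ∧ i ≠ b ∧ a i = c) → False := by
    rintro N hN ⟨h24, hc⟩
    exact S.quad1236 h24 (hc 1 (Dvd.dvd.trans (by norm_num) hN)) (hc 2 (Dvd.dvd.trans (by norm_num) hN))
      (hc 3 (Dvd.dvd.trans (by norm_num) hN)) (hc 6 hN)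
  unfold Pof Mof at h
  by_cases k1 : k ≤ 20
  · simp only [k1, if_true] at h
    exact fin 6 (by norm_num) (S.count_large hk' 3 4 6 p1 (by norm_num) c1 (by
      have : k ≤ 24 := by omega
      simp only [this, if_true] at h ⊢; exact h))
  by_cases k2 : k ≤ 56
  · simp only [k1, k2, if_true, if_false] at h
    exact fin 30 (by norm_num) (S.count_large hk' 5 8 30 p2 (by norm_num) c2 h)
  by_cases k3 : k ≤ 176
  · simp only [k1, k2, k3, if_true, if_false] at h
    exact fin 210 (by norm_num) (S.count_large hk' 7 16 210 p3 (by norm_num) c3 h)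
  by_cases k4 : k ≤ 416
  · simp only [k1, k2, k3, k4, if_true, if_false] at h
    exact fin 2310 (by norm_num) (S.count_large hk' 11 32 2310 p4 (by norm_num) c4 h)
  · simp only [k1, k2, k3, k4, if_false] at h
    exact fin 30030 (by norm_num) (S.count_large hk' 13 64 30030 p5 (by norm_num) c5 h)

end TwoTerms

namespace TwoTerms

def bit (m j : ℕ) : Bool := Nat.beq (Nat.land (Nat.shiftRight m j) 1) 1

/-- residue tables: for each squarefree c, masks of the values c * y ^ 2 modulo m -/
def tab6 : List (ℕ × List (ℕ × ℕ)) := [(1, [(16, 531), (9, 147), (5, 19)]),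
  (2, [(16, 261), (9, 293), (5, 13)]),
  (3, [(16, 6153), (9, 9), (5, 13)]),
  (5, [(16, 8241), (9, 293), (5, 1)]),
  (6, [(16, 321), (9, 65), (5, 19)]),
  (10, [(16, 1281), (9, 147), (5, 1)]),
  (15, [(16, 36993), (9, 65), (5, 1)]),
  (30, [(16, 16641), (9, 9), (5, 1)])]

def tab7 : List (ℕ × List (ℕ × ℕ)) := [(1, [(7, 23), (16, 531), (9, 147), (5, 19)]),
  (2, [(7, 23), (16, 261), (9, 293), (5, 13)]),
  (3, [(7, 105), (16, 6153), (9, 9), (5, 13)]),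
  (5, [(7, 105), (16, 8241), (9, 293), (5, 1)]),
  (6, [(7, 105), (16, 321), (9, 65), (5, 19)]),
  (7, [(7, 1), (16, 36993), (9, 147), (5, 13)]),
  (10, [(7, 105), (16, 1281), (9, 147), (5, 1)]),
  (14, [(7, 1), (16, 16641), (9, 293), (5, 19)]),
  (15, [(7, 23), (16, 36993), (9, 65), (5, 1)]),
  (21, [(7, 1), (16, 8241), (9, 9), (5, 19)]),
  (30, [(7, 23), (16, 16641), (9, 9), (5, 1)]),
  (35, [(7, 1), (16, 6153), (9, 293), (5, 1)]),
  (42, [(7, 1), (16, 1281), (9, 65), (5, 13)]),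
  (70, [(7, 1), (16, 321), (9, 147), (5, 1)]),
  (105, [(7, 1), (16, 531), (9, 65), (5, 1)]),
  (210, [(7, 1), (16, 261), (9, 9), (5, 1)])]

def test (t : List (ℕ × ℕ)) (v : ℕ) : Bool := t.all fun w => bit w.2 (v % w.1)

def fin4 (l : List ℕ) : Bool :=
  (l.contains 1 && l.contains 2 && l.contains 3 && l.contains 6) ||
  (l.contains 1 && l.contains 2 && l.contains 5 && l.contains 10) ||
  (l.contains 1 && l.contains 3 && l.contains 5 && l.contains 15) ||
  (l.contains 2 && l.contains 3 && l.contains 5 && l.contains 30)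

def dfs (L : List (ℕ × List (ℕ × ℕ))) (r : ℕ) : ℕ → Bool → List ℕ → Bool
  | 0, _, ch => fin4 ch
  | i + 1, s, ch => (s || dfs L r i true ch) &&
      L.all fun e => ch.contains e.1 || !(test e.2 (r + i)) || dfs L r i s (e.1 :: ch)

lemma dfs6 : ((List.range 720).all fun r => dfs tab6 r 6 false []) = true := by decide +kernel

lemma dfs7 : ((List.range 5040).all fun r => dfs tab7 r 7 false []) = true := by decide +kernel

def valid (M : ℕ) (L : List (ℕ × List (ℕ × ℕ))) : Bool :=
  L.all fun e => e.2.all fun w => M % w.1 == 0 && Nat.blt 0 w.1 &&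
    (List.range w.1).all fun y => bit w.2 (e.1 * y ^ 2 % w.1)

lemma valid6 : valid 720 tab6 = true := by decide +kernel
lemma valid7 : valid 5040 tab7 = true := by decide +kernel

lemma test_of {M : ℕ} {L : List (ℕ × List (ℕ × ℕ))} (hv : valid M L = true)
    {e : ℕ × List (ℕ × ℕ)} (he : e ∈ L) {n i x : ℕ} (h : n + i = e.1 * x ^ 2) :
    test e.2 (n % M + i) = true := by
  unfold test
  rw [List.all_eq_true]
  intro w hw
  have h1 := List.all_eq_true.mp (List.all_eq_true.mp hv e he) w hw
  simp only [Bool.and_eq_true, beq_iff_eq, Nat.blt_eq, List.all_eq_true, List.mem_range] at h1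
  obtain ⟨⟨h2, h3⟩, h4⟩ := h1
  have h5 := h4 (x % w.1) (Nat.mod_lt _ h3)
  have h6 : e.1 * (x % w.1) ^ 2 ≡ n % M + i [MOD w.1] := by
    have : e.1 * (x % w.1) ^ 2 ≡ n + i [MOD w.1] := by
      rw [h]
      exact Nat.ModEq.mul_left _ ((Nat.mod_modEq _ _).pow 2)
    refine this.trans (Nat.ModEq.add_right i ?_)
    exact ((Nat.mod_modEq n M).of_dvd (Nat.dvd_of_mod_eq_zero h2)).symm
  rw [← h6]; exact h5

lemma dfs_sound {n k b : ℕ} {a x : ℕ → ℕ} (S : Setup n k b a x) {M : ℕ}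
    {L : List (ℕ × List (ℕ × ℕ))} (hv : valid M L = true)
    (hL : ∀ i, i < k → i ≠ b → ∃ e ∈ L, e.1 = a i) :
    ∀ (i : ℕ) (s : Bool) (ch : List ℕ), i ≤ k → (s = true → i ≤ b) →
      (∀ c ∈ ch, ∃ j, i ≤ j ∧ j < k ∧ j ≠ b ∧ a j = c) → dfs L (n % M) i s ch = true →
      ∃ ch' : List ℕ, (∀ c ∈ ch', ∃ j, j < k ∧ j ≠ b ∧ a j = c) ∧ fin4 ch' = true := by
  intro i
  induction i with
  | zero =>
    intro s ch _ _ hch h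
    refine ⟨ch, fun c hc => ?_, h⟩
    obtain ⟨j, -, hj⟩ := hch c hc
    exact ⟨j, hj⟩
  | succ i ih =>
    intro s ch hik hs hch h
    simp only [dfs, Bool.and_eq_true, List.all_eq_true] at h
    have hch' : ∀ c ∈ ch, ∃ j, i ≤ j ∧ j < k ∧ j ≠ b ∧ a j = c := by
      intro c hc
      obtain ⟨j, h1, h2⟩ := hch c hc
      exact ⟨j, by omega, h2⟩
    by_cases hib : i = b
    · have hs' : s = false := by
        cases s with
        | false => rfl
        | true => have := hs rfl; omega
      rw [hs', Bool.false_or] at h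
      exact ih true ch (by omega) (by intro _; omega) hch' h.1
    · obtain ⟨e, he, hea⟩ := hL i (by omega) hib
      have h1 := h.2 e he
      have h2 : test e.2 (n % M + i) = true :=
        test_of hv he (x := x i) (by rw [hea]; exact S.eq i (by omega))
      have h3 : ch.contains e.1 = false := by
        rw [Bool.eq_false_iff]
        intro hc
        rw [List.contains_iff_mem] at hc
        obtain ⟨j, hj1, hj2, hj3, hj4⟩ := hch _ hc
        have := S.inj hj2 (by omega : i < k) (by rw [hj4, hea])
        omega
      rw [h2, h3] at h1
      simp only [Bool.not_true, Bool.false_or] at h1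
      refine ih s _ (by omega) (fun h => by have := hs h; omega) ?_ h1
      intro c hc
      rcases List.mem_cons.mp hc with rfl | hc
      · exact ⟨i, le_refl _, by omega, hib, hea.symm⟩
      · exact hch' c hc

lemma Setup.fin {n k b : ℕ} {a x : ℕ → ℕ} (S : Setup n k b a x) (hk : k ≤ 7)
    (h : ∃ ch' : List ℕ, (∀ c ∈ ch', ∃ j, j < k ∧ j ≠ b ∧ a j = c) ∧ fin4 ch' = true) : False := by
  obtain ⟨l, hl, h⟩ := h
  simp only [fin4, Bool.or_eq_true, Bool.and_eq_true, List.contains_iff_mem] at h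
  rcases h with ((h | h) | h) | h
  · exact S.quad1236 (by omega) (hl _ h.1.1.1) (hl _ h.1.1.2) (hl _ h.1.2) (hl _ h.2)
  · exact S.quad12510 hk (hl _ h.1.1.1) (hl _ h.1.1.2) (hl _ h.1.2) (hl _ h.2)
  · exact S.quad13515 hk (hl _ h.1.1.1) (hl _ h.1.1.2) (hl _ h.1.2) (hl _ h.2)
  · exact S.quad23530 hk (hl _ h.1.1.1) (hl _ h.1.1.2) (hl _ h.1.2) (hl _ h.2)

lemma tab6_mem : ∀ c ∈ Nat.divisors 30, ∃ e ∈ tab6, e.1 = c := by decide +kernel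
lemma tab7_mem : ∀ c ∈ Nat.divisors 210, ∃ e ∈ tab7, e.1 = c := by decide +kernel

lemma prime_le5 {p : ℕ} (hp : p.Prime) (h : p ≤ 6) : p ≤ 5 := by
  rcases Nat.lt_or_ge p 6 with h' | h'
  · omega
  · have : p = 6 := by omega
    subst this; norm_num at hp

lemma prime_le7 {p : ℕ} (hp : p.Prime) (h : p ≤ 8) : p ≤ 7 := by
  rcases Nat.lt_or_ge p 8 with h' | h'
  · omega
  · have : p = 8 := by omega
    subst this; norm_num at hp

lemma Setup.k6 {n b : ℕ} {a x : ℕ → ℕ} (S : Setup n 6 b a x) : False := by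
  apply S.fin (by norm_num)
  refine dfs_sound S valid6 ?_ 6 false [] (le_refl _) (by simp) (by simp)
    (List.all_eq_true.mp dfs6 _ (List.mem_range.mpr (Nat.mod_lt _ (by norm_num))))
  intro i hi hib
  apply tab6_mem
  rw [Nat.mem_divisors, ← prim_vals.2.1]
  exact ⟨sqf_dvd_primorial (S.sqf i hi) (fun p hp h => prime_le5 hp (S.sm i hi hib p hp h)),
    (primorial_pos _).ne'⟩

lemma Setup.k7 {n b : ℕ} {a x : ℕ → ℕ} (S : Setup n 7 b a x) : False := by
  apply S.fin (by norm_num)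
  refine dfs_sound S valid7 ?_ 7 false [] (le_refl _) (by simp) (by simp)
    (List.all_eq_true.mp dfs7 _ (List.mem_range.mpr (Nat.mod_lt _ (by norm_num))))
  intro i hi hib
  apply tab7_mem
  rw [Nat.mem_divisors, ← prim_vals.2.2.1]
  exact ⟨sqf_dvd_primorial (S.sqf i hi) (fun p hp h => S.sm i hi hib p hp h),
    (primorial_pos _).ne'⟩

lemma Setup.k8 {n b : ℕ} {a x : ℕ → ℕ} (S : Setup n 8 b a x) : False := by
  have hn := S.hn
  have S' : Setup n 7 (if b = 7 then 0 else b) a x :=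
    { hn := by omega
      hb := by have := S.hb; split_ifs <;> omega
      eq := fun i hi => S.eq i (by omega)
      sqf := fun i hi => S.sqf i (by omega)
      sm := fun i hi hib p hp h => prime_le7 hp (S.sm i (by omega)
        (by intro hb; split_ifs at hib <;> omega) p hp h) }
  exact S'.k7

end TwoTerms

namespace TwoTerms

lemma dvd_choose_of {p m l : ℕ} (hp : p.Prime) (h : p ≤ l % p + m % p) : p ∣ (m + l).choose l := by
  have := Fact.mk hp
  apply dvd_of_one_le_padicValNat
  have hlt : p ≤ m + l := h.trans (by have := Nat.mod_le l p; have := Nat.mod_le m p; omega)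
  rw [padicValNat_choose' (p := p) (b := Nat.log p (m + l) + 1) (by omega)]
  apply Finset.card_pos.mpr
  refine ⟨1, ?_⟩
  rw [Finset.mem_filter, Finset.mem_Ico]
  refine ⟨⟨le_refl _, ?_⟩, by simpa using h⟩
  have := Nat.log_pos hp.one_lt hlt
  omega

lemma prime_dvd_multi {p n : ℕ} (hp : p.Prime) (h1 : n < p) (h2 : p ≤ 6 * n) :
    p ∣ (6 * n).choose (3 * n) * (3 * n).choose n := by
  have e1 : 6 * n = 3 * n + 3 * n := by ring
  have e2 : 3 * n = 2 * n + n := by ring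
  have A : p ≤ 3 * n % p + 3 * n % p → p ∣ (6 * n).choose (3 * n) * (3 * n).choose n := by
    intro h
    have := dvd_choose_of hp h
    rw [← e1] at this
    exact Dvd.dvd.mul_right this _
  have B : p ≤ n % p + 2 * n % p → p ∣ (6 * n).choose (3 * n) * (3 * n).choose n := by
    intro h
    have := dvd_choose_of hp h
    rw [← e2] at this
    exact Dvd.dvd.mul_left this _
  have hnp : n % p = n := Nat.mod_eq_of_lt h1
  rcases Nat.lt_or_ge (3 * n) p with h3 | h3
  · apply A; rw [Nat.mod_eq_of_lt h3]; omega
  rcases Nat.lt_or_ge (2 * n) p with h4 | h4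
  · apply B; rw [hnp, Nat.mod_eq_of_lt h4]; omega
  rcases Nat.lt_or_ge (3 * n) (2 * p) with h5 | h5
  · apply A
    have : 3 * n % p = 3 * n - p := by
      rw [Nat.mod_eq_sub_mod h3, Nat.mod_eq_of_lt (by omega)]
    omega
  · apply B
    have : 2 * n % p = 2 * n - p := by
      rw [Nat.mod_eq_sub_mod h4, Nat.mod_eq_of_lt (by omega)]
    omega

lemma choose_three (n : ℕ) : 4 ^ n * (3 * n).choose n ≤ 27 ^ n := by
  have h := add_pow 1 2 (3 * n)
  have h2 : (1 : ℕ) ^ n * 2 ^ (3 * n - n) * (3 * n).choose n ≤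
      ∑ m ∈ Finset.range (3 * n + 1), 1 ^ m * 2 ^ (3 * n - m) * (3 * n).choose m :=
    Finset.single_le_sum (f := fun m => (1 : ℕ) ^ m * 2 ^ (3 * n - m) * (3 * n).choose m)
      (fun _ _ => Nat.zero_le _) (Finset.mem_range.mpr (by omega))
  simp only [Nat.cast_id] at h
  rw [← h, show 3 * n - n = 2 * n by omega, one_pow, one_mul, pow_mul, pow_mul] at h2
  norm_num at h2
  exact h2

lemma primorial_six (n r : ℕ) (hn : 0 < n) (hr : r ≤ 5) :
    primorial (6 * n + r) ≤ 1728 ^ n * ((6 * n + 1) * (6 * n + 5)) := by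
  have h1 : primorial (6 * n) ≤ 1728 ^ n := by
    have e : primorial (6 * n) = primorial (n + 5 * n) := by congr 1; ring
    rw [e, primorial_add]
    have h2 : ∏ p ∈ Finset.Ico (n + 1) (n + 5 * n + 1) with p.Prime, p ∣
        (6 * n).choose (3 * n) * (3 * n).choose n := by
      apply Finset.prod_primes_dvd
      · intro p hp; exact (Finset.mem_filter.1 hp).2.prime
      · intro p hp
        rw [Finset.mem_filter, Finset.mem_Ico] at hp
        exact prime_dvd_multi hp.2 (by omega) (by omega)
    have h3 := Nat.le_of_dvd (Nat.mul_pos (Nat.choose_pos (by omega)) (Nat.choose_pos (by omega))) h2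
    have h4 : primorial n ≤ 4 ^ n := (primorial_lt_four_pow n hn.ne').le
    have h5 : (6 * n).choose (3 * n) ≤ 64 ^ n := by
      refine (Nat.choose_le_two_pow _ _).trans ?_
      rw [pow_mul]; norm_num
    have h6 := choose_three n
    calc _ ≤ 4 ^ n * ((6 * n).choose (3 * n) * (3 * n).choose n) := by gcongr
      _ = (6 * n).choose (3 * n) * (4 ^ n * (3 * n).choose n) := by ring
      _ ≤ 64 ^ n * 27 ^ n := by gcongr
      _ = 1728 ^ n := by rw [← mul_pow]; norm_num
  rw [primorial_add]
  gcongr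
  have hs : (Finset.Ico (6 * n + 1) (6 * n + r + 1)).filter Nat.Prime ⊆ {6 * n + 1, 6 * n + 5} := by
    intro p hp
    rw [Finset.mem_filter, Finset.mem_Ico] at hp
    simp only [Finset.mem_insert, Finset.mem_singleton]
    by_contra hc
    have : 2 ∣ p ∨ 3 ∣ p := by omega
    rcases this with h | h
    · have := (Nat.prime_dvd_prime_iff_eq Nat.prime_two hp.2).mp h; omega
    · have := (Nat.prime_dvd_prime_iff_eq Nat.prime_three hp.2).mp h; omega
  refine (Finset.prod_le_prod_of_subset_of_one_le' hs ?_).trans ?_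
  · intro i hi _
    simp only [Finset.mem_insert, Finset.mem_singleton] at hi
    omega
  · rw [Finset.prod_pair (by omega)]

/-! ### squarefree products -/

lemma count_sf (y : ℕ) :
    3 * Nat.count (fun m => ¬ 4 ∣ m ∧ ¬ 9 ∣ m) (y + 1) ≤ 2 * y + 4 := by
  induction y using Nat.strong_induction_on with
  | _ y ih =>
    rcases Nat.lt_or_ge y 36 with h | h
    · interval_cases y <;> decide +kernel
    · have h1 := ih (y - 36) (by omega)
      have e : y + 1 = 36 + (y - 36 + 1) := by omega
      rw [e, Nat.count_add]
      have h36 : Nat.count (fun m => ¬ 4 ∣ m ∧ ¬ 9 ∣ m) 36 = 24 := by decide +kernel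
      have hp : (fun m => ¬ 4 ∣ 36 + m ∧ ¬ 9 ∣ 36 + m) = (fun m => ¬ 4 ∣ m ∧ ¬ 9 ∣ m) := by
        funext m
        rw [Nat.dvd_add_right (by norm_num : 4 ∣ 36), Nat.dvd_add_right (by norm_num : 9 ∣ 36)]
      simp only [hp]
      rw [h36]
      omega

lemma sqf_card {s : Finset ℕ} (hs : ∀ m ∈ s, Squarefree m) {y : ℕ} (hy : ∀ m ∈ s, m ≤ y) :
    3 * s.card ≤ 2 * y + 4 := by
  refine le_trans ?_ (count_sf y)
  rw [Nat.count_eq_card_filter_range]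
  gcongr
  intro m hm
  rw [Finset.mem_filter, Finset.mem_range]
  refine ⟨by have := hy m hm; omega, ?_, ?_⟩
  · intro h
    have := hs m hm 2 (by simpa using h)
    simp at this
  · intro h
    have := hs m hm 3 (by simpa using h)
    simp at this

lemma sqf_prod : ∀ (N : ℕ) (s : Finset ℕ), (∀ m ∈ s, Squarefree m) → s.card = N + 2 →
    (3 / 2 : ℝ) ^ N * (N.factorial : ℝ) ≤ ∏ m ∈ s, (m : ℝ) := by
  intro N
  induction N with
  | zero =>
    intro s hs _
    simp only [pow_zero, Nat.factorial_zero, Nat.cast_one, mul_one]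
    rw [← Nat.cast_prod, Nat.one_le_cast]
    exact Finset.prod_pos (fun m hm => Nat.pos_of_ne_zero (hs m hm).ne_zero)
  | succ N ih =>
    intro s hs hc
    have hne : s.Nonempty := Finset.card_pos.mp (by omega)
    have h1 := sqf_card hs (y := s.max' hne) (fun m hm => s.le_max' m hm)
    have hmem := s.max'_mem hne
    have h2 := ih (s.erase (s.max' hne)) (fun m hm => hs m (Finset.mem_of_mem_erase hm))
      (by rw [Finset.card_erase_of_mem hmem]; omega)
    rw [← Finset.mul_prod_erase s _ hmem]
    have h3 : (3 / 2 : ℝ) * ((N + 1 : ℕ) : ℝ) ≤ ((s.max' hne : ℕ) : ℝ) := by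
      rw [hc] at h1
      have : ((3 * (N + 1 + 2) : ℕ) : ℝ) ≤ ((2 * s.max' hne + 4 : ℕ) : ℝ) := by exact_mod_cast h1
      push_cast at this ⊢
      linarith
    calc (3 / 2 : ℝ) ^ (N + 1) * ((N + 1).factorial : ℝ)
        = ((3 / 2 : ℝ) * ((N + 1 : ℕ) : ℝ)) * ((3 / 2 : ℝ) ^ N * (N.factorial : ℝ)) := by
          rw [Nat.factorial_succ]; push_cast; ring
      _ ≤ _ := by gcongr

/-! ### counting odd valuations -/

def oc (p lo hi : ℕ) : ℕ := ((Finset.Ico lo hi).filter (fun m => Odd (padicValNat p m))).card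

lemma ceil_iff {p : ℕ} (hp : 0 < p) (lo m : ℕ) : (lo + p - 1) / p ≤ m ↔ lo ≤ p * m := by
  rw [← Nat.lt_succ_iff, Nat.div_lt_iff_lt_mul hp, Nat.succ_mul, mul_comm m p]
  omega

lemma oc_step {p lo hi : ℕ} (hp : p.Prime) (hlo : 1 ≤ lo) :
    oc p lo hi + oc p ((lo + p - 1) / p) ((hi + p - 1) / p) =
      (hi + p - 1) / p - (lo + p - 1) / p := by
  have := Fact.mk hp
  have h1 : oc p lo hi = ((Finset.Ico ((lo + p - 1) / p) ((hi + p - 1) / p)).filter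
      (fun m => ¬ Odd (padicValNat p m))).card := by
    unfold oc
    rw [← Finset.card_image_of_injective
      ((Finset.Ico ((lo + p - 1) / p) ((hi + p - 1) / p)).filter
      (fun m => ¬ Odd (padicValNat p m))) (mul_right_injective₀ hp.ne_zero)]
    congr 1
    have key : ∀ m, 1 ≤ m → (Odd (padicValNat p (p * m)) ↔ ¬ Odd (padicValNat p m)) := by
      intro m hm
      rw [padicValNat.mul hp.ne_zero (by omega), padicValNat_self, add_comm]
      exact Nat.odd_add_one
    ext m
    simp only [Finset.mem_filter, Finset.mem_Ico, Finset.mem_image, ceil_iff hp.pos]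
    constructor
    · rintro ⟨⟨h1, h2⟩, h3⟩
      have hd : p ∣ m := by
        apply dvd_of_one_le_padicValNat
        exact h3.pos
      obtain ⟨c, rfl⟩ := hd
      have hc : 1 ≤ c := by
        rcases Nat.eq_zero_or_pos c with h | h
        · subst h; omega
        · exact h
      refine ⟨c, ⟨⟨h1, ?_⟩, (key c hc).mp h3⟩, rfl⟩
      by_contra hcc
      rw [not_lt, ceil_iff hp.pos] at hcc
      omega
    · rintro ⟨c, ⟨⟨h1, h2⟩, h3⟩, rfl⟩
      have hc : 1 ≤ c := by
        rcases Nat.eq_zero_or_pos c with h | h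
        · subst h; omega
        · exact h
      refine ⟨⟨h1, ?_⟩, (key c hc).mpr h3⟩
      by_contra hcc
      rw [not_lt, ← ceil_iff hp.pos] at hcc
      omega
  rw [h1, add_comm]
  unfold oc
  rw [Finset.card_filter_add_card_filter_not, Nat.card_Ico]

lemma oc_bound {p : ℕ} (hp : p.Prime) : ∀ (t lo hi : ℕ), 1 ≤ lo → lo ≤ hi → hi - lo ≤ p ^ t →
    (p + 1) * oc p lo hi ≤ (hi - lo) + (p - 1) * t + p ∧
    (hi - lo) ≤ (p + 1) * oc p lo hi + (p - 1) * t + p := by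
  intro t
  induction t with
  | zero =>
    intro lo hi h1 h2 h3
    have h4 : oc p lo hi ≤ hi - lo := by
      unfold oc
      exact (Finset.card_filter_le _ _).trans (by rw [Nat.card_Ico])
    have hp1 := hp.one_lt
    rw [pow_zero] at h3
    constructor
    · have : p * oc p lo hi ≤ p * 1 := by gcongr; omega
      rw [add_mul]; omega
    · omega
  | succ t ih =>
    intro lo hi h1 h2 h3
    have hp1 := hp.one_lt
    have hs := oc_step (hi := hi) hp h1
    set lo' := (lo + p - 1) / p with hlo
    set hi' := (hi + p - 1) / p with hhi
    have a1 : p * lo' ≤ lo + p - 1 := Nat.mul_div_le _ _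
    have a2 : p * hi' ≤ hi + p - 1 := Nat.mul_div_le _ _
    have a3 : lo ≤ p * lo' := (ceil_iff hp.pos lo lo').mp (le_refl _)
    have a4 : hi ≤ p * hi' := (ceil_iff hp.pos hi hi').mp (le_refl _)
    have b1 : 1 ≤ lo' := by
      by_contra h
      have : lo' = 0 := Nat.eq_zero_of_not_pos h
      rw [this, mul_zero] at a3; omega
    have b2 : lo' ≤ hi' := (ceil_iff hp.pos lo hi').mpr (by omega)
    have b3 : hi' - lo' ≤ p ^ t := by
      have : hi' ≤ lo' + p ^ t := 
        (ceil_iff hp.pos hi (lo' + p ^ t)).mpr (by rw [mul_add, ← pow_succ']; omega)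
      omega
    obtain ⟨i1, i2⟩ := ih lo' hi' b1 b2 b3
    obtain ⟨d, hd⟩ : ∃ d, hi' = lo' + d := ⟨hi' - lo', by omega⟩
    rw [hd] at hs i1 i2 a2 a4
    rw [Nat.add_sub_cancel_left] at hs i1 i2
    rw [← hd] at hs i1 i2
    obtain ⟨D, hD⟩ : ∃ D, hi = lo + D := ⟨hi - lo, by omega⟩
    rw [hD, Nat.add_sub_cancel_left]
    rw [hD] at hs a2 a4
    obtain ⟨q, hq⟩ : ∃ q, p = q + 1 := ⟨p - 1, by omega⟩
    have e1 : (p + 1) * oc p lo (lo + D) + (p + 1) * oc p lo' hi' = (p + 1) * d := by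
      rw [← hs]; ring
    have e2 : p * (lo' + d) = p * lo' + p * d := by ring
    have e3 : (p + 1) * d = p * d + d := by ring
    have e4 : (p - 1) * (t + 1) = (p - 1) * t + (p - 1) := by ring
    rw [e4]
    rw [e2] at a2 a4
    constructor <;> omega

/-! ### factorial valuations -/

lemma list_sum_le (l : List ℕ) (c : ℕ) (h : ∀ d ∈ l, d ≤ c) : l.sum ≤ l.length * c := by
  have := List.sum_le_card_nsmul l c h
  simpa using this

lemma fact_val {p : ℕ} (hp : p.Prime) {m : ℕ} (hm : m ≠ 0) :
    m ≤ (p - 1) * padicValNat p m.factorial + (p - 1) * (Nat.log p m + 1) := by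
  have := Fact.mk hp
  rw [sub_one_mul_padicValNat_factorial]
  have h1 := list_sum_le (p.digits m) (p - 1) (fun d hd => by
    have := Nat.digits_lt_base hp.one_lt hd; omega)
  rw [Nat.length_digits p m hp.one_lt hm, mul_comm] at h1
  omega

lemma div_le_fact_val {p : ℕ} (hp : p.Prime) (m : ℕ) : m / p ≤ padicValNat p m.factorial := by
  have := Fact.mk hp
  rcases Nat.lt_or_ge m p with h | h
  · rw [Nat.div_eq_of_lt h]; omega
  rw [padicValNat_factorial (p := p) (b := Nat.log p m + 1) (by omega)]
  have := Finset.single_le_sum (f := fun i => m / p ^ i) (s := Finset.Ico 1 (Nat.log p m + 1))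
    (fun _ _ => Nat.zero_le _) (a := 1)
    (Finset.mem_Ico.mpr ⟨le_refl _, by have := Nat.log_pos hp.one_lt h; omega⟩)
  simpa using this

end TwoTerms

namespace TwoTerms

/-- number of usable indices whose squarefree part is divisible by p -/
def cc (k b : ℕ) (a : ℕ → ℕ) (p : ℕ) : ℕ := (((Finset.range k).erase b).filter (fun i => p ∣ a i)).card

lemma Setup.log_sum {n k b : ℕ} {a x : ℕ → ℕ} (S : Setup n k b a x) :
    ∑ i ∈ (Finset.range k).erase b, Real.log (a i) =
      ∑ p ∈ Nat.primesLE k, (cc k b a p : ℝ) * Real.log p := by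
  have h1 : ∀ i ∈ (Finset.range k).erase b, Real.log (a i) =
      ∑ p ∈ Nat.primesLE k, if p ∣ a i then Real.log p else 0 := by
    intro i hi
    rw [Finset.mem_erase, Finset.mem_range] at hi
    have hs := S.sqf i hi.2
    conv_lhs => rw [← Nat.prod_primeFactors_of_squarefree hs]
    rw [Nat.cast_prod, Real.log_prod, ← Finset.sum_filter]
    · apply Finset.sum_congr _ (fun _ _ => rfl)
      ext p
      rw [Nat.mem_primeFactors, Finset.mem_filter, Nat.mem_primesLE]
      constructor
      · rintro ⟨h1, h2, h3⟩
        exact ⟨⟨S.sm i hi.2 hi.1 p h1 h2, h1⟩, h2⟩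
      · rintro ⟨⟨h1, h2⟩, h3⟩
        exact ⟨h2, h3, hs.ne_zero⟩
    · intro p hp
      have := (Nat.prime_of_mem_primeFactors hp).pos
      positivity
  rw [Finset.sum_congr rfl h1, Finset.sum_comm]
  apply Finset.sum_congr rfl
  intro p _
  rw [← Finset.sum_filter, Finset.sum_const, nsmul_eq_mul]
  rfl

lemma log_fact {m k : ℕ} (h : m ≤ k) : Real.log (m.factorial : ℝ) =
    ∑ p ∈ Nat.primesLE k, (padicValNat p m.factorial : ℝ) * Real.log p := by
  have h1 : m.factorial = ∏ p ∈ Nat.primesLE k, p ^ m.factorial.factorization p := by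
    conv_lhs => rw [← Nat.prod_factorization_pow_eq_self (Nat.factorial_ne_zero m)]
    apply Finsupp.prod_of_support_subset
    · intro p hp
      rw [Nat.support_factorization, Nat.mem_primeFactors] at hp
      rw [Nat.mem_primesLE]
      exact ⟨((Nat.Prime.dvd_factorial hp.1).mp hp.2.1).trans h, hp.1⟩
    · intros; simp
  conv_lhs => rw [h1]
  rw [Nat.cast_prod, Real.log_prod]
  · apply Finset.sum_congr rfl
    intro p hp
    rw [Nat.mem_primesLE] at hp
    rw [Nat.cast_pow, Real.log_pow, Nat.factorization_def _ hp.2]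
  · intro p hp
    rw [Nat.mem_primesLE] at hp
    have := hp.2.pos
    positivity

lemma log_primorial (k : ℕ) : Real.log (primorial k : ℝ) = ∑ p ∈ Nat.primesLE k, Real.log p := by
  rw [primorial_eq_prod_primesLE, Nat.cast_prod, Real.log_prod]
  intro p hp
  rw [Nat.mem_primesLE] at hp
  have := hp.2.pos
  positivity

lemma Setup.cc_le {n k b : ℕ} {a x : ℕ → ℕ} (S : Setup n k b a x) {p : ℕ} (hp : p.Prime) :
    cc k b a p ≤ padicValNat p (k - 1).factorial + 1 := by
  have h1 : cc k b a p ≤ ((Finset.range k).filter (fun i => p ∣ n + i)).card := by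
    apply Finset.card_le_card
    intro i hi
    simp only [Finset.mem_filter, Finset.mem_erase, Finset.mem_range] at hi ⊢
    exact ⟨hi.1.2, S.dvd_term hi.1.2 hi.2⟩
  have h2 := card_mult n k p hp.pos
  have h3 := div_le_fact_val hp (k - 1)
  have hb := S.hb
  have h4 : (k + p - 1) / p = (k - 1) / p + 1 := by
    rw [show k + p - 1 = (k - 1) + p by omega, Nat.add_div_right _ hp.pos]
  omega

lemma Setup.odd_of_dvd {n k b : ℕ} {a x : ℕ → ℕ} (S : Setup n k b a x) {p i : ℕ} (hp : p.Prime)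
    (hi : i < k) (h : p ∣ a i) : Odd (padicValNat p (n + i)) := by
  have := Fact.mk hp
  have hs := S.sqf i hi
  have hn := S.hn
  have e := S.eq i hi
  have hx : x i ≠ 0 := by
    intro h0; rw [h0] at e; simp at e; omega
  have h1 : padicValNat p (a i) = 1 := by
    rw [← Nat.factorization_def _ hp]
    have h2 := hs.natFactorization_le_one p
    have h3 := (hp.dvd_iff_one_le_factorization hs.ne_zero).mp h
    omega
  rw [e, padicValNat.mul hs.ne_zero (pow_ne_zero 2 hx), padicValNat.pow, h1]
  exact ⟨padicValNat p (x i), by ring⟩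

lemma Setup.cc_le_oc {n k b : ℕ} {a x : ℕ → ℕ} (S : Setup n k b a x) {p : ℕ} (hp : p.Prime) :
    cc k b a p ≤ oc p n (n + k) := by
  unfold cc oc
  apply Finset.card_le_card_of_injOn (fun i => n + i)
  · intro i hi
    simp only [Finset.coe_filter, Finset.mem_erase, Finset.mem_range, Set.mem_ofPred_eq,
      Finset.mem_Ico] at hi ⊢
    exact ⟨by omega, S.odd_of_dvd hp hi.1.2 hi.2⟩
  · intro i _ j _ h
    simpa using h

lemma Setup.cc_log {n k b : ℕ} {a x : ℕ → ℕ} (S : Setup n k b a x) {p : ℕ} (hp : p.Prime)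
    (hk : 2 ≤ k) :
    ((p : ℝ) + 1) * (cc k b a p * Real.log p) ≤
      (k + 2 * p - 1) * Real.log p + (p - 1) * Real.log k := by
  have hn := S.hn
  have h0 := S.cc_le_oc hp
  have h1 := (oc_bound hp (Nat.clog p k) n (n + k) (by omega) (by omega)
    (by rw [Nat.add_sub_cancel_left]; exact Nat.le_pow_clog hp.one_lt k)).1
  rw [Nat.add_sub_cancel_left] at h1
  have ht : 1 ≤ Nat.clog p k := Nat.clog_pos hp.one_lt hk
  obtain ⟨t, ht'⟩ : ∃ t, Nat.clog p k = t + 1 := ⟨Nat.clog p k - 1, by omega⟩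
  rw [ht'] at h1
  have h2 : p ^ t < k := by
    have := Nat.pow_pred_clog_lt_self hp.one_lt hk
    rw [ht'] at this
    simpa using this
  have h3 : (t : ℝ) * Real.log p ≤ Real.log k := by
    rw [← Real.log_pow]
    apply Real.log_le_log
    · have := hp.pos; positivity
    · exact_mod_cast h2.le
  have h4 : (p + 1) * cc k b a p ≤ k + (p - 1) * (t + 1) + p :=
    (Nat.mul_le_mul_left _ h0).trans h1
  have h5 : ((p : ℝ) + 1) * cc k b a p ≤ k + (p - 1) * (t + 1) + p := by
    have h6 : (((p + 1) * cc k b a p : ℕ) : ℝ) ≤ ((k + (p - 1) * (t + 1) + p : ℕ) : ℝ) := by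
      exact_mod_cast h4
    push_cast [Nat.cast_sub hp.one_lt.le] at h6
    exact h6
  have hl : 0 ≤ Real.log p := Real.log_natCast_nonneg p
  have h7 := mul_le_mul_of_nonneg_right h5 hl
  have hp1 : (0 : ℝ) ≤ (p : ℝ) - 1 := by
    have : (1 : ℝ) ≤ p := by exact_mod_cast hp.one_lt.le
    linarith
  have h8 := mul_le_mul_of_nonneg_left h3 hp1
  nlinarith

lemma fact_log {k p : ℕ} (hp : p.Prime) (hk : 2 ≤ k) :
    ((k : ℝ) - 1) * Real.log p ≤ (p - 1) * (padicValNat p (k - 1).factorial * Real.log p) +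
      (p - 1) * Real.log k + (p - 1) * Real.log p := by
  have h1 := fact_val hp (m := k - 1) (by omega)
  have h2 : p ^ Nat.log p (k - 1) ≤ k - 1 := Nat.pow_log_le_self p (by omega)
  have h3 : (Nat.log p (k - 1) : ℝ) * Real.log p ≤ Real.log k := by
    rw [← Real.log_pow]
    apply Real.log_le_log
    · have := hp.pos; positivity
    · exact_mod_cast h2.trans (by omega)
  have h5 : (k : ℝ) - 1 ≤ (p - 1) * padicValNat p (k - 1).factorial +
      (p - 1) * (Nat.log p (k - 1) + 1) := by
    have h6 : ((k - 1 : ℕ) : ℝ) ≤ (((p - 1) * padicValNat p (k - 1).factorial +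
      (p - 1) * (Nat.log p (k - 1) + 1) : ℕ) : ℝ) := by exact_mod_cast h1
    push_cast [Nat.cast_sub hp.one_lt.le, Nat.cast_sub (show 1 ≤ k by omega)] at h6
    exact h6
  have hl : 0 ≤ Real.log p := Real.log_natCast_nonneg p
  have h7 := mul_le_mul_of_nonneg_right h5 hl
  have hp1 : (0 : ℝ) ≤ (p : ℝ) - 1 := by
    have : (1 : ℝ) ≤ p := by exact_mod_cast hp.one_lt.le
    linarith
  have h8 := mul_le_mul_of_nonneg_left h3 hp1
  nlinarith

lemma log_primorial_le {k : ℕ} (hk : 6 ≤ k) : Real.log (primorial k : ℝ) ≤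
    k * Real.log 2 + k / 2 * Real.log 3 + 2 * Real.log k + 2 * Real.log 2 := by
  have h1 := primorial_six (k / 6) (k % 6) (by omega) (by omega)
  rw [Nat.div_add_mod] at h1
  have h2 : primorial k ≤ 1728 ^ (k / 6) * ((2 * k) * (2 * k)) := by
    refine h1.trans ?_
    gcongr <;> omega
  have hk0 : (0 : ℝ) < k := by positivity
  have h3 : Real.log (primorial k : ℝ) ≤
      Real.log (1728 ^ (k / 6) * ((2 * (k : ℝ)) * (2 * k))) := by
    apply Real.log_le_log
    · exact_mod_cast primorial_pos k
    · exact_mod_cast h2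
  rw [Real.log_mul (by positivity) (by positivity), Real.log_mul (by positivity) (by positivity),
    Real.log_mul (by norm_num) hk0.ne', Real.log_pow] at h3
  have h4 : Real.log (1728 : ℝ) = 6 * Real.log 2 + 3 * Real.log 3 := by
    rw [show (1728 : ℝ) = 2 ^ 6 * 3 ^ 3 by norm_num, Real.log_mul (by norm_num) (by norm_num),
      Real.log_pow, Real.log_pow]
    norm_num
  have h5 : ((k / 6 : ℕ) : ℝ) ≤ k / 6 := by
    have := @Nat.cast_div_le ℝ _ _ _ k 6
    simpa using this
  have h6 : 0 ≤ Real.log 2 := Real.log_nonneg (by norm_num)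
  have h7 : 0 ≤ Real.log 3 := Real.log_nonneg (by norm_num)
  rw [h4] at h3
  have h8 := mul_le_mul_of_nonneg_right h5 (show 0 ≤ 6 * Real.log 2 + 3 * Real.log 3 by positivity)
  linarith

lemma Setup.lower {n k b : ℕ} {a x : ℕ → ℕ} (S : Setup n k b a x) (hk : 6 ≤ k) :
    (k - 3) * Real.log (3 / 2) + Real.log ((k - 3).factorial : ℝ) ≤
      ∑ i ∈ (Finset.range k).erase b, Real.log (a i) := by
  have hinj : Set.InjOn a ((Finset.range k).erase b : Finset ℕ) := by
    intro i hi j hj h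
    simp only [Finset.coe_erase, Finset.coe_range, Set.mem_sdiff, Set.mem_Iio] at hi hj
    exact S.inj hi.1 hj.1 h
  have h1 := sqf_prod (k - 3) (((Finset.range k).erase b).image a) (by
    intro m hm
    simp only [Finset.mem_image, Finset.mem_erase, Finset.mem_range] at hm
    obtain ⟨i, hi, rfl⟩ := hm
    exact S.sqf i hi.2) (by
    rw [Finset.card_image_of_injOn hinj, Finset.card_erase_of_mem (Finset.mem_range.mpr S.hb),
      Finset.card_range]
    omega)
  rw [Finset.prod_image hinj] at h1
  have h2 := Real.log_le_log (by positivity) h1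
  rw [Real.log_mul (by positivity) (by positivity), Real.log_pow, Real.log_prod] at h2
  · push_cast [Nat.cast_sub (show 3 ≤ k by omega)] at h2
    exact h2
  · intro i hi
    rw [Finset.mem_erase, Finset.mem_range] at hi
    exact_mod_cast (S.sqf i hi.2).ne_zero

lemma log_pow_le {u v : ℝ} (hu : 0 < u) (hv : 0 < v) (s t : ℕ) (h : u ^ s ≤ v ^ t) :
    s * Real.log u ≤ t * Real.log v := by
  rw [← Real.log_pow, ← Real.log_pow]
  exact Real.log_le_log (by positivity) h

lemma Setup.large {n k b : ℕ} {a x : ℕ → ℕ} (S : Setup n k b a x) (hk : 801 ≤ k) : False := by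
  have hlow := S.lower (by omega)
  have hprim := log_primorial_le (show 6 ≤ k by omega)
  rw [S.log_sum] at hlow
  have hkR : (801 : ℝ) ≤ k := by exact_mod_cast hk
  have hfac : Real.log ((k - 1).factorial : ℝ) ≤ Real.log ((k - 3).factorial : ℝ)
      + 2 * Real.log k := by
    have e : (k - 1).factorial ≤ (k - 3).factorial * (k * k) := by
      obtain ⟨m, rfl⟩ : ∃ m, k = m + 3 := ⟨k - 3, by omega⟩
      rw [show m + 3 - 1 = m + 1 + 1 by omega, Nat.add_sub_cancel, Nat.factorial_succ,
        Nat.factorial_succ]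
      calc (m + 1 + 1) * ((m + 1) * m.factorial) = m.factorial * ((m + 2) * (m + 1)) := by ring
        _ ≤ _ := by gcongr <;> omega
    have e2 : Real.log ((k - 1).factorial : ℝ) ≤ Real.log ((k - 3).factorial * ((k : ℝ) * k)) := by
      apply Real.log_le_log
      · positivity
      · exact_mod_cast e
    rw [Real.log_mul (by positivity) (by positivity), Real.log_mul (by positivity) (by positivity)]
      at e2
    linarith
  rw [log_fact (show k - 1 ≤ k by omega)] at hfac
  rw [log_primorial] at hprim
  set Q : Finset ℕ := {2, 3, 5, 7} with hQ
  have hsub : Q ⊆ Nat.primesLE k := by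
    intro p hp
    simp only [hQ, Finset.mem_insert, Finset.mem_singleton] at hp
    rw [Nat.mem_primesLE]
    rcases hp with rfl | rfl | rfl | rfl <;> exact ⟨by omega, by norm_num⟩
  have hmain : ∑ p ∈ Nat.primesLE k, ((cc k b a p : ℝ) * Real.log p
      - (padicValNat p (k - 1).factorial : ℝ) * Real.log p - Real.log p) ≤
      ∑ p ∈ Q, ((cc k b a p : ℝ) * Real.log p
      - (padicValNat p (k - 1).factorial : ℝ) * Real.log p - Real.log p) := by
    rw [← Finset.sum_sdiff hsub]
    have : ∑ p ∈ Nat.primesLE k \ Q, ((cc k b a p : ℝ) * Real.log p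
      - (padicValNat p (k - 1).factorial : ℝ) * Real.log p - Real.log p) ≤ 0 := by
      apply Finset.sum_nonpos
      intro p hp
      rw [Finset.mem_sdiff, Nat.mem_primesLE] at hp
      have h1 : (cc k b a p : ℝ) ≤ padicValNat p (k - 1).factorial + 1 := by
        exact_mod_cast S.cc_le hp.1.2
      have h2 := mul_le_mul_of_nonneg_right h1 (Real.log_natCast_nonneg p)
      linarith
    linarith
  rw [Finset.sum_sub_distrib, Finset.sum_sub_distrib] at hmain
  have hQs : ∀ f : ℕ → ℝ, ∑ p ∈ Q, f p = f 2 + (f 3 + (f 5 + f 7)) := by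
    intro f
    rw [hQ, Finset.sum_insert (by decide), Finset.sum_insert (by decide),
      Finset.sum_insert (by decide), Finset.sum_singleton]
  rw [hQs] at hmain
  have c2 := S.cc_log Nat.prime_two (by omega)
  have c3 := S.cc_log Nat.prime_three (by omega)
  have c5 := S.cc_log Nat.prime_five (by omega)
  have c7 := S.cc_log (show Nat.Prime 7 by norm_num) (by omega)
  have v2 := fact_log (k := k) Nat.prime_two (by omega)
  have v3 := fact_log (k := k) Nat.prime_three (by omega)
  have v5 := fact_log (k := k) Nat.prime_five (by omega)
  have v7 := fact_log (k := k) (show Nat.Prime 7 by norm_num) (by omega)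
  push_cast at hmain c2 c3 c5 c7 v2 v3 v5 v7
  have h32 : Real.log (3 / 2) = Real.log 3 - Real.log 2 :=
    Real.log_div (by norm_num) (by norm_num)
  rw [h32] at hlow
  have lk : Real.log k ≤ 10 * Real.log 2 + k / 1024 - 1 := by
    have h1 := Real.log_le_sub_one_of_pos (show (0 : ℝ) < k / 1024 by positivity)
    rw [Real.log_div (by positivity) (by norm_num), show (1024 : ℝ) = 2 ^ 10 by norm_num,
      Real.log_pow] at h1
    push_cast at h1
    linarith
  have l3 := log_pow_le (u := 2) (v := 3) (by norm_num) (by norm_num) 19 12 (by norm_num)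
  have l5 := log_pow_le (u := 2) (v := 5) (by norm_num) (by norm_num) 16 7 (by norm_num)
  have l7 := log_pow_le (u := 2) (v := 7) (by norm_num) (by norm_num) 14 5 (by norm_num)
  have u3 := log_pow_le (u := 3) (v := 2) (by norm_num) (by norm_num) 5 8 (by norm_num)
  have u5 := log_pow_le (u := 5) (v := 2) (by norm_num) (by norm_num) 3 7 (by norm_num)
  have u7 := log_pow_le (u := 7) (v := 2) (by norm_num) (by norm_num) 6 17 (by norm_num)
  push_cast at l3 l5 l7 u3 u5 u7
  have g2 := Real.log_two_gt_d9
  have g2' := Real.log_two_lt_d9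
  have hk0 : (0 : ℝ) ≤ k := by positivity
  have m2 := mul_le_mul_of_nonneg_left (show (0.6931 : ℝ) ≤ Real.log 2 by linarith) hk0
  have m3 := mul_le_mul_of_nonneg_left l3 hk0
  have m5 := mul_le_mul_of_nonneg_left l5 hk0
  have m7 := mul_le_mul_of_nonneg_left l7 hk0
  clear_value Q
  generalize Real.log 2 = L2 at *
  generalize Real.log 3 = L3 at *
  generalize Real.log 5 = L5 at *
  generalize Real.log 7 = L7 at *
  generalize Real.log k = LK at *
  ring_nf at *
  linarith

end TwoTerms

namespace TwoTerms

lemma odd_of_sqf_dvd {m a x p : ℕ} (hm : m ≠ 0) (e : m = a * x ^ 2) (hs : Squarefree a)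
    (hp : p.Prime) (h : p ∣ a) : Odd (padicValNat p m) := by
  have := Fact.mk hp
  have hx : x ≠ 0 := by
    intro h0; rw [h0] at e; simp at e; omega
  have h1 : padicValNat p a = 1 := by
    rw [← Nat.factorization_def _ hp]
    have h2 := hs.natFactorization_le_one p
    have h3 := (hp.dvd_iff_one_le_factorization hs.ne_zero).mp h
    omega
  rw [e, padicValNat.mul hs.ne_zero (pow_ne_zero 2 hx), padicValNat.pow, h1]
  exact ⟨padicValNat p x, by ring⟩

lemma Setup.absurd {n k b : ℕ} {a x : ℕ → ℕ} (S : Setup n k b a x) (hk : 6 ≤ k) : False := by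
  rcases Nat.lt_or_ge k 9 with h | h
  · have : k = 6 ∨ k = 7 ∨ k = 8 := by omega
    rcases this with rfl | rfl | rfl
    · exact S.k6
    · exact S.k7
    · exact S.k8
  · rcases Nat.lt_or_ge k 801 with h' | h'
    · exact S.mid h (by omega)
    · exact S.large h'

end TwoTerms

theorem two_terms_with_prime_to_odd_power (n k : ℕ) (hk : 6 ≤ k) (hn : k ^ 2 < n) :
    ∃ r s : ℕ, r < s ∧ s ≤ k - 1 ∧
      (∃ p : ℕ, p.Prime ∧ k < p ∧ Odd (padicValNat p (n + r))) ∧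
      (∃ q : ℕ, q.Prime ∧ k < q ∧ Odd (padicValNat q (n + s))) := by
  by_contra hcon
  have hex : ∀ m : ℕ, ∃ a x : ℕ, m = a * x ^ 2 ∧ Squarefree a := by
    intro m
    obtain ⟨a, b, h1, h2⟩ := Nat.sq_mul_squarefree m
    exact ⟨a, b, by rw [← h1]; ring, h2⟩
  choose f g hfg hf using hex
  have hbad : ∃ b, b < k ∧ ∀ i, i < k → i ≠ b →
      ∀ p : ℕ, p.Prime → Odd (padicValNat p (n + i)) → p ≤ k := by
    by_cases hb : ∃ b, b < k ∧ ∃ p : ℕ, p.Prime ∧ k < p ∧ Odd (padicValNat p (n + b))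
    · obtain ⟨b, hbk, hq⟩ := hb
      refine ⟨b, hbk, fun i hi hib p hp ho => ?_⟩
      by_contra hlt
      rw [not_le] at hlt
      apply hcon
      rcases Nat.lt_or_ge i b with h | h
      · exact ⟨i, b, h, by omega, ⟨p, hp, hlt, ho⟩, hq⟩
      · exact ⟨b, i, by omega, by omega, hq, ⟨p, hp, hlt, ho⟩⟩
    · refine ⟨0, by omega, fun i hi _ p hp ho => ?_⟩
      by_contra hlt
      exact hb ⟨i, hi, p, hp, by omega, ho⟩
  obtain ⟨b, hbk, hb⟩ := hbad
  have S : TwoTerms.Setup n k b (fun i => f (n + i)) (fun i => g (n + i)) :=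
    { hn := hn
      hb := hbk
      eq := fun i _ => hfg (n + i)
      sqf := fun i _ => hf (n + i)
      sm := fun i hi hib p hp h => hb i hi hib p hp
        (TwoTerms.odd_of_sqf_dvd (by omega) (hfg (n + i)) (hf (n + i)) hp h) }
  exact S.absurd hk
end

section
/- Let n, k be positive integers with n ≥ k+2 ≥ 4. Suppose there exists a prime p > k such that p^e exactly divides n−l for some l with 1 ≤ l ≤ k−1 (i.e., e = ord_p(n−l) ≥ 1). Set d = gcd(e, l) and d' = gcd(e, k−l). Then F_{n,k}(x) has at least two non-associate irreducible factors over the p-adic field ℚ_p; one of them has degree a multiple of l/d and the other has degree a multiple of (k−l)/d'. -/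
open Polynomial

/-- `F n k a = ∑_{j=0}^{k} a_j c_j x^j` as a polynomial over the `p`-adic field `ℚ_p`. -/
noncomputable def Fp (p : ℕ) [Fact p.Prime] (n k : ℕ) (a : ℕ → ℤ) : Polynomial ℚ_[p] :=
  ∑ j ∈ Finset.range (k + 1), Polynomial.C ((a j * c n k j : ℤ) : ℚ_[p]) * Polynomial.X ^ j

theorem choose_identity (n k j : ℕ) (hn : k + 2 ≤ n) (hj : j ≤ k) :
    n.descFactorial (k + 1)
      = (n - j) * (n.choose j * (n - j - 1).choose (k - j)) * (j.factorial * (k - j).factorial) := by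
  have h1 := Nat.descFactorial_mul_descFactorial (n := n) (k := j) (m := k + 1) (by omega)
  have h2 : (n - j).descFactorial (k + 1 - j) = (n - j) * (n - j - 1).descFactorial (k - j) := by
    obtain ⟨m, hm⟩ : ∃ m, n - j = m + 1 := ⟨n - j - 1, by omega⟩
    rw [hm, show k + 1 - j = (k - j) + 1 by omega, Nat.succ_descFactorial_succ]
    rfl
  rw [← h1, h2, Nat.descFactorial_eq_factorial_mul_choose, Nat.descFactorial_eq_factorial_mul_choose]
  ring

section
variable (p : ℕ) [hp : Fact p.Prime]

theorem norm_nat_one (m : ℕ) (h : ¬ p ∣ m) : ‖(m : ℚ_[p])‖ = 1 := by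
  rw [Padic.norm_natCast_eq_one_iff]
  exact (Nat.Prime.coprime_iff_not_dvd hp.out).2 h

theorem not_dvd_sub (n k : ℕ) (hn : n ≥ k + 2) (hpk : k < p)
    (l : ℕ) (hl2 : l ≤ k) (hpl : p ∣ (n - l)) (j : ℕ) (hj : j ≤ k) (hjl : j ≠ l) :
    ¬ p ∣ (n - j) := by
  intro h
  rcases lt_or_gt_of_ne hjl with h1 | h1
  · have := Nat.dvd_sub h hpl
    have := Nat.le_of_dvd (by omega) this
    omega
  · have := Nat.dvd_sub hpl h
    have := Nat.le_of_dvd (by omega) this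
    omega

theorem norm_coeff (n k : ℕ) (hn : n ≥ k + 2) (hpk : k < p)
    (l : ℕ) (hl2 : l ≤ k) (hpl : p ∣ (n - l))
    (e : ℕ) (he : e = padicValNat p (n - l))
    (a : ℕ → ℤ) (ha : ∀ j ≤ k, a j ≠ 0 ∧ ∀ q : ℕ, q.Prime → (q : ℤ) ∣ a j → q ≤ k)
    (j : ℕ) (hj : j ≤ k) :
    ‖((a j * c n k j : ℤ) : ℚ_[p])‖ = if j = l then 1 else ((p : ℝ) ^ e)⁻¹ := by
  have hnl : ‖((n - l : ℕ) : ℚ_[p])‖ = ((p : ℝ) ^ e)⁻¹ := by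
    rw [Padic.norm_eq_zpow_neg_valuation (by
      have : n - l ≠ 0 := by omega
      exact_mod_cast this), Padic.valuation_natCast, ← he, zpow_neg, zpow_natCast]
  have hpe : ((p : ℝ) ^ e)⁻¹ ≠ 0 := by
    have : (p : ℝ) ≠ 0 := by exact_mod_cast hp.out.ne_zero
    positivity
  have hother : ∀ i ≤ k, i ≠ l → ‖((n - i : ℕ) : ℚ_[p])‖ = 1 := fun i hi hil =>
    norm_nat_one p _ (not_dvd_sub p n k hn hpk l hl2 hpl i hi hil)
  have haj : ‖((a j : ℤ) : ℚ_[p])‖ = 1 := by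
    apply le_antisymm (Padic.norm_int_le_one _)
    by_contra h
    rw [not_le, Padic.norm_intCast_lt_one_iff] at h
    have := (ha j hj).2 p hp.out h
    omega
  have hfac : ∀ i ≤ k, ‖((i.factorial : ℕ) : ℚ_[p])‖ = 1 := fun i hi =>
    norm_nat_one p _ (by rw [hp.out.dvd_factorial]; omega)
  have hD : ‖((n.descFactorial (k + 1) : ℕ) : ℚ_[p])‖ = ((p : ℝ) ^ e)⁻¹ := by
    rw [Nat.descFactorial_eq_prod_range, Nat.cast_prod, norm_prod,
      Finset.prod_eq_single l, hnl]
    · intro b hb hbl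
      exact hother b (by simpa [Nat.lt_succ_iff] using hb) hbl
    · intro h
      simp at h
      omega
  rw [choose_identity n k j hn hj] at hD
  simp only [Nat.cast_mul, norm_mul, hfac j hj, hfac (k - j) (by omega), mul_one] at hD
  unfold c
  push_cast
  simp only [norm_mul, haj, norm_pow, norm_neg, norm_one, one_pow, one_mul]
  split_ifs with h
  · subst h
    rw [hnl] at hD
    exact mul_left_cancel₀ hpe (by rw [hD, mul_one])
  · rw [hother j hj h, one_mul] at hD
    exact hD

theorem degree_dvd (x : PadicAlgCl p) (hx : x ≠ 0) (l : ℕ) (hl : 0 < l) (s : ℤ)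
    (h : ‖x‖ ^ l = (p : ℝ) ^ s) :
    (l / Nat.gcd s.natAbs l) ∣ (minpoly ℚ_[p] x).natDegree := by
  have hint : IsIntegral ℚ_[p] x := (PadicAlgCl.isAlgebraic p).isAlgebraic x |>.isIntegral
  set g := minpoly ℚ_[p] x with hg
  have hgm : g.Monic := minpoly.monic hint
  set G := g.map (algebraMap ℚ_[p] (PadicAlgCl p)) with hG
  have hspl : G.Splits := IsAlgClosed.splits G
  have hGm : G.Monic := hgm.map _
  have h0 := hspl.coeff_zero_eq_prod_roots_of_monic hGm
  have hnorm : ∀ y ∈ G.roots, ‖y‖ = ‖x‖ := by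
    intro y hy
    have hy0 : Polynomial.aeval y g = 0 := by
      have := (Polynomial.mem_roots hGm.ne_zero).1 hy
      rwa [IsRoot.def, hG, Polynomial.eval_map_algebraMap] at this
    have hmin : minpoly ℚ_[p] y = g :=
      (minpoly.eq_of_irreducible_of_monic (minpoly.irreducible hint) hy0 hgm).symm
    rw [← PadicAlgCl.spectralNorm_eq, ← PadicAlgCl.spectralNorm_eq, spectralNorm, spectralNorm, hmin]
  have hprod : ‖G.roots.prod‖ = ‖x‖ ^ g.natDegree := by
    have h1 : ‖G.roots.prod‖ = (G.roots.map (fun y => ‖y‖)).prod :=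
      map_multiset_prod (normHom (α := PadicAlgCl p)) _
    rw [h1, Multiset.map_congr rfl hnorm, Multiset.map_const', Multiset.prod_replicate,
      ← hspl.natDegree_eq_card_roots, hG, Polynomial.natDegree_map]
  have hc : ‖g.coeff 0‖ = ‖x‖ ^ g.natDegree := by
    have := congrArg norm h0
    rw [norm_mul, hprod, hG, Polynomial.coeff_map, norm_algebraMap'] at this
    simpa using this
  have hc0 : g.coeff 0 ≠ 0 := minpoly.coeff_zero_ne_zero hint hx
  rw [Padic.norm_eq_zpow_neg_valuation hc0] at hc
  have hp1 : (1 : ℝ) < p := by exact_mod_cast hp.out.one_lt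
  have key : (p : ℝ) ^ (-(g.coeff 0).valuation * l) = (p : ℝ) ^ (s * g.natDegree) := by
    rw [zpow_mul, zpow_mul, zpow_natCast, zpow_natCast, hc, ← h, ← pow_mul, ← pow_mul, mul_comm]
  have key2 := zpow_right_injective₀ (by linarith) hp1.ne' key
  have hd : (l : ℤ) ∣ s * g.natDegree := ⟨-(g.coeff 0).valuation, by rw [← key2]; ring⟩
  have hd' : l ∣ s.natAbs * g.natDegree := by
    have := Int.natCast_dvd.1 hd
    simpa [Int.natAbs_mul] using this
  have hgpos : 0 < Nat.gcd s.natAbs l := Nat.gcd_pos_of_pos_right _ hl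
  have hco : Nat.Coprime (l / Nat.gcd s.natAbs l) (s.natAbs / Nat.gcd s.natAbs l) :=
    (Nat.coprime_div_gcd_div_gcd hgpos).symm
  apply hco.dvd_of_dvd_mul_left
  obtain ⟨u, hu⟩ := Nat.gcd_dvd_left s.natAbs l
  obtain ⟨v, hv⟩ := Nat.gcd_dvd_right s.natAbs l
  generalize Nat.gcd s.natAbs l = d at *
  rw [hu, hv] at hd'
  rw [hu, hv, Nat.mul_div_cancel_left _ hgpos, Nat.mul_div_cancel_left _ hgpos]
  rw [mul_assoc] at hd'
  exact Nat.dvd_of_mul_dvd_mul_left hgpos hd'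

/-- A root cannot have a strictly dominating term. -/
theorem no_dominant (k : ℕ) (T : ℕ → PadicAlgCl p) (h0 : ∑ j ∈ Finset.range (k + 1), T j = 0)
    (i : ℕ) (hi : i ≤ k) (hdom : ∀ j ≤ k, j ≠ i → ‖T j‖ < ‖T i‖) (hpos : 0 < ‖T i‖) : False := by
  have h := (PadicAlgCl.isNonarchimedean p).apply_sum_eq_of_lt (fun a => (norm_neg a).symm)
    (s := Finset.range (k + 1)) (l := T) (k := i) (by simp; omega)
    (fun j hj hji => hdom j (by simpa [Nat.lt_succ_iff] using hj) hji)
  rw [h0, norm_zero] at h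
  linarith

theorem root_norm (k l : ℕ) (hl1 : 1 ≤ l) (hl2 : l < k) (f : ℕ → ℚ_[p]) (r : ℝ) (hr0 : 0 < r)
    (hr1 : r < 1) (hf : ∀ j ≤ k, ‖f j‖ = if j = l then 1 else r)
    (x : PadicAlgCl p)
    (hx : ∑ j ∈ Finset.range (k + 1), algebraMap ℚ_[p] (PadicAlgCl p) (f j) * x ^ j = 0) :
    (‖x‖ < 1 ∧ ‖x‖ ^ l = r) ∨ (1 < ‖x‖ ∧ ‖x‖ ^ (k - l) = r⁻¹) := by
  set t := ‖x‖ with ht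
  have ht0 : 0 ≤ t := norm_nonneg x
  have hT : ∀ j ≤ k, ‖algebraMap ℚ_[p] (PadicAlgCl p) (f j) * x ^ j‖
      = (if j = l then 1 else r) * t ^ j := by
    intro j hj
    rw [norm_mul, norm_algebraMap', norm_pow, hf j hj]
  have nd := no_dominant p k _ hx
  have nd' : ∀ i ≤ k, (∀ j ≤ k, j ≠ i →
      (if j = l then 1 else r) * t ^ j < (if i = l then 1 else r) * t ^ i) →
      0 < (if i = l then 1 else r) * t ^ i → False := by
    intro i hi h1 h2
    refine nd i hi ?_ ?_
    · intro j hj hji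
      simp only [hT j hj, hT i hi]
      exact h1 j hj hji
    · simp only [hT i hi]
      exact h2
  rcases lt_trichotomy t 1 with h | h | h
  · left
    refine ⟨h, ?_⟩
    rcases lt_trichotomy (t ^ l) r with h1 | h1 | h1
    · exfalso
      refine nd' 0 (by omega) ?_ ?_
      · intro j hj hj0
        rw [if_neg (by omega : ¬ 0 = l)]
        split_ifs with hjl
        · subst hjl; simpa using h1
        · have := pow_lt_one₀ ht0 h hj0
          nlinarith
      · rw [if_neg (by omega : ¬ 0 = l)]; simpa using hr0
    · exact h1
    · exfalso
      refine nd' l (by omega) ?_ ?_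
      · intro j hj hjl
        rw [if_neg hjl, if_pos rfl, one_mul]
        have := pow_le_one₀ ht0 h.le (n := j)
        nlinarith
      · simp; linarith
  · exfalso
    refine nd' l (by omega) ?_ ?_
    · intro j hj hjl
      rw [if_neg hjl, if_pos rfl, h]
      simpa using hr1
    · simp [h]
  · right
    refine ⟨h, ?_⟩
    have hkl : t ^ k = t ^ (k - l) * t ^ l := by rw [← pow_add]; congr 1; omega
    have htl : 0 < t ^ l := by positivity
    have htk : 0 < t ^ k := by positivity
    rcases lt_trichotomy (r * t ^ (k - l)) 1 with h1 | h1 | h1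
    · exfalso
      refine nd' l (by omega) ?_ ?_
      · intro j hj hjl
        rw [if_neg hjl, if_pos rfl, one_mul]
        have : t ^ j ≤ t ^ k := pow_le_pow_right₀ h.le hj
        calc r * t ^ j ≤ r * t ^ k := by gcongr
          _ = (r * t ^ (k - l)) * t ^ l := by rw [hkl]; ring
          _ < 1 * t ^ l := by gcongr
          _ = t ^ l := one_mul _
      · simp [htl]
    · exact eq_inv_of_mul_eq_one_right h1
    · exfalso
      refine nd' k le_rfl ?_ ?_
      · intro j hj hjk
        rw [if_neg (by omega : ¬ k = l)]
        split_ifs with hjl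
        · subst hjl
          calc 1 * t ^ j < (r * t ^ (k - j)) * t ^ j := by gcongr
            _ = r * t ^ k := by rw [hkl]; ring
        · have : t ^ j < t ^ k := pow_lt_pow_right₀ h (by omega)
          gcongr
      · rw [if_neg (by omega : ¬ k = l)]; positivity

end

theorem multiset_prod_lt_one (s : Multiset ℝ) (hs : s ≠ 0) (h : ∀ x ∈ s, 0 ≤ x ∧ x < 1) :
    0 ≤ s.prod ∧ s.prod < 1 := by
  induction s using Multiset.induction with
  | empty => exact absurd rfl hs
  | cons a s ih =>
    have ha := h a (Multiset.mem_cons_self a s)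
    rw [Multiset.prod_cons]
    by_cases h0 : s = 0
    · subst h0; simpa using ha
    · have := ih h0 (fun x hx => h x (Multiset.mem_cons_of_mem hx))
      exact ⟨mul_nonneg ha.1 this.1, by nlinarith [ha.1, ha.2, this.1, this.2]⟩

theorem multiset_one_lt_prod (s : Multiset ℝ) (hs : s ≠ 0) (h : ∀ x ∈ s, 1 < x) :
    1 < s.prod := by
  induction s using Multiset.induction with
  | empty => exact absurd rfl hs
  | cons a s ih =>
    have ha := h a (Multiset.mem_cons_self a s)
    rw [Multiset.prod_cons]
    by_cases h0 : s = 0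
    · subst h0; simpa using ha
    · have := ih h0 (fun x hx => h x (Multiset.mem_cons_of_mem hx))
      nlinarith

theorem F_two_nonassociate_irreducible_factors (n k : ℕ) (hk : k + 2 ≥ 4) (hn : n ≥ k + 2)
    (p : ℕ) [hp : Fact p.Prime] (hpk : k < p)
    (l : ℕ) (hl1 : 1 ≤ l) (hl2 : l ≤ k - 1) (hpl : p ∣ (n - l))
    (e : ℕ) (he : e = padicValNat p (n - l))
    (a : ℕ → ℤ) (ha : ∀ j ≤ k, a j ≠ 0 ∧ ∀ q : ℕ, q.Prime → (q : ℤ) ∣ a j → q ≤ k) :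
    ∃ g h : Polynomial ℚ_[p], Irreducible g ∧ Irreducible h ∧
      g ∣ Fp p n k a ∧ h ∣ Fp p n k a ∧ ¬Associated g h ∧
      (l / Nat.gcd e l) ∣ g.natDegree ∧ ((k - l) / Nat.gcd e (k - l)) ∣ h.natDegree := by
  have he1 : e ≠ 0 := by
    have := one_le_padicValNat_of_dvd (by omega) hpl
    omega
  have hp1 : (1 : ℝ) < p := by exact_mod_cast hp.out.one_lt
  have hpe : (1 : ℝ) < (p : ℝ) ^ e := one_lt_pow₀ hp1 he1
  set r : ℝ := ((p : ℝ) ^ e)⁻¹ with hr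
  have hr0 : 0 < r := by positivity
  have hr1 : r < 1 := inv_lt_one_of_one_lt₀ hpe
  have hf := norm_coeff p n k hn hpk l (by omega) hpl e he a ha
  set f : ℕ → ℚ_[p] := fun j => ((a j * c n k j : ℤ) : ℚ_[p]) with hfdef
  have hf : ∀ j ≤ k, ‖f j‖ = if j = l then 1 else r := hf
  set F := Fp p n k a with hF
  have hFs : F = ∑ j ∈ Finset.range (k + 1), Polynomial.C (f j) * Polynomial.X ^ j := rfl
  have hcoeff : ∀ i, F.coeff i = if i ≤ k then f i else 0 := by
    intro i
    rw [hFs, Polynomial.finset_sum_coeff]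
    simp [Polynomial.coeff_X_pow, Nat.lt_succ_iff]
  have hfk : f k ≠ 0 := by
    rw [← norm_pos_iff, hf k le_rfl, if_neg (by omega)]; exact hr0
  have hdeg : F.natDegree = k := by
    apply Polynomial.natDegree_eq_of_le_of_coeff_ne_zero
    · rw [Polynomial.natDegree_le_iff_coeff_eq_zero]
      intro N hN
      rw [hcoeff, if_neg (by omega)]
    · rw [hcoeff, if_pos le_rfl]; exact hfk
  have hF0 : F ≠ 0 := by
    intro h; rw [h] at hdeg; simp at hdeg; omega
  set G := F.map (algebraMap ℚ_[p] (PadicAlgCl p)) with hG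
  have hG0 : G ≠ 0 := (Polynomial.map_ne_zero_iff (algebraMap ℚ_[p] (PadicAlgCl p)).injective).2 hF0
  have hspl : G.Splits := IsAlgClosed.splits G
  have hcard : G.roots.card = k := by
    rw [← hspl.natDegree_eq_card_roots, hG, Polynomial.natDegree_map, hdeg]
  have hroot : ∀ y ∈ G.roots, Polynomial.aeval y F = 0 := by
    intro y hy
    have := (Polynomial.mem_roots hG0).1 hy
    rwa [IsRoot.def, hG, Polynomial.eval_map_algebraMap] at this
  have hcases : ∀ y ∈ G.roots,
      (‖y‖ < 1 ∧ ‖y‖ ^ l = r) ∨ (1 < ‖y‖ ∧ ‖y‖ ^ (k - l) = r⁻¹) := by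
    intro y hy
    apply root_norm p k l hl1 (by omega) f r hr0 hr1 hf y
    have := hroot y hy
    rw [hFs] at this
    simpa using this
  have hprod : (G.roots.map (fun y => ‖y‖)).prod = 1 := by
    have h1 : ‖G.roots.prod‖ = (G.roots.map (fun y => ‖y‖)).prod :=
      map_multiset_prod (normHom (α := PadicAlgCl p)) _
    have h0 := congrArg norm hspl.coeff_zero_eq_leadingCoeff_mul_prod_roots
    have hlc : G.leadingCoeff = algebraMap ℚ_[p] (PadicAlgCl p) (f k) := by
      rw [Polynomial.leadingCoeff, hG, Polynomial.natDegree_map, Polynomial.coeff_map, hdeg, hcoeff,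
        if_pos le_rfl]
    rw [norm_mul, norm_mul, hlc, hG, Polynomial.coeff_map, hcoeff, norm_algebraMap',
      norm_algebraMap', if_pos (Nat.zero_le _), hf 0 (by omega), hf k le_rfl,
      if_neg (by omega), if_neg (by omega), ← hG, h1, norm_pow, norm_neg, norm_one, one_pow,
      one_mul] at h0
    exact mul_left_cancel₀ hr0.ne' (by rw [← h0, mul_one])
  have hne : G.roots.map (fun y => ‖y‖) ≠ 0 := by
    intro h
    have := congrArg Multiset.card h
    simp [hcard] at this
    omega
  obtain ⟨x, hx, hx1, hxl⟩ : ∃ x ∈ G.roots, ‖x‖ < 1 ∧ ‖x‖ ^ l = r := by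
    by_contra! hcon
    have := multiset_one_lt_prod _ hne (by
      intro z hz
      obtain ⟨y, hy, rfl⟩ := Multiset.mem_map.1 hz
      rcases hcases y hy with h | h
      · exact absurd h.2 (hcon y hy h.1)
      · exact h.1)
    linarith
  obtain ⟨y, hy, hy1, hyl⟩ : ∃ x ∈ G.roots, 1 < ‖x‖ ∧ ‖x‖ ^ (k - l) = r⁻¹ := by
    by_contra! hcon
    have := multiset_prod_lt_one _ hne (by
      intro z hz
      obtain ⟨y, hy, rfl⟩ := Multiset.mem_map.1 hz
      rcases hcases y hy with h | h
      · exact ⟨norm_nonneg _, h.1⟩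
      · exact absurd h.2 (hcon y hy h.1))
    linarith
  have hint : ∀ z : PadicAlgCl p, IsIntegral ℚ_[p] z := fun z =>
    (PadicAlgCl.isAlgebraic p).isAlgebraic z |>.isIntegral
  have hx0 : x ≠ 0 := by
    rintro rfl
    rw [norm_zero, zero_pow (by omega)] at hxl
    linarith
  have hy0 : y ≠ 0 := by
    rintro rfl
    rw [norm_zero] at hy1
    linarith
  refine ⟨minpoly ℚ_[p] x, minpoly ℚ_[p] y, minpoly.irreducible (hint x),
    minpoly.irreducible (hint y), minpoly.dvd _ _ (hroot x hx), minpoly.dvd _ _ (hroot y hy),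
    ?_, ?_, ?_⟩
  · intro hass
    have heq := Polynomial.eq_of_monic_of_associated (minpoly.monic (hint x))
      (minpoly.monic (hint y)) hass
    have : ‖x‖ = ‖y‖ := by
      rw [← PadicAlgCl.spectralNorm_eq, ← PadicAlgCl.spectralNorm_eq, spectralNorm, spectralNorm,
        heq]
    linarith
  · have := degree_dvd p x hx0 l (by omega) (-e) (by rw [hxl, hr, zpow_neg, zpow_natCast])
    simpa using this
  · have := degree_dvd p y hy0 (k - l) (by omega) e (by rw [hyl, hr, inv_inv, zpow_natCast])
    simpa using this
end
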